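/- If Ω is the open unit disc, there exist constants C > 0 and κ₀ > 0 such that for every κ ≥ κ₀, both the lower global critical field H_{C3}(κ) and the upper global critical field H̄_{C3}(κ) satisfy |H(κ) − κ/Θ₀ − C₁·Θ₀^{−3/2}| ≤ C·κ^{−1}. -/

import Mathlib

open MeasureTheory Filter Set Topology

noncomputable section

namespace SC

/-- The plane `ℝ²`. -/
abbrev Plane := ℝ × ℝ

/-- Squared Euclidean norm on the plane. -/
def esq (v : Plane) : ℝ := v.1 ^ 2 + v.2 ^ 2

/-- Euclidean dot product on the plane. -/
def dot2 (v w : Plane) : ℝ := v.1 * w.1 + v.2 * w.2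

/-- The reference vector potential `F₀(x) = (-x₂/2, x₁/2)`, with `curl F₀ = 1`. -/
def F0 : Plane → Plane := fun x => (-x.2 / 2, x.1 / 2)

/-- `u` is of class `Cⁿ` on a neighborhood of the closure of `Ω`. -/
def CNearCl {E : Type*} [NormedAddCommGroup E] [NormedSpace ℝ E]
    (n : ℕ) (Ω : Set Plane) (u : Plane → E) : Prop :=
  ∃ U : Set Plane, IsOpen U ∧ closure Ω ⊆ U ∧ ContDiffOn ℝ n u U

/-- The pointwise squared magnetic gradient `|(-i∇ - B·A)u|²`. -/
def magSq (B : ℝ) (A : Plane → Plane) (u : Plane → ℂ) (x : Plane) : ℝ :=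
  ‖(-Complex.I) * fderiv ℝ u x ((1 : ℝ), (0 : ℝ)) - ((B * (A x).1 : ℝ) : ℂ) * u x‖ ^ 2 +
  ‖(-Complex.I) * fderiv ℝ u x ((0 : ℝ), (1 : ℝ)) - ((B * (A x).2 : ℝ) : ℂ) * u x‖ ^ 2

/-- `curl A = ∂₁A₂ - ∂₂A₁`. -/
def curl2 (A : Plane → Plane) (x : Plane) : ℝ :=
  fderiv ℝ (fun y => (A y).2) x ((1 : ℝ), (0 : ℝ)) -
    fderiv ℝ (fun y => (A y).1) x ((0 : ℝ), (1 : ℝ))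

/-- The variational ground state energy `λ₁(B·A)` of the magnetic Neumann Laplacian. -/
def lam1A (Ω : Set Plane) (B : ℝ) (A : Plane → Plane) : ℝ :=
  sInf { r : ℝ | ∃ u : Plane → ℂ, CNearCl 1 Ω u ∧ (∫ x in Ω, ‖u x‖ ^ 2) ≠ 0 ∧
    r = (∫ x in Ω, magSq B A u x) / (∫ x in Ω, ‖u x‖ ^ 2) }

/-- `λ₁(B) = λ₁(B·F₀)`. -/
def lam1 (Ω : Set Plane) (B : ℝ) : ℝ := lam1A Ω B F0

/-- The Ginzburg–Landau energy functional. -/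
def GLenergy (Ω : Set Plane) (κ H : ℝ) (ψ : Plane → ℂ) (A : Plane → Plane) : ℝ :=
  ∫ x in Ω, (magSq (κ * H) A ψ x - κ ^ 2 * ‖ψ x‖ ^ 2 + κ ^ 2 / 2 * ‖ψ x‖ ^ 4
    + κ ^ 2 * H ^ 2 * (curl2 A x - 1) ^ 2)

/-- Admissible Ginzburg–Landau configurations. -/
def GLadm (Ω : Set Plane) (ψ : Plane → ℂ) (A : Plane → Plane) : Prop :=
  CNearCl 1 Ω ψ ∧ CNearCl 1 Ω A

/-- The normal state is a minimizer at `(κ, H)`. -/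
def NormalMin (Ω : Set Plane) (κ H : ℝ) : Prop :=
  ∀ ψ A, GLadm Ω ψ A → 0 ≤ GLenergy Ω κ H ψ A

/-- The normal state is the unique minimizer at `(κ, H)`. -/
def NormalUnique (Ω : Set Plane) (κ H : ℝ) : Prop :=
  NormalMin Ω κ H ∧
  ∀ ψ A, GLadm Ω ψ A → (∫ x in Ω, ‖ψ x‖ ^ 2) ≠ 0 → 0 < GLenergy Ω κ H ψ A

/-- `(ψ, A)` is a minimizer of the Ginzburg–Landau energy at `(κ, H)`. -/
def IsGLMin (Ω : Set Plane) (κ H : ℝ) (ψ : Plane → ℂ) (A : Plane → Plane) : Prop :=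
  GLadm Ω ψ A ∧ ∀ ψ' A', GLadm Ω ψ' A' → GLenergy Ω κ H ψ A ≤ GLenergy Ω κ H ψ' A'

/-- Lower global critical field. -/
def HC3low (Ω : Set Plane) (κ : ℝ) : ℝ := sInf {H : ℝ | 0 < H ∧ NormalMin Ω κ H}

/-- Upper global critical field. -/
def HC3up (Ω : Set Plane) (κ : ℝ) : ℝ :=
  sInf {H : ℝ | 0 < H ∧ ∀ H', H < H' → NormalUnique Ω κ H'}

/-- Lower local critical field. -/
def HlocLow (Ω : Set Plane) (κ : ℝ) : ℝ :=
  sInf {H : ℝ | 0 < H ∧ κ ^ 2 ≤ lam1 Ω (κ * H)}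

/-- Upper local critical field. -/
def HlocUp (Ω : Set Plane) (κ : ℝ) : ℝ :=
  sInf {H : ℝ | 0 < H ∧ ∀ H', H < H' → κ ^ 2 ≤ lam1 Ω (κ * H')}

/-- The inward unit normal `ν(s) = (-γ₂'(s), γ₁'(s))`. -/
def nuVec (γ : ℝ → Plane) (s : ℝ) : Plane := (-(deriv γ s).2, (deriv γ s).1)

/-- The curvature `k(s) = ⟨γ''(s), ν(s)⟩`. -/
def curvOf (γ : ℝ → Plane) (s : ℝ) : ℝ := dot2 (deriv (deriv γ) s) (nuVec γ s)

/-- The maximal curvature. -/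
def kmaxOf (γ : ℝ → Plane) : ℝ := sSup (Set.range (curvOf γ))

/-- A smooth counterclockwise arclength parametrization of the boundary of `Ω`. -/
structure BoundaryParam (Ω : Set Plane) where
  γ : ℝ → Plane
  L : ℝ
  L_pos : 0 < L
  smooth : ContDiff ℝ (⊤ : ℕ∞) γ
  periodic : Function.Periodic γ L
  unit_speed : ∀ s, esq (deriv γ s) = 1
  injOn : Set.InjOn γ (Set.Ico 0 L)
  range_eq : Set.range γ = frontier Ω
  inward : ∀ s, ∃ ε > 0, ∀ t ∈ Set.Ioo (0 : ℝ) ε, γ s + t • nuVec γ s ∈ Ω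

/-- The non-degeneracy assumption: finitely many points of maximal curvature,
all of them non-degenerate maxima. -/
def NonDegen {Ω : Set Plane} (P : BoundaryParam Ω) : Prop :=
  ∃ (N : ℕ) (s : Fin N → ℝ), 0 < N ∧ (∀ j, s j ∈ Set.Ico 0 P.L) ∧
    (∀ j, curvOf P.γ (s j) = kmaxOf P.γ) ∧
    (∀ t ∈ Set.Ico 0 P.L, (∀ j, t ≠ s j) → curvOf P.γ t < kmaxOf P.γ) ∧
    (∀ j, deriv (deriv (curvOf P.γ)) (s j) < 0)

/-- The ground state energy `μ(ζ)` of the de Gennes half-line model operator. -/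
def muGen (ζ : ℝ) : ℝ :=
  sInf { r : ℝ | ∃ φ : ℝ → ℝ, ContDiff ℝ 1 φ ∧ HasCompactSupport φ ∧
    (∃ τ, 0 < τ ∧ φ τ ≠ 0) ∧
    r = (∫ τ in Set.Ioi (0 : ℝ), ((deriv φ τ) ^ 2 + (τ + ζ) ^ 2 * (φ τ) ^ 2)) /
        (∫ τ in Set.Ioi (0 : ℝ), (φ τ) ^ 2) }

/-- The de Gennes constant `Θ₀`. -/
def Theta0 : ℝ := sInf (Set.range muGen)

/-- Standard facts about the de Gennes constant, taken as hypotheses. -/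
structure DeGennes where
  ξ₀ : ℝ
  u₀ : ℝ → ℝ
  theta_lb : 1 / 2 < Theta0
  theta_ub : Theta0 < 1
  ξ₀_mem : ξ₀ ∈ Set.Ioo (-1 : ℝ) 0
  ξ₀_min : muGen ξ₀ = Theta0
  ξ₀_uniq : ∀ ζ, muGen ζ = Theta0 → ζ = ξ₀
  ξ₀_sq : ξ₀ ^ 2 = Theta0
  u₀_pos : ∀ τ, 0 ≤ τ → 0 < u₀ τ
  u₀_smooth : ContDiffOn ℝ 2 u₀ (Set.Ici 0)
  u₀_sq_int : IntegrableOn (fun τ => (u₀ τ) ^ 2) (Set.Ioi 0)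
  u₀_normalized : (∫ τ in Set.Ioi (0 : ℝ), (u₀ τ) ^ 2) = 1
  u₀_neumann : derivWithin u₀ (Set.Ici 0) 0 = 0
  u₀_ode : ∀ τ ∈ Set.Ioi (0 : ℝ),
    -(deriv (deriv u₀) τ) + (τ + ξ₀) ^ 2 * u₀ τ = Theta0 * u₀ τ

/-- The universal constant `C₁ = u₀(0)²/3`. -/
def DeGennes.C1 (D : DeGennes) : ℝ := (D.u₀ 0) ^ 2 / 3

/-- Condition (★) on a vector field `A` at field strength `B` with constant `C₀`. -/
def StarCond (Ω : Set Plane) (C₀ B : ℝ) (A : Plane → Plane) : Prop :=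
  CNearCl 2 Ω A ∧
  (∀ x ∈ closure Ω, ‖A x‖ ≤ C₀) ∧
  (∀ x ∈ closure Ω, ‖fderiv ℝ A x‖ ≤ C₀) ∧
  (∀ x ∈ closure Ω, ‖fderiv ℝ (fderiv ℝ A) x‖ ≤ C₀) ∧
  (∀ x ∈ closure Ω, |curl2 A x - 1| ≤ C₀ * B ^ (-(1 : ℝ) / 4)) ∧
  (∀ x ∈ closure Ω, ‖fderiv ℝ (curl2 A) x‖ ≤ C₀ * B ^ (-(1 : ℝ) / 4)) ∧
  (∀ x ∈ frontier Ω, curl2 A x = 1)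

/-- The open unit disc. -/
def unitDisc : Set Plane := {x : Plane | x.1 ^ 2 + x.2 ^ 2 < 1}

/-- `Δ_B`: distance from `B/2 + ξ₀√B + δ₀` to the nearest integer. -/
def DeltaB (ξ₀ δ₀ B : ℝ) : ℝ :=
  sInf (Set.range (fun m : ℤ => |(m : ℝ) - B / 2 - ξ₀ * Real.sqrt B - δ₀|))

/-- Euclidean distance to the boundary of `Ω`. -/
def distBdry (Ω : Set Plane) (x : Plane) : ℝ :=
  sInf ((fun y => Real.sqrt (esq (x - y))) '' frontier Ω)

/-- The half-line profile `u` with derivative `v`, solving `u'' = ((s + ξ)² - ξ²) u`. -/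
structure IsProfile (ξ : ℝ) (u v : ℝ → ℝ) : Prop where
  neg_one_lt : -1 < ξ
  neg : ξ < 0
  pos : ∀ s, 0 ≤ s → 0 < u s
  cont_u : ContinuousOn u (Ici 0)
  cont_v : ContinuousOn v (Ici 0)
  v_zero : v 0 = 0
  hasDeriv_u : ∀ s, 0 < s → HasDerivAt u (v s) s
  hasDeriv_u_zero : HasDerivWithinAt u 0 (Ici 0) 0
  hasDeriv_v : ∀ s, 0 < s → HasDerivAt v ((s ^ 2 + 2 * ξ * s) * u s) s
  sq_int : IntegrableOn (fun s => u s ^ 2) (Ioi 0)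
  normalized : ∫ s in Ioi (0 : ℝ), u s ^ 2 = 1

theorem DeGennes.isProfile (D : DeGennes) : ∃ v, IsProfile D.ξ₀ D.u₀ v := by
  have hU : UniqueDiffOn ℝ (Ici (0 : ℝ)) := uniqueDiffOn_Ici 0
  have hd : DifferentiableOn ℝ D.u₀ (Ici 0) := D.u₀_smooth.differentiableOn (by norm_num)
  have hv1 : ContDiffOn ℝ 1 (derivWithin D.u₀ (Ici 0)) (Ici 0) :=
    D.u₀_smooth.derivWithin hU (by norm_num)
  have hdv : DifferentiableOn ℝ (derivWithin D.u₀ (Ici 0)) (Ici 0) :=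
    hv1.differentiableOn (by norm_num)
  have key : ∀ s, 0 < s → derivWithin D.u₀ (Ici 0) =ᶠ[𝓝 s] deriv D.u₀ := by
    intro s hs
    filter_upwards [Ioi_mem_nhds hs] with t ht
    exact derivWithin_of_mem_nhds (Ici_mem_nhds ht)
  refine ⟨derivWithin D.u₀ (Ici 0), D.ξ₀_mem.1, D.ξ₀_mem.2, D.u₀_pos, hd.continuousOn,
    hv1.continuousOn, D.u₀_neumann, ?_, ?_, ?_, D.u₀_sq_int, D.u₀_normalized⟩
  · intro s hs
    have := (hd s hs.le).differentiableAt (Ici_mem_nhds hs)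
    rw [(key s hs).self_of_nhds]
    exact this.hasDerivAt
  · have := (hd 0 self_mem_Ici).hasDerivWithinAt
    rwa [D.u₀_neumann] at this
  · intro s hs
    have h := ((hdv s hs.le).differentiableAt (Ici_mem_nhds hs)).hasDerivAt
    rw [(key s hs).deriv_eq] at h
    have e := D.u₀_ode s hs
    have : deriv (deriv D.u₀) s = (s ^ 2 + 2 * D.ξ₀ * s) * D.u₀ s := by
      rw [← D.ξ₀_sq] at e
      linear_combination -e
    rwa [this] at h

namespace IsProfile

variable {ξ : ℝ} {u v : ℝ → ℝ}

theorem not_ge_const (P : IsProfile ξ u v) {s₁ c : ℝ} (hs : 0 ≤ s₁) (hc : 0 < c)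
    (h : ∀ s, s₁ < s → c ≤ u s) : False := by
  have hi : IntegrableOn (fun _ : ℝ => c ^ 2) (Ioi s₁) := by
    refine Integrable.mono' (P.sq_int.mono_set (Ioi_subset_Ioi hs)) (by fun_prop) ?_
    filter_upwards [ae_restrict_mem measurableSet_Ioi] with s hs'
    rw [Real.norm_of_nonneg (by positivity)]
    exact pow_le_pow_left₀ hc.le (h s hs') 2
  rw [integrableOn_const_iff] at hi
  rcases hi with h | h
  · exact (pow_pos hc 2).ne' (enorm_eq_zero.1 h)
  · simp at h

theorem v_neg (P : IsProfile ξ u v) {s : ℝ} (hs : 0 < s) : v s < 0 := by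
  have hξ := P.neg
  have h1 : StrictAntiOn v (Icc 0 (-(2 * ξ))) := by
    refine strictAntiOn_of_deriv_neg (convex_Icc _ _)
      (P.cont_v.mono Icc_subset_Ici_self) ?_
    intro t ht
    rw [interior_Icc] at ht
    rw [(P.hasDeriv_v t ht.1).deriv]
    have := P.pos t ht.1.le
    have h2 := ht.2
    have : (t ^ 2 + 2 * ξ * t) < 0 := by nlinarith [ht.1]
    nlinarith
  by_cases hs2 : s ≤ -(2 * ξ)
  · have := h1 (left_mem_Icc.2 (by linarith)) ⟨hs.le, hs2⟩ hs
    rwa [P.v_zero] at this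
  push Not at hs2
  by_contra! hv
  have mono : MonotoneOn v (Ici s) := by
    refine monotoneOn_of_deriv_nonneg (convex_Ici _)
      (P.cont_v.mono (Ici_subset_Ici.2 hs.le)) ?_ ?_
    · intro t ht
      rw [interior_Ici] at ht
      exact (P.hasDeriv_v t (hs.trans ht)).differentiableAt.differentiableWithinAt
    · intro t ht
      rw [interior_Ici] at ht
      have ht0 := hs.trans ht
      rw [(P.hasDeriv_v t ht0).deriv]
      have := P.pos t ht0.le
      have h3 : s < t := ht
      have : 0 ≤ t ^ 2 + 2 * ξ * t := by nlinarith
      positivity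
  have mono2 : MonotoneOn u (Ici s) := by
    refine monotoneOn_of_deriv_nonneg (convex_Ici _)
      (P.cont_u.mono (Ici_subset_Ici.2 hs.le)) ?_ ?_
    · intro t ht
      rw [interior_Ici] at ht
      exact (P.hasDeriv_u t (hs.trans ht)).differentiableAt.differentiableWithinAt
    · intro t ht
      rw [interior_Ici] at ht
      rw [(P.hasDeriv_u t (hs.trans ht)).deriv]
      exact hv.trans (mono self_mem_Ici (mem_Ici.2 (le_of_lt ht)) (le_of_lt ht))
  exact P.not_ge_const hs.le (P.pos s hs.le)
    (fun t ht => mono2 self_mem_Ici (mem_Ici.2 ht.le) ht.le)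

theorem v_nonpos (P : IsProfile ξ u v) {s : ℝ} (hs : 0 ≤ s) : v s ≤ 0 := by
  rcases hs.eq_or_lt with rfl | h
  · exact P.v_zero.le
  · exact (P.v_neg h).le

theorem hasDeriv_barrier (P : IsProfile ξ u v) (k : ℝ) {s : ℝ} (hs : 0 < s) :
    HasDerivAt (fun s => (v s + (s + ξ + k) * u s) * Real.exp (-(s + ξ + k) ^ 2 / 2))
      ((1 - ξ ^ 2 - k ^ 2 - 2 * k * (s + ξ)) * u s * Real.exp (-(s + ξ + k) ^ 2 / 2)) s := by
  have hx : HasDerivAt (fun s : ℝ => s + ξ + k) 1 s := ((hasDerivAt_id s).add_const ξ).add_const k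
  have he : HasDerivAt (fun s : ℝ => Real.exp (-(s + ξ + k) ^ 2 / 2))
      (Real.exp (-(s + ξ + k) ^ 2 / 2) * (-(2 * (s + ξ + k)) / 2)) s := by
    have := (((hx.pow 2).neg).div_const 2).exp
    simpa using this
  have := ((P.hasDeriv_v s hs).add (hx.mul (P.hasDeriv_u s hs))).mul he
  refine this.congr_deriv ?_
  simp only [Pi.add_apply, Pi.mul_apply]
  ring

theorem cont_barrier (P : IsProfile ξ u v) (k : ℝ) :
    ContinuousOn (fun s => (v s + (s + ξ + k) * u s) * Real.exp (-(s + ξ + k) ^ 2 / 2))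
      (Ici 0) := by
  have := P.cont_u
  have := P.cont_v
  fun_prop

theorem v_add_le (P : IsProfile ξ u v) {s : ℝ} (hs : 0 ≤ s) : v s + (s + ξ) * u s ≤ 0 := by
  by_contra! hw
  have hξ := P.neg
  have hξ1 := P.neg_one_lt
  set W := fun s => (v s + (s + ξ + 0) * u s) * Real.exp (-(s + ξ + 0) ^ 2 / 2) with hW
  have mono : MonotoneOn W (Ici s) := by
    refine monotoneOn_of_deriv_nonneg (convex_Ici _)
      ((P.cont_barrier 0).mono (Ici_subset_Ici.2 hs)) ?_ ?_
    · intro t ht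
      rw [interior_Ici] at ht
      exact (P.hasDeriv_barrier 0 (hs.trans_lt ht)).differentiableAt.differentiableWithinAt
    · intro t ht
      rw [interior_Ici] at ht
      rw [(P.hasDeriv_barrier 0 (hs.trans_lt ht)).deriv]
      have := P.pos t (hs.trans_lt ht).le
      have : 0 ≤ 1 - ξ ^ 2 - 0 ^ 2 - 2 * 0 * (t + ξ) := by nlinarith
      positivity
  have hc : 0 < W s := by
    simp only [hW, add_zero]
    positivity
  refine P.not_ge_const (s₁ := max s 1) (c := W s) (le_max_of_le_left hs) hc ?_
  intro t ht
  have hst : s < t := (le_max_left _ _).trans_lt ht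
  have h1t : 1 < t := (le_max_right _ _).trans_lt ht
  have h1 := mono self_mem_Ici (mem_Ici.2 hst.le) hst.le
  have hE := Real.add_one_le_exp ((t + ξ) ^ 2 / 2)
  have hE2 : Real.exp (-(t + ξ + 0) ^ 2 / 2) * Real.exp ((t + ξ) ^ 2 / 2) = 1 := by
    rw [← Real.exp_add]; ring_nf; simp
  have h2 : W s * Real.exp ((t + ξ) ^ 2 / 2) ≤ v t + (t + ξ) * u t := by
    calc W s * Real.exp ((t + ξ) ^ 2 / 2) ≤ W t * Real.exp ((t + ξ) ^ 2 / 2) := by gcongr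
      _ = v t + (t + ξ) * u t := by
        simp only [hW]; rw [mul_assoc, hE2]; ring
  have h3 := P.v_neg (hs.trans_lt hst)
  have hx : 0 < t + ξ := by linarith
  have h4 : W s * (t + ξ) ≤ (t + ξ) * u t := by
    have : t + ξ ≤ Real.exp ((t + ξ) ^ 2 / 2) := by nlinarith [sq_nonneg (t + ξ - 1)]
    nlinarith
  nlinarith

theorem v_add_ge (P : IsProfile ξ u v) {s : ℝ} (hs : 0 ≤ s) : 0 ≤ v s + (s + ξ + 3) * u s := by
  by_contra! hw
  have hξ := P.neg
  have hξ1 := P.neg_one_lt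
  set W := fun s => (v s + (s + ξ + 3) * u s) * Real.exp (-(s + ξ + 3) ^ 2 / 2) with hW
  have anti : AntitoneOn W (Ici s) := by
    refine antitoneOn_of_deriv_nonpos (convex_Ici _)
      ((P.cont_barrier 3).mono (Ici_subset_Ici.2 hs)) ?_ ?_
    · intro t ht
      rw [interior_Ici] at ht
      exact (P.hasDeriv_barrier 3 (hs.trans_lt ht)).differentiableAt.differentiableWithinAt
    · intro t ht
      rw [interior_Ici] at ht
      have ht' : s < t := ht
      rw [(P.hasDeriv_barrier 3 (hs.trans_lt ht)).deriv]
      have := P.pos t (hs.trans_lt ht).le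
      have : 1 - ξ ^ 2 - 3 ^ 2 - 2 * 3 * (t + ξ) ≤ 0 := by nlinarith
      exact mul_nonpos_of_nonpos_of_nonneg
        (mul_nonpos_of_nonpos_of_nonneg this (P.pos t (hs.trans_lt ht).le).le) (Real.exp_pos _).le
  have hc : W s < 0 := by
    simp only [hW]
    exact mul_neg_of_neg_of_pos hw (Real.exp_pos _)
  have hv : ∀ t, s < t → v t ≤ W s := by
    intro t ht
    have h1 := anti self_mem_Ici (mem_Ici.2 ht.le) ht.le
    have hE : Real.exp (-(t + ξ + 3) ^ 2 / 2) ≤ 1 := Real.exp_le_one_iff.2 (by nlinarith)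
    have hE0 := Real.exp_pos (-(t + ξ + 3) ^ 2 / 2)
    have h2 : W t = (v t + (t + ξ + 3) * u t) * Real.exp (-(t + ξ + 3) ^ 2 / 2) := rfl
    have h3 : v t + (t + ξ + 3) * u t ≤ W s := by
      by_contra! h
      rcases le_or_gt 0 (v t + (t + ξ + 3) * u t) with h5 | h5
      · nlinarith [mul_nonneg h5 hE0.le]
      · nlinarith
    have := P.pos t (hs.trans ht.le)
    nlinarith
  have anti2 : AntitoneOn (fun t => u t - W s * t) (Ici s) := by
    have hder : ∀ t, s < t → HasDerivAt (fun t => u t - W s * t) (v t - W s) t := by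
      intro t ht
      exact ((P.hasDeriv_u t (hs.trans_lt ht)).fun_sub
        ((hasDerivAt_id t).const_mul (W s))).congr_deriv (by simp)
    refine antitoneOn_of_deriv_nonpos (convex_Ici _) ?_ ?_ ?_
    · exact (P.cont_u.mono (Ici_subset_Ici.2 hs)).sub (by fun_prop)
    · intro t ht
      rw [interior_Ici] at ht
      exact (hder t ht).differentiableAt.differentiableWithinAt
    · intro t ht
      rw [interior_Ici] at ht
      rw [(hder t ht).deriv]
      linarith [hv t ht]
  have hus := P.pos s hs
  have hle : s ≤ s + u s / (-W s) := by
    have : 0 ≤ u s / (-W s) := div_nonneg hus.le (by linarith)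
    linarith
  have h5 := anti2 self_mem_Ici (mem_Ici.2 hle) hle
  have h6 := P.pos (s + u s / (-W s)) (hs.trans hle)
  have h7 : W s * (u s / (-W s)) = - u s := by
    have : W s ≠ 0 := hc.ne
    field_simp
  simp only [mul_add] at h5
  linarith

end IsProfile
/-- The logarithmic slope `ρ = u'/u` of the profile and its first curvature correction `ρ₁`. -/
structure IsSlope (ξ c₁ : ℝ) (ρ ρ₁ : ℝ → ℝ) : Prop where
  neg_one_lt : -1 < ξ
  neg : ξ < 0
  zero : ρ 0 = 0
  zero₁ : ρ₁ 0 = 0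
  cont : ContinuousOn ρ (Ici 0)
  cont₁ : ContinuousOn ρ₁ (Ici 0)
  hasDeriv : ∀ s, 0 < s → HasDerivAt ρ (s ^ 2 + 2 * ξ * s - ρ s ^ 2) s
  hasDeriv₁ : ∀ s, 0 < s →
    HasDerivAt ρ₁ (c₁ + 2 * s * ((s + ξ) ^ 2 - ρ s ^ 2) - 2 * ρ s * ρ₁ s) s
  le : ∀ s, 0 ≤ s → ρ s ≤ -(s + ξ)
  ge : ∀ s, 0 ≤ s → -(s + ξ + 3) ≤ ρ s
  nonpos : ∀ s, 0 ≤ s → ρ s ≤ 0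
  bound₁ : ∃ L, 0 ≤ L ∧ ∀ s, 0 ≤ s → |ρ₁ s| ≤ L * (1 + s) ^ 3

namespace IsProfile

variable {ξ : ℝ} {u v : ℝ → ℝ}

theorem antitoneOn (P : IsProfile ξ u v) : AntitoneOn u (Ici 0) := by
  refine antitoneOn_of_deriv_nonpos (convex_Ici _) P.cont_u ?_ ?_
  · intro t ht
    rw [interior_Ici] at ht
    exact (P.hasDeriv_u t ht).differentiableAt.differentiableWithinAt
  · intro t ht
    rw [interior_Ici] at ht
    rw [(P.hasDeriv_u t ht).deriv]
    exact P.v_nonpos (le_of_lt ht)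

/-- The partial mass `∫₀ˢ u²`. -/
theorem exists_mass (P : IsProfile ξ u v) : ∃ m : ℝ → ℝ, m 0 = 0 ∧ Continuous m ∧
    (∀ s, 0 < s → HasDerivAt m (u s ^ 2) s) ∧ Tendsto m atTop (𝓝 1) ∧
    (∀ s, 0 ≤ s → m s ≤ 1) ∧ ∀ s, 0 ≤ s → 0 ≤ m s := by
  have hc : Continuous (fun t => u (max t 0) ^ 2) := by
    refine Continuous.pow ?_ 2
    exact P.cont_u.comp_continuous (by fun_prop) (fun t => mem_Ici.2 (le_max_right _ _))
  have hder : ∀ s, HasDerivAt (fun s => ∫ t in (0 : ℝ)..s, u (max t 0) ^ 2) (u (max s 0) ^ 2) s :=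
    fun s => intervalIntegral.integral_hasDerivAt_right (hc.intervalIntegrable _ _)
      (hc.stronglyMeasurableAtFilter _ _) hc.continuousAt
  have hmono : Monotone (fun s => ∫ t in (0 : ℝ)..s, u (max t 0) ^ 2) := by
    refine monotone_of_deriv_nonneg (fun s => (hder s).differentiableAt) ?_
    intro s
    rw [(hder s).deriv]
    positivity
  have hint : IntegrableOn (fun t => u (max t 0) ^ 2) (Ioi 0) := by
    refine P.sq_int.congr_fun ?_ measurableSet_Ioi
    intro t ht
    simp [max_eq_left (le_of_lt (mem_Ioi.1 ht))]
  have hlim : Tendsto (fun s => ∫ t in (0 : ℝ)..s, u (max t 0) ^ 2) atTop (𝓝 1) := by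
    have := intervalIntegral_tendsto_integral_Ioi 0 hint tendsto_id
    rw [← P.normalized]
    have e : ∫ t in Ioi (0 : ℝ), u t ^ 2 = ∫ t in Ioi (0 : ℝ), u (max t 0) ^ 2 := by
      refine setIntegral_congr_fun measurableSet_Ioi ?_
      intro t ht
      simp [max_eq_left (le_of_lt (mem_Ioi.1 ht))]
    rw [e]
    exact this
  refine ⟨_, by simp, continuous_iff_continuousAt.2 fun s => (hder s).continuousAt, ?_, hlim,
    fun s _ => hmono.ge_of_tendsto hlim s, fun s hs => ?_⟩
  · intro s hs
    have := hder s
    rwa [max_eq_left hs.le] at this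
  · have := hmono hs
    simpa using this

theorem exists_slope (P : IsProfile ξ u v) :
    ∃ ρ ρ₁, IsSlope ξ (u 0 ^ 2 / 3) ρ ρ₁ ∧ ∀ s, 0 ≤ s → v s = ρ s * u s := by
  obtain ⟨m, hm0, hmc, hmd, hml, hm1, hmn⟩ := P.exists_mass
  have hξ := P.neg
  have hξ1 := P.neg_one_lt
  set ρ : ℝ → ℝ := fun s => v s / u s with hρ
  set τ : ℝ → ℝ := fun s => (1 - m s) / u s ^ 2 with hτ
  set ρ₁ : ℝ → ℝ := fun s => 1 / 3 - 2 / 3 * (s + ξ) * ρ s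
    - 2 / 3 * (s + ξ) ^ 2 * (ρ s ^ 2 - (s + ξ) ^ 2 + ξ ^ 2)
    - ξ ^ 2 / 3 * (ρ s ^ 2 - (s + ξ) ^ 2 + ξ ^ 2)
    + ξ * ((s + ξ) * ρ s ^ 2 - (s + ξ) ^ 3 + ξ ^ 2 * (s + ξ) + ρ s)
    - u 0 ^ 2 / 3 * τ s with hρ₁
  have hu : ∀ s, 0 ≤ s → u s ≠ 0 := fun s hs => (P.pos s hs).ne'
  have cρ : ContinuousOn ρ (Ici 0) := P.cont_v.div P.cont_u (fun s hs => hu s hs)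
  have cτ : ContinuousOn τ (Ici 0) :=
    (continuousOn_const.sub hmc.continuousOn).div (P.cont_u.pow 2)
      (fun s hs => pow_ne_zero 2 (hu s hs))
  have dρ : ∀ s, 0 < s → HasDerivAt ρ (s ^ 2 + 2 * ξ * s - ρ s ^ 2) s := by
    intro s hs
    refine ((P.hasDeriv_v s hs).div (P.hasDeriv_u s hs) (hu s hs.le)).congr_deriv ?_
    have := hu s hs.le
    simp only [hρ]
    field_simp
  have dτ : ∀ s, 0 < s → HasDerivAt τ (-1 - 2 * ρ s * τ s) s := by
    intro s hs
    refine (((hmd s hs).const_sub 1).div ((P.hasDeriv_u s hs).pow 2)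
      (pow_ne_zero 2 (hu s hs.le))).congr_deriv ?_
    have := hu s hs.le
    simp only [hρ, hτ]
    push_cast
    field_simp
    simp only [Pi.pow_apply]
    field_simp
  have hle : ∀ s, 0 ≤ s → ρ s ≤ -(s + ξ) := by
    intro s hs
    have := P.v_add_le hs
    rw [hρ, div_le_iff₀ (P.pos s hs)]
    linarith
  have hge : ∀ s, 0 ≤ s → -(s + ξ + 3) ≤ ρ s := by
    intro s hs
    have := P.v_add_ge hs
    rw [hρ, le_div_iff₀ (P.pos s hs)]
    linarith
  have hnp : ∀ s, 0 ≤ s → ρ s ≤ 0 :=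
    fun s hs => div_nonpos_of_nonpos_of_nonneg (P.v_nonpos hs) (P.pos s hs).le
  have hτ0 : ∀ s, 0 ≤ s → 0 ≤ τ s :=
    fun s hs => div_nonneg (by linarith [hm1 s hs]) (by positivity)
  have hτ1 : ∀ s, 0 ≤ s → τ s ≤ 1 + 1 / u 2 ^ 2 := by
    intro s hs
    have hu2 := P.pos 2 (by norm_num)
    have hp : 0 < 1 / u 2 ^ 2 := by positivity
    rcases le_total s 2 with h | h
    · have h1 : u 2 ^ 2 ≤ u s ^ 2 :=
        pow_le_pow_left₀ hu2.le (P.antitoneOn hs (mem_Ici.2 (by norm_num)) h) 2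
      have h2 : τ s ≤ 1 / u 2 ^ 2 := by
        simp only [hτ]
        have := hmn s hs
        gcongr
        linarith
      linarith
    · have mono : MonotoneOn (fun s => 1 - m s - u s ^ 2) (Ici 2) := by
        have hd : ∀ t, 2 < t → HasDerivAt (fun s => 1 - m s - u s ^ 2)
            (-(u t ^ 2) - 2 * u t * v t) t := by
          intro t ht
          refine (((hmd t (by linarith)).const_sub 1).fun_sub
            ((P.hasDeriv_u t (by linarith)).fun_pow 2)).congr_deriv ?_
          simp
        refine monotoneOn_of_deriv_nonneg (convex_Ici _) ?_ ?_ ?_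
        · exact (continuousOn_const.sub hmc.continuousOn).sub
            ((P.cont_u.mono (Ici_subset_Ici.2 (by norm_num))).pow 2)
        · intro t ht
          rw [interior_Ici] at ht
          exact (hd t ht).differentiableAt.differentiableWithinAt
        · intro t ht
          rw [interior_Ici] at ht
          have ht' : 2 < t := ht
          rw [(hd t ht).deriv]
          have h1 := P.v_add_le (s := t) (by linarith)
          have h2 := P.pos t (by linarith)
          nlinarith
      have h3 : 1 - m s - u s ^ 2 ≤ 0 := by
        have hl : Tendsto (fun t => 1 - m t) atTop (𝓝 0) := by
          simpa using hml.const_sub 1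
        refine ge_of_tendsto hl ?_
        filter_upwards [eventually_ge_atTop s] with t ht
        have := mono (mem_Ici.2 h) (mem_Ici.2 (h.trans ht)) ht
        simp only at this
        nlinarith [sq_nonneg (u t)]
      have h4 : τ s ≤ 1 := by
        have := P.pos s hs
        simp only [hτ]
        rw [div_le_one (by positivity)]
        linarith
      linarith
  refine ⟨ρ, ρ₁, ⟨hξ1, hξ, by simp [hρ, P.v_zero], ?_, cρ, ?_, dρ, ?_, hle, hge, hnp, ?_⟩,
    fun s hs => by simp only [hρ]; field_simp [hu s hs]⟩
  · have := hu 0 le_rfl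
    simp only [hρ₁, hρ, hτ, P.v_zero, hm0]
    field_simp
    ring
  · fun_prop
  · intro s hs
    have dx : HasDerivAt (fun s : ℝ => s + ξ) 1 s := (hasDerivAt_id s).add_const ξ
    have d1 := dρ s hs
    have dE : HasDerivAt (fun s => ρ s ^ 2 - (s + ξ) ^ 2 + ξ ^ 2) _ s :=
      ((d1.fun_pow 2).fun_sub (dx.fun_pow 2)).add_const (ξ ^ 2)
    have := ((((((dx.const_mul (2 / 3)).fun_mul d1).const_sub (1 / 3)).fun_sub
      (((dx.fun_pow 2).const_mul (2 / 3)).fun_mul dE)).fun_sub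
      (dE.const_mul (ξ ^ 2 / 3))).fun_add
      (((((dx.fun_mul (d1.fun_pow 2)).fun_sub (dx.fun_pow 3)).fun_add
        (dx.const_mul (ξ ^ 2))).fun_add d1).const_mul ξ)).fun_sub
      ((dτ s hs).const_mul (u 0 ^ 2 / 3))
    refine this.congr_deriv ?_
    simp only [hρ₁]
    push_cast
    ring
  · refine ⟨100 + u 0 ^ 2 / 3 * (1 + 1 / u 2 ^ 2), by positivity, fun s hs => ?_⟩
    have a1 : |s + ξ| ≤ 1 + s := abs_le.2 ⟨by linarith, by linarith⟩
    have a2 : |ρ s| ≤ 4 * (1 + s) :=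
      abs_le.2 ⟨by linarith [hge s hs], by linarith [hnp s hs]⟩
    have a3 : |ξ| ≤ 1 := abs_le.2 ⟨by linarith, by linarith⟩
    have a4 : |ξ ^ 2| ≤ 1 := by rw [abs_pow]; exact pow_le_one₀ (abs_nonneg _) a3
    have a5 : |ρ s ^ 2 - (s + ξ) ^ 2 + ξ ^ 2| ≤ 16 * (1 + s) := by
      have e : ρ s ^ 2 - (s + ξ) ^ 2 = (-(ρ s + (s + ξ))) * (s + ξ - ρ s) := by ring
      have b1 : 0 ≤ -(ρ s + (s + ξ)) := by linarith [hle s hs]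
      have b2 : -(ρ s + (s + ξ)) ≤ 3 := by linarith [hge s hs]
      have b3 : |s + ξ - ρ s| ≤ 5 * (1 + s) := (abs_sub _ _).trans (by linarith)
      calc _ ≤ |ρ s ^ 2 - (s + ξ) ^ 2| + |ξ ^ 2| := abs_add_le _ _
        _ ≤ 3 * (5 * (1 + s)) + 1 := by
          rw [e, abs_mul, abs_of_nonneg b1]
          gcongr
        _ ≤ _ := by linarith
    have a6 : |τ s| ≤ 1 + 1 / u 2 ^ 2 := by
      rw [abs_of_nonneg (hτ0 s hs)]; exact hτ1 s hs
    have e : ρ₁ s = 1 / 3 + (-(2 / 3) * ((s + ξ) * ρ s))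
        + (-(2 / 3) * ((s + ξ) ^ 2 * (ρ s ^ 2 - (s + ξ) ^ 2 + ξ ^ 2)))
        + (-(1 / 3) * (ξ ^ 2 * (ρ s ^ 2 - (s + ξ) ^ 2 + ξ ^ 2)))
        + ξ * ((s + ξ) * (ρ s ^ 2 - (s + ξ) ^ 2 + ξ ^ 2) + ρ s)
        + (-(u 0 ^ 2 / 3) * τ s) := by
      simp only [hρ₁]; ring
    have y1 : 1 ≤ 1 + s := by linarith
    generalize hy : 1 + s = y at *
    have y2 : y ≤ y ^ 3 := le_self_pow₀ y1 (by norm_num)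
    have y3 : y ^ 2 ≤ y ^ 3 := pow_le_pow_right₀ y1 (by norm_num)
    have y4 : 1 ≤ y ^ 3 := one_le_pow₀ y1
    have y0 : 0 ≤ y := by linarith
    calc |ρ₁ s| ≤ 1 / 3 + 2 / 3 * (y * (4 * y)) + 2 / 3 * (y ^ 2 * (16 * y))
          + 1 / 3 * (1 * (16 * y)) + 1 * (y * (16 * y) + 4 * y)
          + u 0 ^ 2 / 3 * (1 + 1 / u 2 ^ 2) := by
          rw [e]
          refine (abs_add_le _ _).trans (add_le_add ((abs_add_le _ _).trans (add_le_add
            ((abs_add_le _ _).trans (add_le_add ((abs_add_le _ _).trans (add_le_add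
            ((abs_add_le _ _).trans (add_le_add ?_ ?_)) ?_)) ?_)) ?_)) ?_)
          · norm_num
          · rw [abs_mul, abs_mul]; gcongr; norm_num
          · rw [abs_mul, abs_mul, abs_pow]; gcongr; norm_num
          · rw [abs_mul, abs_mul]; gcongr; norm_num
          · rw [abs_mul]; gcongr
            refine (abs_add_le _ _).trans (add_le_add ?_ a2)
            rw [abs_mul]; gcongr
          · rw [abs_mul, abs_neg, abs_of_nonneg (by positivity : 0 ≤ u 0 ^ 2 / 3)]; gcongr
      _ ≤ (100 + u 0 ^ 2 / 3 * (1 + 1 / u 2 ^ 2)) * y ^ 3 := by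
          have : 0 ≤ u 0 ^ 2 / 3 * (1 + 1 / u 2 ^ 2) := by positivity
          nlinarith

end IsProfile
theorem riccati_source_bound {s L p₁ g : ℝ} (hL0 : 0 ≤ L) (hs0 : 0 < s)
    (d1 : -((34 + 8 * L) * (1 + s) ^ 4) ≤ g) (d2 : |p₁| ≤ L * (1 + s) ^ 3) :
    -((68 + 16 * L + L ^ 2) * (1 + s) ^ 6) ≤ 2 * s * g - p₁ ^ 2 := by
  have e1 : p₁ ^ 2 ≤ (L * (1 + s) ^ 3) ^ 2 := sq_le_sq' (by linarith [_root_.abs_le.1 d2])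
    (by linarith [_root_.abs_le.1 d2])
  have e2 : 2 * s * (-((34 + 8 * L) * (1 + s) ^ 4)) ≤ 2 * s * g := by gcongr
  have e3 : 2 * s * ((34 + 8 * L) * (1 + s) ^ 4)
      ≤ 2 * (1 + s) ^ 2 * ((34 + 8 * L) * (1 + s) ^ 4) := by
    gcongr
    nlinarith
  nlinarith

theorem riccati_remainder_near {h s s₂ L M K₀ K p p₁ g : ℝ} (hh : 0 < h) (hs0 : 0 < s)
    (hL0 : 0 ≤ L) (hM0 : 68 ≤ M) (hK₀1 : 1 ≤ K₀) (hhsm : h * s₂ < 1 / 4096) (hhm : h < 1 / 4096)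
    (hK : K = 2 * (8 * s₂ ^ 7 + (M * (1 + s₂) ^ 6 + 2 * (4 * (1 + s₂)) * (s₂ ^ 8 + K₀)
      + 2 * (L * (1 + s₂) ^ 3) * (s₂ ^ 8 + K₀) + (s₂ ^ 8 + K₀) ^ 2))) (hKp : 0 < K)
    (d2 : |p₁| ≤ L * (1 + s) ^ 3) (d4 : |p| ≤ 4 * (1 + s))
    (hG : -(M * (1 + s) ^ 6) ≤ 2 * s * g - p₁ ^ 2) (hss : s ≤ s₂) :
    (1 - 2 * h * s) * (8 * s ^ 7 - K)
      ≤ 2 * s * g - p₁ ^ 2 - 2 * p * (s ^ 8 - K₀) - 2 * h * p₁ * (s ^ 8 - K₀)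
        - h ^ 2 * (s ^ 8 - K₀) ^ 2 := by
  set r₂ := s ^ 8 - K₀ with hr₂
  clear_value r₂
  have hs2 : 0 ≤ s₂ := hs0.le.trans hss
  have f0 : 1 / 2 ≤ 1 - 2 * h * s := by nlinarith
  have f00 : 1 - 2 * h * s ≤ 1 := by nlinarith
  have f1 : |r₂| ≤ s₂ ^ 8 + K₀ := by
    rw [hr₂]
    refine (abs_sub _ _).trans ?_
    rw [abs_of_nonneg (by positivity), abs_of_nonneg (by linarith)]
    gcongr
  have f2 : 2 * p * r₂ ≤ 2 * (4 * (1 + s₂)) * (s₂ ^ 8 + K₀) := by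
    refine (le_abs_self _).trans ?_
    rw [abs_mul, abs_mul, abs_two]
    gcongr
    exact d4.trans (by gcongr)
  have f3 : 2 * h * p₁ * r₂ ≤ 2 * (L * (1 + s₂) ^ 3) * (s₂ ^ 8 + K₀) := by
    refine (le_abs_self _).trans ?_
    rw [abs_mul, abs_mul, abs_mul, abs_two, abs_of_pos hh]
    gcongr
    · linarith
    · exact d2.trans (by gcongr)
  have f4 : h ^ 2 * r₂ ^ 2 ≤ (s₂ ^ 8 + K₀) ^ 2 := by
    have f5 : r₂ ^ 2 ≤ (s₂ ^ 8 + K₀) ^ 2 := by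
      rw [← sq_abs r₂]
      gcongr
    have : h ^ 2 ≤ 1 := pow_le_one₀ hh.le (by linarith)
    nlinarith [sq_nonneg r₂]
  have f6 : M * (1 + s) ^ 6 ≤ M * (1 + s₂) ^ 6 := by gcongr
  have f7 : (1 - 2 * h * s) * (8 * s ^ 7 - K) ≤ 8 * s₂ ^ 7 - K / 2 := by
    have f8 : (1 - 2 * h * s) * (8 * s ^ 7) ≤ 1 * (8 * s₂ ^ 7) := by gcongr
    have f9 : 1 / 2 * K ≤ (1 - 2 * h * s) * K := by
      gcongr
    linarith
  linarith

theorem riccati_remainder_far {ξ h s s₂ L M K₀ K p p₁ g : ℝ} (hh : 0 < h) (hs0 : 0 < s)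
    (hL0 : 0 ≤ L) (hM0 : 68 ≤ M) (hK₀1 : 1 ≤ K₀) (hs₂ : s₂ = 16 + 64 * M + 48 * L + 2 * K₀)
    (hξ1 : -1 < ξ) (hKp : 0 < K) (g0 : 0 ≤ 1 - 2 * h * s) (g1 : h * s ^ 4 ≤ 3)
    (d2 : |p₁| ≤ L * (1 + s) ^ 3) (d3 : p ≤ -(s + ξ))
    (hG : -(M * (1 + s) ^ 6) ≤ 2 * s * g - p₁ ^ 2) (hss : s₂ ≤ s) :
    (1 - 2 * h * s) * (8 * s ^ 7 - K)
      ≤ 2 * s * g - p₁ ^ 2 - 2 * p * (s ^ 8 - K₀) - 2 * h * p₁ * (s ^ 8 - K₀)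
        - h ^ 2 * (s ^ 8 - K₀) ^ 2 := by
  set r₂ := s ^ 8 - K₀ with hr₂
  clear_value r₂
  have g16 : 16 ≤ s := by linarith
  have g2 : 2 * K₀ ≤ s ^ 8 := by
    have : s ≤ s ^ 8 := le_self_pow₀ (by linarith) (by norm_num)
    linarith
  have g3 : s ^ 8 / 2 ≤ r₂ := by linarith
  have g4 : h ^ 2 * r₂ ^ 2 ≤ 9 * r₂ := by
    have : h ^ 2 * s ^ 8 ≤ 9 := by
      rw [show h ^ 2 * s ^ 8 = (h * s ^ 4) ^ 2 by ring]
      calc (h * s ^ 4) ^ 2 ≤ 3 ^ 2 := by gcongr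
        _ = 9 := by norm_num
    have h9 : h ^ 2 * r₂ ≤ 9 := by
      refine le_trans ?_ this
      gcongr
      linarith
    have hr0 : 0 ≤ r₂ := le_trans (by positivity) g3
    nlinarith
  have hr0 : 0 ≤ r₂ := le_trans (by positivity) g3
  have g5 : 2 * h * p₁ * r₂ ≤ 1 * r₂ := by
    gcongr
    have k1 : p₁ ≤ L * (2 * s) ^ 3 :=
      (le_abs_self _).trans (d2.trans (by gcongr; linarith))
    have k2 : s * (2 * h * p₁) ≤ s * 1 := by
      calc s * (2 * h * p₁) ≤ s * (2 * h * (L * (2 * s) ^ 3)) := by gcongr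
        _ = 16 * L * (h * s ^ 4) := by ring
        _ ≤ 16 * L * 3 := by gcongr
        _ ≤ s * 1 := by linarith
    exact le_of_mul_le_mul_left k2 hs0
  have g6 : 2 * p * r₂ ≤ -2 * (s - 1) * r₂ :=
    mul_le_mul_of_nonneg_right (by linarith) hr0
  have g7 : (1 - 2 * h * s) * (8 * s ^ 7 - K) ≤ 8 * s ^ 7 := by
    have a1 : (1 - 2 * h * s) * (8 * s ^ 7) ≤ 1 * (8 * s ^ 7) := by
      gcongr
      nlinarith
    have : 0 ≤ (1 - 2 * h * s) * K := by positivity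
    linarith
  have g8 : M * (1 + s) ^ 6 ≤ 64 * M * s ^ 6 := by
    calc M * (1 + s) ^ 6 ≤ M * (2 * s) ^ 6 := by gcongr; linarith
      _ = _ := by ring
  have g9 : (s ^ 8 / 2) * (2 * s - 12) ≤ r₂ * (2 * s - 12) := by
    gcongr
    linarith
  have g10 : 8 * s ^ 7 + 64 * M * s ^ 6 ≤ (s ^ 8 / 2) * (2 * s - 12) := by
    have : 8 * s + 64 * M ≤ s ^ 2 * (s - 6) := by nlinarith
    have := mul_le_mul_of_nonneg_left this (by positivity : 0 ≤ s ^ 6)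
    linarith
  linarith

namespace IsSlope

variable {ξ c₁ : ℝ} {ρ ρ₁ : ℝ → ℝ}

theorem le_quadratic (S : IsSlope ξ c₁ ρ ρ₁) {s : ℝ} (h0 : 0 ≤ s) (h1 : s ≤ -ξ) :
    ρ s ≤ ξ * s ^ 2 / 2 := by
  have hd : ∀ t, 0 < t → HasDerivAt (fun t => ρ t - ξ * t ^ 2 / 2)
      (t ^ 2 + 2 * ξ * t - ρ t ^ 2 - ξ * t) t := by
    intro t ht
    refine ((S.hasDeriv t ht).fun_sub
      ((((hasDerivAt_id t).fun_pow 2).const_mul ξ).div_const 2)).congr_deriv ?_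
    simp only [id]
    push_cast
    ring
  have anti : AntitoneOn (fun t => ρ t - ξ * t ^ 2 / 2) (Icc 0 (-ξ)) := by
    refine antitoneOn_of_deriv_nonpos (convex_Icc _ _) ?_ ?_ ?_
    · exact (S.cont.mono Icc_subset_Ici_self).sub (by fun_prop)
    · intro t ht
      rw [interior_Icc] at ht
      exact (hd t ht.1).differentiableAt.differentiableWithinAt
    · intro t ht
      rw [interior_Icc] at ht
      rw [(hd t ht.1).deriv]
      nlinarith [ht.1, ht.2, sq_nonneg (ρ t)]
  have := anti (left_mem_Icc.2 (h0.trans h1)) ⟨h0, h1⟩ h0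
  simp only [S.zero] at this
  linarith

theorem abs_le (S : IsSlope ξ c₁ ρ ρ₁) {s : ℝ} (h0 : 0 ≤ s) : |ρ s| ≤ 4 * (1 + s) := by
  have := S.ge s h0
  have := S.nonpos s h0
  have := S.neg
  exact _root_.abs_le.2 ⟨by linarith, by linarith⟩

theorem abs_drift_le (S : IsSlope ξ c₁ ρ ρ₁) {L : ℝ}
    (hL : ∀ s, 0 ≤ s → |ρ₁ s| ≤ L * (1 + s) ^ 3) {s : ℝ} (h0 : 0 ≤ s) :
    |2 * s * ((s + ξ) ^ 2 - ρ s ^ 2) - 2 * ρ s * ρ₁ s| ≤ (34 + 8 * L) * (1 + s) ^ 4 := by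
  have h1 := S.abs_le h0
  have h2 := hL s h0
  have h3 : |s + ξ| ≤ 1 + s :=
    _root_.abs_le.2 ⟨by linarith [S.neg_one_lt], by linarith [S.neg]⟩
  have h4 : |2 * s| ≤ 2 * (1 + s) := by rw [abs_of_nonneg (by positivity)]; linarith
  have hy : 1 ≤ 1 + s := by linarith
  generalize 1 + s = y at *
  have y3 : y ^ 3 ≤ y ^ 4 := pow_le_pow_right₀ hy (by norm_num)
  calc |2 * s * ((s + ξ) ^ 2 - ρ s ^ 2) - 2 * ρ s * ρ₁ s|
      ≤ 2 * y * (y ^ 2 + (4 * y) ^ 2) + 2 * (4 * y) * (L * y ^ 3) := by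
        refine (abs_sub _ _).trans (add_le_add ?_ ?_)
        · rw [abs_mul]
          gcongr
          refine (abs_sub _ _).trans ?_
          rw [abs_pow, abs_pow]
          gcongr
        · rw [abs_mul, abs_mul, abs_two]
          gcongr
    _ ≤ _ := by linarith

theorem exists_lin (S : IsSlope ξ c₁ ρ ρ₁) :
    ∃ L₁, ∀ s, 0 ≤ s → s ≤ 1 → ρ₁ s ≤ L₁ * s := by
  obtain ⟨L, hL0, hL⟩ := S.bound₁
  refine ⟨c₁ + (34 + 8 * L) * 2 ^ 4, fun s h0 h1 => ?_⟩
  set L₁ := c₁ + (34 + 8 * L) * 2 ^ 4 with hL₁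
  have hd : ∀ t, 0 < t → HasDerivAt (fun t => ρ₁ t - L₁ * t)
      (c₁ + 2 * t * ((t + ξ) ^ 2 - ρ t ^ 2) - 2 * ρ t * ρ₁ t - L₁) t := by
    intro t ht
    refine ((S.hasDeriv₁ t ht).fun_sub ((hasDerivAt_id t).const_mul L₁)).congr_deriv ?_
    simp
  have anti : AntitoneOn (fun t => ρ₁ t - L₁ * t) (Icc 0 1) := by
    refine antitoneOn_of_deriv_nonpos (convex_Icc _ _) ?_ ?_ ?_
    · exact (S.cont₁.mono Icc_subset_Ici_self).sub (by fun_prop)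
    · intro t ht
      rw [interior_Icc] at ht
      exact (hd t ht.1).differentiableAt.differentiableWithinAt
    · intro t ht
      rw [interior_Icc] at ht
      rw [(hd t ht.1).deriv]
      have h5 := (le_abs_self _).trans (S.abs_drift_le hL ht.1.le)
      have h6 : (34 + 8 * L) * (1 + t) ^ 4 ≤ (34 + 8 * L) * 2 ^ 4 := by
        have := ht.1
        gcongr
        linarith [ht.2]
      linarith
  have := anti (left_mem_Icc.2 zero_le_one) ⟨h0, h1⟩ h0
  simp only [S.zero₁] at this
  linarith

set_option maxHeartbeats 1000000 in
/-- Subsolutions `σ` of the Riccati equation with curvature parameter `h`. -/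
theorem exists_riccati (S : IsSlope ξ c₁ ρ ρ₁) : ∃ K h₀ : ℝ, 0 < K ∧ 0 < h₀ ∧
    ∀ h, 0 < h → h < h₀ → ∃ (σ σ' : ℝ → ℝ) (b : ℝ), -ξ ≤ b ∧ 2 * h * b < 1 ∧
      ContinuousOn σ (Icc 0 b) ∧ (∀ s ∈ Ioo 0 b, HasDerivAt σ (σ' s) s) ∧
      (∀ s ∈ Ioo 0 b, (1 - 2 * h * s) * (σ' s + (ξ ^ 2 - c₁ * h - K * h ^ 2))
        ≤ (s + ξ) ^ 2 - σ s ^ 2) ∧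
      (∀ s ∈ Icc 0 (-ξ), σ s ≤ 0) ∧ -(b + ξ) ≤ σ b := by
  obtain ⟨L, hL0, hL⟩ := S.bound₁
  obtain ⟨L₁, hL₁⟩ := S.exists_lin
  have hξ := S.neg
  have hξ1 := S.neg_one_lt
  set M := 68 + 16 * L + L ^ 2 with hM
  set K₀ := 1 + L₁ ^ 2 / (2 * -ξ) with hK₀
  have hK₀1 : 1 ≤ K₀ := by
    have : 0 ≤ L₁ ^ 2 / (2 * -ξ) := div_nonneg (sq_nonneg _) (by linarith)
    linarith
  set s₂ := 16 + 64 * M + 48 * L + 2 * K₀ with hs₂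
  have hM0 : 68 ≤ M := by nlinarith
  clear_value M K₀ s₂
  have hs16 : 16 ≤ s₂ := by linarith
  set N := M * (1 + s₂) ^ 6 + 2 * (4 * (1 + s₂)) * (s₂ ^ 8 + K₀)
    + 2 * (L * (1 + s₂) ^ 3) * (s₂ ^ 8 + K₀) + (s₂ ^ 8 + K₀) ^ 2 with hN
  have hN0 : 0 ≤ N := by positivity
  clear_value N
  obtain ⟨K, hK⟩ : ∃ K, K = 2 * (8 * s₂ ^ 7 + N) := ⟨_, rfl⟩
  have hKp : 0 < K := by rw [hK]; positivity
  refine ⟨K, 1 / s₂ ^ 4, hKp, by positivity, fun h hh hh0 => ?_⟩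
  have hhs : h * s₂ ^ 4 < 1 := by rwa [lt_div_iff₀ (by positivity)] at hh0
  have hhs1 : h * s₂ * 16 ^ 3 ≤ h * s₂ ^ 4 := by
    rw [show h * s₂ ^ 4 = h * s₂ * s₂ ^ 3 by ring]
    gcongr
  have hhsm : h * s₂ < 1 / 4096 := by linarith
  have hhm : h < 1 / 4096 := by nlinarith
  set b := √√(3 / h) with hb
  have hb4 : h * b ^ 4 = 3 := by
    rw [show b ^ 4 = (b ^ 2) ^ 2 by ring, hb, Real.sq_sqrt (by positivity),
      Real.sq_sqrt (by positivity)]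
    field_simp
  have hb0 : 0 ≤ b := Real.sqrt_nonneg _
  clear_value b
  have hbs : s₂ ≤ b := by
    by_contra! hlt
    have : b ^ 4 < s₂ ^ 4 := by gcongr
    nlinarith
  have hb16 : 16 ≤ b := hs16.trans hbs
  have hbh : 2 * h * b < 1 := by
    have : b * 16 ^ 3 ≤ b ^ 4 := by
      rw [show b ^ 4 = b * b ^ 3 by ring]
      gcongr
    nlinarith
  have hσd : ∀ s, 0 < s → HasDerivAt (fun s => ρ s + h * ρ₁ s + h ^ 2 * (s ^ 8 - K₀))
      ((s ^ 2 + 2 * ξ * s - ρ s ^ 2)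
        + h * (c₁ + 2 * s * ((s + ξ) ^ 2 - ρ s ^ 2) - 2 * ρ s * ρ₁ s)
        + h ^ 2 * (8 * s ^ 7)) s := by
    intro s hs
    refine (((S.hasDeriv s hs).fun_add ((S.hasDeriv₁ s hs).const_mul h)).fun_add
      ((((hasDerivAt_id s).fun_pow 8).sub_const K₀).const_mul (h ^ 2))).congr_deriv ?_
    simp
  refine ⟨fun s => ρ s + h * ρ₁ s + h ^ 2 * (s ^ 8 - K₀), _, b, by linarith, hbh, ?_,
    fun s hs => hσd s hs.1, ?_, ?_, ?_⟩
  · have h1 := S.cont.mono (Icc_subset_Ici_self : Icc 0 b ⊆ _)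
    have h2 := S.cont₁.mono (Icc_subset_Ici_self : Icc 0 b ⊆ _)
    fun_prop
  · intro s hs
    have hs0 := hs.1
    have d1 := (_root_.abs_le.1 (S.abs_drift_le hL hs0.le)).1
    have d2 := hL s hs0.le
    have d3 := S.le s hs0.le
    have d4 := S.abs_le hs0.le
    obtain ⟨g, hg⟩ : ∃ g, g = 2 * s * ((s + ξ) ^ 2 - ρ s ^ 2) - 2 * ρ s * ρ₁ s := ⟨_, rfl⟩
    rw [← hg] at d1
    have hG : -(M * (1 + s) ^ 6) ≤ 2 * s * g - ρ₁ s ^ 2 := by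
      rw [hM]
      exact riccati_source_bound hL0 hs0 d1 d2
    have key : (1 - 2 * h * s) * (8 * s ^ 7 - K)
        ≤ 2 * s * g - ρ₁ s ^ 2 - 2 * ρ s * (s ^ 8 - K₀)
          - 2 * h * ρ₁ s * (s ^ 8 - K₀) - h ^ 2 * (s ^ 8 - K₀) ^ 2 := by
      rcases le_total s s₂ with hss | hss
      · exact riccati_remainder_near hh hs0 hL0 hM0 hK₀1 hhsm hhm (by rw [hK, hN]) hKp d2 d4 hG hss
      · refine riccati_remainder_far hh hs0 hL0 hM0 hK₀1 hs₂ hξ1 hKp ?_ ?_ d2 d3 hG hss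
        · nlinarith [hs.2]
        · rw [← hb4]
          have := hs.2.le
          gcongr
    have := mul_le_mul_of_nonneg_left key (sq_nonneg h)
    rw [hg] at this
    linarith
  · intro s hs
    have h1 := S.le_quadratic hs.1 hs.2
    have h2 := mul_le_mul_of_nonneg_left (hL₁ s hs.1 (by linarith [hs.2])) hh.le
    have h3 : s ^ 8 ≤ 1 := pow_le_one₀ hs.1 (by linarith [hs.2])
    have h4 : h ^ 2 * (s ^ 8 - K₀) ≤ h ^ 2 * (1 - K₀) := by gcongr
    have h5 : h ^ 2 * (1 - K₀) = h ^ 2 * L₁ ^ 2 / (2 * ξ) := by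
      rw [hK₀]
      have : ξ ≠ 0 := hξ.ne
      field_simp
      ring
    have h6 : ξ * s ^ 2 / 2 + h * (L₁ * s) + h ^ 2 * L₁ ^ 2 / (2 * ξ)
        = (ξ * s + h * L₁) ^ 2 / (2 * ξ) := by
      have : ξ ≠ 0 := hξ.ne
      field_simp
      ring
    have h7 : (ξ * s + h * L₁) ^ 2 / (2 * ξ) ≤ 0 :=
      div_nonpos_of_nonneg_of_nonpos (sq_nonneg _) (by linarith)
    simp only
    linarith
  · have h1 := S.ge b hb0
    have h2 : -(L * (2 * b) ^ 3) ≤ ρ₁ b := by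
      have := (_root_.abs_le.1 (hL b hb0)).1
      have : L * (1 + b) ^ 3 ≤ L * (2 * b) ^ 3 := by gcongr; linarith
      linarith
    have h3 : -1 ≤ h * ρ₁ b := by
      have k2 : b * (-1) ≤ b * (h * ρ₁ b) := by
        calc b * (-1) ≤ -(8 * L * 3) := by linarith
          _ = -(8 * L * (h * b ^ 4)) := by rw [hb4]
          _ = b * (h * -(L * (2 * b) ^ 3)) := by ring
          _ ≤ _ := by gcongr
      exact le_of_mul_le_mul_left k2 (by linarith)
    have h4 : h ^ 2 * (b ^ 8 - K₀) = 9 - h ^ 2 * K₀ := by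
      have : h ^ 2 * b ^ 8 = (h * b ^ 4) ^ 2 := by ring
      rw [hb4] at this
      linarith
    have h5 : h ^ 2 * K₀ ≤ 1 := by
      have : h * K₀ ≤ 1 := by nlinarith
      nlinarith
    simp only
    linarith

end IsSlope
/-- Data giving the lower bound `lam` for the radial operator with potential `(n - B r²/2)²/r²`. -/
def RadialBarrier (B lam n : ℝ) : Prop :=
  ∃ (r₁ R : ℝ) (G G' : ℝ → ℝ), 0 ≤ r₁ ∧ r₁ ≤ R ∧ R ≤ 1 ∧ ContinuousOn G (Icc r₁ R) ∧
    (∀ r ∈ Ioo r₁ R, HasDerivAt G (G' r) r) ∧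
    (∀ r ∈ Ioo r₁ R, lam * r ^ 2 ≤ (n - B * r ^ 2 / 2) ^ 2 - G r ^ 2 + r * G' r) ∧
    -(n - B * r₁ ^ 2 / 2) ≤ G r₁ ∧ G R ≤ 0 ∧
    ∀ r ∈ Ioo R 1, lam * r ^ 2 ≤ (n - B * r ^ 2 / 2) ^ 2

theorem radial_piece {f f' d : ℝ → ℂ} {G G' V : ℝ → ℝ} {lam a b : ℝ} (ha : 0 ≤ a) (hab : a ≤ b)
    (hf : ContinuousOn f (Icc a b)) (hf' : ContinuousOn f' (Icc a b))
    (hd : ContinuousOn d (Icc a b)) (hder : ∀ r ∈ Ioo a b, HasDerivAt f (f' r) r)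
    (hG : ContinuousOn G (Icc a b)) (hGd : ∀ r ∈ Ioo a b, HasDerivAt G (G' r) r)
    (hV : ∀ r ∈ Ioo a b, V r ^ 2 * ‖f r‖ ^ 2 ≤ r ^ 2 * ‖d r‖ ^ 2)
    (hle : ∀ r ∈ Ioo a b, lam * r ^ 2 ≤ V r ^ 2 - G r ^ 2 + r * G' r) :
    G a * ‖f a‖ ^ 2 - G b * ‖f b‖ ^ 2
      ≤ ∫ r in a..b, (r * ‖f' r‖ ^ 2 + r * ‖d r‖ ^ 2 - lam * (r * ‖f r‖ ^ 2)) := by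
  have hcont : ContinuousOn
      (fun r => r * ‖f' r‖ ^ 2 + r * ‖d r‖ ^ 2 - lam * (r * ‖f r‖ ^ 2)) (Icc a b) := by
    fun_prop
  have := intervalIntegral.sub_le_integral_of_hasDeriv_right_of_le (g := fun r => -(G r * ‖f r‖ ^ 2))
    (g' := fun r => -(G' r * ‖f r‖ ^ 2 + G r * (2 * inner ℝ (f r) (f' r)))) hab (by fun_prop)
    (fun r hr => (((hGd r hr).mul ((hder r hr).norm_sq)).neg).hasDerivWithinAt)
    hcont.integrableOn_Icc ?_
  · linarith
  intro r hr
  have hr0 : 0 < r := ha.trans_lt hr.1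
  have h1 := hV r hr
  have h2 := mul_le_mul_of_nonneg_right (hle r hr) (sq_nonneg ‖f r‖)
  have h3 : 0 ≤ ‖(r : ℝ) • f' r + (G r) • f r‖ ^ 2 := sq_nonneg _
  rw [norm_add_sq_real, norm_smul, norm_smul, real_inner_smul_left, real_inner_smul_right,
    real_inner_comm, mul_pow, mul_pow, Real.norm_eq_abs, Real.norm_eq_abs, sq_abs, sq_abs] at h3
  refine le_of_mul_le_mul_left ?_ hr0
  nlinarith

theorem RadialBarrier.lower_bound {B lam n : ℝ} (H : RadialBarrier B lam n) (hlam : lam ≤ B)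
    {f f' d : ℝ → ℂ}
    (hf : ContinuousOn f (Icc 0 1)) (hf' : ContinuousOn f' (Icc 0 1))
    (hd : ContinuousOn d (Icc 0 1)) (hder : ∀ r ∈ Ioo 0 1, HasDerivAt f (f' r) r)
    (hV : ∀ r ∈ Icc (0 : ℝ) 1, (n - B * r ^ 2 / 2) ^ 2 * ‖f r‖ ^ 2 ≤ r ^ 2 * ‖d r‖ ^ 2) :
    lam * ∫ r in (0 : ℝ)..1, r * ‖f r‖ ^ 2
      ≤ ∫ r in (0 : ℝ)..1, (r * ‖f' r‖ ^ 2 + r * ‖d r‖ ^ 2) := by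
  obtain ⟨r₁, R, G, G', h0, h1, h2, hG, hGd, hle, hG1, hGR, hout⟩ := H
  have i1 : Icc 0 r₁ ⊆ Icc (0 : ℝ) 1 := Icc_subset_Icc le_rfl (h1.trans h2)
  have i2 : Icc r₁ R ⊆ Icc (0 : ℝ) 1 := Icc_subset_Icc h0 h2
  have i3 : Icc R 1 ⊆ Icc (0 : ℝ) 1 := Icc_subset_Icc (h0.trans h1) le_rfl
  have o1 : Ioo 0 r₁ ⊆ Ioo (0 : ℝ) 1 := Ioo_subset_Ioo le_rfl (h1.trans h2)
  have o2 : Ioo r₁ R ⊆ Ioo (0 : ℝ) 1 := Ioo_subset_Ioo h0 h2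
  have o3 : Ioo R 1 ⊆ Ioo (0 : ℝ) 1 := Ioo_subset_Ioo (h0.trans h1) le_rfl
  have p1 := radial_piece (G := fun r => -(n - B * r ^ 2 / 2)) (G' := fun r => B * r) (lam := lam)
    (V := fun r => n - B * r ^ 2 / 2) le_rfl h0 (hf.mono i1) (hf'.mono i1) (hd.mono i1)
    (fun r hr => hder r (o1 hr)) (by fun_prop)
    (fun r _ => by
      refine (((((hasDerivAt_id r).fun_pow 2).const_mul B).div_const 2).const_sub n).fun_neg.congr_deriv
        ?_
      simp only [id]
      push_cast
      ring) (fun r hr => hV r (i1 (Ioo_subset_Icc_self hr)))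
    (fun r hr => by nlinarith [mul_le_mul_of_nonneg_right hlam (sq_nonneg r)])
  have p2 := radial_piece (V := fun r => n - B * r ^ 2 / 2) h0 h1 (hf.mono i2) (hf'.mono i2)
    (hd.mono i2) (fun r hr => hder r (o2 hr)) hG hGd
    (fun r hr => hV r (i2 (Ioo_subset_Icc_self hr))) hle
  have p3 := radial_piece (G := fun _ => 0) (G' := fun _ => 0) (lam := lam)
    (V := fun r => n - B * r ^ 2 / 2) (h0.trans h1) h2 (hf.mono i3) (hf'.mono i3) (hd.mono i3)
    (fun r hr => hder r (o3 hr)) (by fun_prop) (fun r _ => hasDerivAt_const r _)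
    (fun r hr => hV r (i3 (Ioo_subset_Icc_self hr)))
    (fun r hr => by simpa using hout r hr)
  have hcont : ContinuousOn
      (fun r => r * ‖f' r‖ ^ 2 + r * ‖d r‖ ^ 2 - lam * (r * ‖f r‖ ^ 2)) (Icc 0 1) := by
    fun_prop
  have hc1 : ContinuousOn (fun r => r * ‖f' r‖ ^ 2 + r * ‖d r‖ ^ 2) (Icc 0 1) := by fun_prop
  have hc2 : ContinuousOn (fun r => lam * (r * ‖f r‖ ^ 2)) (Icc 0 1) := by fun_prop
  have ii : ∀ a b : ℝ, a ≤ b → Icc a b ⊆ Icc 0 1 → IntervalIntegrable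
      (fun r => r * ‖f' r‖ ^ 2 + r * ‖d r‖ ^ 2 - lam * (r * ‖f r‖ ^ 2)) volume a b := by
    intro a b hab hs
    refine ContinuousOn.intervalIntegrable ?_
    rw [uIcc_of_le hab]
    exact hcont.mono hs
  have s1 := intervalIntegral.integral_add_adjacent_intervals (ii 0 r₁ h0 i1) (ii r₁ R h1 i2)
  have s2 := intervalIntegral.integral_add_adjacent_intervals (ii 0 R (h0.trans h1)
    (Icc_subset_Icc le_rfl h2)) (ii R 1 h2 i3)
  have s3 : ∫ r in (0 : ℝ)..1, (r * ‖f' r‖ ^ 2 + r * ‖d r‖ ^ 2 - lam * (r * ‖f r‖ ^ 2))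
      = (∫ r in (0 : ℝ)..1, (r * ‖f' r‖ ^ 2 + r * ‖d r‖ ^ 2))
        - lam * ∫ r in (0 : ℝ)..1, r * ‖f r‖ ^ 2 := by
    rw [intervalIntegral.integral_sub (hc1.intervalIntegrable_of_Icc zero_le_one)
      (hc2.intervalIntegrable_of_Icc zero_le_one), intervalIntegral.integral_const_mul]
  have hz : n * ‖f 0‖ ^ 2 = 0 := by
    have := hV 0 (left_mem_Icc.2 zero_le_one)
    rcases eq_or_ne n 0 with h | h
    · simp [h]
    · have hn : 0 < n ^ 2 := by positivity
      have : n ^ 2 * ‖f 0‖ ^ 2 ≤ 0 := by simpa using this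
      have : ‖f 0‖ ^ 2 ≤ 0 := by
        by_contra! hc
        have := mul_pos hn hc
        linarith
      have : ‖f 0‖ ^ 2 = 0 := le_antisymm this (sq_nonneg _)
      rw [this, mul_zero]
  have e1 := mul_le_mul_of_nonneg_right hG1 (sq_nonneg ‖f r₁‖)
  have e2 := mul_nonneg (neg_nonneg.2 hGR) (sq_nonneg ‖f R‖)
  have e3 : -(n - B * 0 ^ 2 / 2) * ‖f 0‖ ^ 2 = 0 := by
    rw [show -(n - B * 0 ^ 2 / 2) * ‖f 0‖ ^ 2 = -(n * ‖f 0‖ ^ 2) by ring, hz, neg_zero]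
  rw [e3] at p1
  linarith

theorem radialBarrier_of_half_le {q lam n : ℝ} (hn : q ^ 2 / 2 ≤ n) :
    RadialBarrier (q ^ 2) lam n := by
  refine ⟨1, 1, fun _ => 0, fun _ => 0, zero_le_one, le_rfl, le_rfl, by fun_prop, by simp, by simp,
    ?_, le_rfl, by simp⟩
  linarith

theorem radialBarrier_deep {q T lam n M : ℝ} (hq : 0 < q) (hn : 0 ≤ n) (hM : 0 < M)
    (hT : 1 ≤ M ^ 2 * (1 - T)) (hlam : lam ≤ T * q ^ 2)
    (hnM : n = q ^ 2 / 2 - 2 * M * q) : RadialBarrier (q ^ 2) lam n := by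
  set r₁ := √(2 * (n + M * q) / q ^ 2) with hr₁
  have hr1 : q ^ 2 * r₁ ^ 2 = 2 * (n + M * q) := by
    rw [hr₁, Real.sq_sqrt (by positivity)]
    field_simp
  have hr10 : 0 ≤ r₁ := Real.sqrt_nonneg _
  have hr11 : r₁ ≤ 1 := by
    by_contra! h
    have : 1 < r₁ ^ 2 := by nlinarith
    nlinarith [mul_pos hM hq, mul_lt_mul_of_pos_left this (by positivity : 0 < q ^ 2)]
  clear_value r₁
  have hx : ∀ r : ℝ, HasDerivAt (fun r => (n - q ^ 2 * r ^ 2 / 2) / q) (-(q * r)) r := by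
    intro r
    refine (((((hasDerivAt_id r).fun_pow 2).const_mul (q ^ 2)).div_const 2).const_sub
      n).div_const q |>.congr_deriv ?_
    simp only [id]
    field_simp
    push_cast
    ring
  refine ⟨r₁, 1, fun r => q * (-((n - q ^ 2 * r ^ 2 / 2) / q)
      - 2 / M * ((n - q ^ 2 * r ^ 2 / 2) / q + M) ^ 2), fun r => q *
      (-(-(q * r)) - 2 / M * (2 * ((n - q ^ 2 * r ^ 2 / 2) / q + M) * -(q * r))),
      hr10, hr11, le_rfl, by fun_prop, ?_, ?_, ?_, ?_, by simp⟩
  · intro r _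
    refine (((hx r).fun_neg.fun_sub (((hx r).add_const M).fun_pow 2 |>.const_mul
      (2 / M))).const_mul q).congr_deriv ?_
    push_cast
    ring
  · intro r hr
    have hV : n - q ^ 2 * r ^ 2 / 2 = q * ((n - q ^ 2 * r ^ 2 / 2) / q) := by field_simp
    obtain ⟨t, ht⟩ : ∃ t, (n - q ^ 2 * r ^ 2 / 2) / q = M * (t - 1) :=
      ⟨(n - q ^ 2 * r ^ 2 / 2) / q / M + 1, by field_simp; ring⟩
    rw [ht] at hV
    beta_reduce
    rw [ht, hV]
    have hr0 : 0 < r := hr10.trans_lt hr.1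
    have k1 : r₁ ^ 2 ≤ r ^ 2 := by have := hr.1.le; gcongr
    have k2 : r ^ 2 ≤ 1 := pow_le_one₀ hr0.le hr.2.le
    have t0 : t ≤ 0 := by
      by_contra! h
      have := mul_pos (mul_pos hq hM) h
      nlinarith [mul_le_mul_of_nonneg_left k1 (sq_nonneg q)]
    have t1 : -1 ≤ t := by
      by_contra! h
      have := mul_pos (mul_pos hq hM) (by linarith : 0 < -1 - t)
      nlinarith [mul_le_mul_of_nonneg_left k2 (sq_nonneg q)]
    have hT' : T - 1 - 4 * t ≤ 4 * M ^ 2 * t ^ 2 := by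
      have hT1 : 0 < 1 - T := by
        by_contra! h
        nlinarith [sq_nonneg M]
      have : 0 ≤ (1 - T) * (4 * M ^ 2 * t ^ 2 - (T - 1 - 4 * t)) := by
        nlinarith [sq_nonneg (2 * t + (1 - T)), mul_le_mul_of_nonneg_right hT (sq_nonneg t)]
      have := nonneg_of_mul_nonneg_right this hT1
      linarith
    have k3 : r ^ 2 * (T - 1 - 4 * t) ≤ 4 * M ^ 2 * t ^ 2 := by
      rcases le_total (T - 1 - 4 * t) 0 with h | h
      · have : 0 ≤ M ^ 2 * t ^ 2 := by positivity
        nlinarith [sq_nonneg r]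
      · nlinarith
    have k4 : 4 * M ^ 2 * t ^ 2 ≤ 4 * M ^ 2 * t ^ 2 * (1 - t - t ^ 2) := by
      have h5 : 0 ≤ -t * (1 + t) := mul_nonneg (by linarith) (by linarith)
      have : 0 ≤ M ^ 2 * t ^ 2 := by positivity
      nlinarith [mul_nonneg this h5]
    have k5 := mul_le_mul_of_nonneg_left (k3.trans k4) (sq_nonneg q)
    have k6 := mul_le_mul_of_nonneg_right hlam (sq_nonneg r)
    have e : (q * (M * (t - 1))) ^ 2
        - (q * (-(M * (t - 1)) - 2 / M * (M * (t - 1) + M) ^ 2)) ^ 2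
        + r * (q * (-(-(q * r)) - 2 / M * (2 * (M * (t - 1) + M) * -(q * r))))
        = q ^ 2 * (4 * M ^ 2 * t ^ 2 * (1 - t - t ^ 2)) + q ^ 2 * r ^ 2 * (1 + 4 * t) := by
      field_simp
      ring
    rw [e]
    linarith
  · simp only
    rw [hr1]
    have : (n - 2 * (n + M * q) / 2) / q = -M := by field_simp; ring
    rw [this]
    simp
    linarith
  · simp only
    have : (n - q ^ 2 * 1 ^ 2 / 2) / q = -2 * M := by rw [hnM]; field_simp; ring
    rw [this]
    have : q * (-(-2 * M) - 2 / M * (-2 * M + M) ^ 2) = 0 := by field_simp; ring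
    exact this.le

set_option maxHeartbeats 1000000 in
theorem radialBarrier_boundary {K h q n Y lam ξ c₁ b : ℝ} {σ σ' : ℝ → ℝ} (hξ : ξ < 0) (hq : 0 < q)
    (hY : 0 < Y) (hh : h * Y = 1) (hYn : Y ^ 2 + 2 * ξ * Y = 2 * n) (hn0 : 0 ≤ n) (hnq : n < q ^ 2 / 2)
    (hlam : lam * Y ^ 2 ≤ q ^ 2 * (ξ ^ 2 * Y ^ 2 - c₁ * Y - K)) (hlam' : lam ≤ ξ ^ 2 * q ^ 2)
    (hb : -ξ ≤ b) (hbh : 2 * h * b < 1) (hσc : ContinuousOn σ (Icc 0 b))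
    (hσd : ∀ s ∈ Ioo 0 b, HasDerivAt σ (σ' s) s)
    (hσ : ∀ s ∈ Ioo 0 b, (1 - 2 * h * s) * (σ' s + (ξ ^ 2 - c₁ * h - K * h ^ 2))
        ≤ (s + ξ) ^ 2 - σ s ^ 2)
    (hσ0 : ∀ s ∈ Icc 0 (-ξ), σ s ≤ 0) (hσb : -(b + ξ) ≤ σ b) : RadialBarrier (q ^ 2) lam n := by
  have hh0 : 0 < h := pos_of_mul_pos_left (by rw [hh]; exact one_pos) hY.le
  set r₁ := √(1 - 2 * h * b) * Y / q with hr₁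
  have hr10 : 0 ≤ r₁ := by positivity
  have hr1 : h ^ 2 * q ^ 2 * r₁ ^ 2 = 1 - 2 * h * b := by
    rw [hr₁, div_pow, mul_pow, Real.sq_sqrt (by linarith)]
    have : h = 1 / Y := by field_simp; linarith
    rw [this]
    field_simp
  have hs : ∀ r, 1 - 2 * h * (h * (n - q ^ 2 * r ^ 2 / 2) - ξ) = h ^ 2 * q ^ 2 * r ^ 2 := by
    intro r
    linear_combination h ^ 2 * hYn - (h * Y + 1 + 2 * ξ * h) * hh
  clear_value r₁
  have hhq : 0 < h * q := mul_pos hh0 hq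
  have hd : ∀ r : ℝ, HasDerivAt (fun r => h * (n - q ^ 2 * r ^ 2 / 2) - ξ) (-(h * q ^ 2 * r)) r := by
    intro r
    refine (((((hasDerivAt_id r).fun_pow 2).const_mul (q ^ 2)).div_const 2).const_sub
      n).const_mul h |>.sub_const ξ |>.congr_deriv ?_
    simp only [id]
    push_cast
    ring
  have hub : ∀ r, r₁ ≤ r → h * (n - q ^ 2 * r ^ 2 / 2) - ξ ≤ b := by
    intro r hr
    have : h ^ 2 * q ^ 2 * r₁ ^ 2 ≤ h ^ 2 * q ^ 2 * r ^ 2 := by gcongr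
    rw [hr1, ← hs] at this
    nlinarith
  have hub' : ∀ r, r₁ < r → h * (n - q ^ 2 * r ^ 2 / 2) - ξ < b := by
    intro r hr
    have : h ^ 2 * q ^ 2 * r₁ ^ 2 < h ^ 2 * q ^ 2 * r ^ 2 := by gcongr
    rw [hr1, ← hs] at this
    nlinarith
  have hlb : ∀ r, 0 ≤ r → r ≤ Y / q → 0 ≤ h * (n - q ^ 2 * r ^ 2 / 2) - ξ := by
    intro r hr hr'
    rw [le_div_iff₀ hq] at hr'
    have h1 : (h * (r * q)) ^ 2 ≤ 1 := by
      refine pow_le_one₀ (by positivity) ?_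
      calc h * (r * q) ≤ h * Y := by gcongr
        _ = 1 := hh
    have h2 := hs r
    nlinarith
  have hlb' : ∀ r, 0 ≤ r → r < Y / q → 0 < h * (n - q ^ 2 * r ^ 2 / 2) - ξ := by
    intro r hr hr'
    rw [lt_div_iff₀ hq] at hr'
    have h1 : (h * (r * q)) ^ 2 < 1 := by
      refine pow_lt_one₀ (by positivity) ?_ two_ne_zero
      calc h * (r * q) < h * Y := by gcongr
        _ = 1 := hh
    have h2 := hs r
    nlinarith
  have hsr1 : h * (n - q ^ 2 * r₁ ^ 2 / 2) - ξ = b := by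
    have := hs r₁
    rw [hr1] at this
    have : 2 * h * (h * (n - q ^ 2 * r₁ ^ 2 / 2) - ξ - b) = 0 := by linarith
    rcases mul_eq_zero.1 this with h | h <;> linarith
  have hr1Y : r₁ ≤ Y / q := by
    by_contra! hc
    have h1 : (1 : ℝ) < (h * q * r₁) ^ 2 := by
      refine one_lt_pow₀ ?_ two_ne_zero
      rw [div_lt_iff₀ hq] at hc
      calc 1 = h * Y := hh.symm
        _ < h * (r₁ * q) := by gcongr
        _ = _ := by ring
    nlinarith
  have hs1 : h * (n - q ^ 2 * 1 ^ 2 / 2) - ξ ≤ -ξ := by nlinarith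
  have hr11 : r₁ ≤ 1 := by
    by_contra! hc
    have h1 : (h * q) ^ 2 * 1 ^ 2 < (h * q) ^ 2 * r₁ ^ 2 := by gcongr
    have h2 := hs 1
    nlinarith
  have hmem : ∀ r ∈ Icc r₁ (min (Y / q) 1), h * (n - q ^ 2 * r ^ 2 / 2) - ξ ∈ Icc 0 b :=
    fun r hr => ⟨hlb r (hr10.trans hr.1) (hr.2.trans (min_le_left _ _)), hub r hr.1⟩
  have hmem' : ∀ r ∈ Ioo r₁ (min (Y / q) 1), h * (n - q ^ 2 * r ^ 2 / 2) - ξ ∈ Ioo 0 b :=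
    fun r hr => ⟨hlb' r (hr10.trans hr.1.le) (hr.2.trans_le (min_le_left _ _)), hub' r hr.1⟩
  refine ⟨r₁, min (Y / q) 1, fun r => σ (h * (n - q ^ 2 * r ^ 2 / 2) - ξ) / h,
    fun r => σ' (h * (n - q ^ 2 * r ^ 2 / 2) - ξ) * (-(h * q ^ 2 * r)) / h, hr10,
    le_min hr1Y hr11, min_le_right _ _, ?_, ?_, ?_, ?_, ?_, ?_⟩
  · exact (hσc.comp (by fun_prop) hmem).div_const h
  · intro r hr
    exact ((hσd _ (hmem' r hr)).comp r (hd r)).div_const h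
  · intro r hr
    have h1 := hσ _ (hmem' r hr)
    rw [hs r] at h1
    beta_reduce
    obtain ⟨s, hse⟩ : ∃ s, s = h * (n - q ^ 2 * r ^ 2 / 2) - ξ := ⟨_, rfl⟩
    have hV : n - q ^ 2 * r ^ 2 / 2 = (s + ξ) * Y := by
      rw [hse]; linear_combination -(n - q ^ 2 * r ^ 2 / 2) * hh
    rw [← hse] at h1 ⊢
    rw [hV]
    have hhY : h = 1 / Y := by field_simp; linarith
    have h2 := mul_le_mul_of_nonneg_left h1 (sq_nonneg Y)
    have h3 := mul_le_mul_of_nonneg_right hlam (sq_nonneg r)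
    have e1 : Y ^ 2 * (h ^ 2 * q ^ 2 * r ^ 2 * (σ' s + (ξ ^ 2 - c₁ * h - K * h ^ 2)))
        = q ^ 2 * r ^ 2 * σ' s + q ^ 2 * (ξ ^ 2 * Y ^ 2 - c₁ * Y - K) * r ^ 2 / Y ^ 2 := by
      rw [hhY]; field_simp
    have e2 : ((s + ξ) * Y) ^ 2 - (σ s / h) ^ 2 + r * (σ' s * (-(h * q ^ 2 * r)) / h)
        = Y ^ 2 * ((s + ξ) ^ 2 - σ s ^ 2) - q ^ 2 * r ^ 2 * σ' s := by
      rw [hhY]; field_simp; ring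
    have e3 : lam * r ^ 2 ≤ q ^ 2 * (ξ ^ 2 * Y ^ 2 - c₁ * Y - K) * r ^ 2 / Y ^ 2 := by
      rw [le_div_iff₀ (by positivity)]
      linarith
    rw [e2]
    linarith
  · beta_reduce
    rw [hsr1, le_div_iff₀ hh0]
    refine le_trans (le_of_eq ?_) hσb
    linarith
  · refine div_nonpos_of_nonpos_of_nonneg ?_ hh0.le
    rcases le_total (Y / q) 1 with h1 | h1
    · rw [min_eq_left h1]
      have : h * (n - q ^ 2 * (Y / q) ^ 2 / 2) - ξ = 0 := by
        have e : q ^ 2 * (Y / q) ^ 2 = Y ^ 2 := by field_simp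
        rw [e]
        linear_combination -(h / 2) * hYn + ξ * hh
      rw [this]
      exact hσ0 0 ⟨le_rfl, by linarith⟩
    · rw [min_eq_right h1]
      exact hσ0 _ ⟨hlb 1 zero_le_one h1, hs1⟩
  · intro r hr
    have h1 : Y / q < r := by
      rcases le_total (Y / q) 1 with h1 | h1
      · rw [min_eq_left h1] at hr; exact hr.1
      · rw [min_eq_right h1] at hr; exact absurd (hr.1.trans hr.2) (lt_irrefl _)
    rw [div_lt_iff₀ hq] at h1
    have h0 : 0 < r := pos_of_mul_pos_left (hY.trans h1) hq.le
    have hYξ : 0 ≤ Y + 2 * ξ := by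
      by_contra! hc
      have := mul_neg_of_pos_of_neg hY hc
      linarith
    have h2 : 0 ≤ q ^ 2 * r ^ 2 / 2 - n + ξ * (q * r) := by
      have := mul_nonneg (sub_nonneg.2 h1.le) (by linarith : 0 ≤ r * q + (Y + 2 * ξ))
      linarith
    have h3 : (ξ * (q * r)) ^ 2 ≤ (n - q ^ 2 * r ^ 2 / 2) ^ 2 := by
      have h4 : 0 ≤ -ξ * (q * r) := mul_nonneg (by linarith) (mul_pos hq h0).le
      have := pow_le_pow_left₀ h4 (by linarith : -ξ * (q * r) ≤ q ^ 2 * r ^ 2 / 2 - n) 2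
      linarith
    have := mul_le_mul_of_nonneg_right hlam' (sq_nonneg r)
    linarith

theorem IsSlope.exists_radialBarrier {ξ c₁ : ℝ} {ρ ρ₁ : ℝ → ℝ} (S : IsSlope ξ c₁ ρ ρ₁)
    (hc : 0 ≤ c₁) : ∃ C q₀ : ℝ, 0 < C ∧ 0 < q₀ ∧ ∀ q n, q₀ ≤ q → 0 ≤ n →
      RadialBarrier (q ^ 2) (ξ ^ 2 * q ^ 2 - c₁ * q - C) n := by
  obtain ⟨K, h₀, hK, hh₀, hmain⟩ := S.exists_riccati
  have hξ := S.neg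
  have hξ1 := S.neg_one_lt
  have hT : 0 < 1 - ξ ^ 2 := by nlinarith
  set M₀ := 1 / (1 - ξ ^ 2) with hM₀
  have hM1 : 1 ≤ M₀ := by
    rw [hM₀, le_div_iff₀ hT]
    nlinarith [sq_nonneg ξ]
  have hM2 : M₀ * (1 - ξ ^ 2) = 1 := by rw [hM₀]; field_simp
  clear_value M₀
  refine ⟨8 * M₀ * c₁ + 4 * K, 8 * M₀ + 4 / h₀, by positivity, by positivity, fun q n hq hn => ?_⟩
  have h4 : 0 < 4 / h₀ := by positivity
  have hq0 : 0 < q := by linarith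
  have hlam' : ξ ^ 2 * q ^ 2 - c₁ * q - (8 * M₀ * c₁ + 4 * K) ≤ ξ ^ 2 * q ^ 2 := by
    have : 0 ≤ c₁ * q := by positivity
    have : 0 ≤ 8 * M₀ * c₁ + 4 * K := by positivity
    linarith
  rcases le_or_gt (q ^ 2 / 2) n with h1 | h1
  · exact radialBarrier_of_half_le h1
  rcases le_or_gt n (q ^ 2 / 2 - 2 * M₀ * q) with h2 | h2
  · have hMM : M₀ ≤ (q ^ 2 / 2 - n) / (2 * q) := by
      rw [le_div_iff₀ (by positivity)]
      linarith
    refine radialBarrier_deep (T := ξ ^ 2) (M := (q ^ 2 / 2 - n) / (2 * q)) hq0 hn (by linarith) ?_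
      hlam' (by field_simp; ring)
    have : M₀ * 1 ≤ ((q ^ 2 / 2 - n) / (2 * q)) ^ 2 := by nlinarith
    calc 1 = M₀ * 1 * (1 - ξ ^ 2) := by rw [mul_one, hM2]
      _ ≤ _ := by gcongr
  set Y := √(ξ ^ 2 + 2 * n) - ξ with hY
  have hsq : (Y + ξ) ^ 2 = ξ ^ 2 + 2 * n := by
    rw [hY, sub_add_cancel, Real.sq_sqrt (by positivity)]
  have hYξ : 0 ≤ Y + ξ := by rw [hY, sub_add_cancel]; exact Real.sqrt_nonneg _
  clear_value Y
  have hY0 : 0 < Y := by linarith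
  have hYq : q - 4 * M₀ ≤ Y := by
    by_contra! hlt
    have : Y ^ 2 < (q - 4 * M₀) ^ 2 := by gcongr
    nlinarith [mul_pos hY0 (neg_pos.2 hξ), mul_nonneg (by linarith : 0 ≤ M₀) (by linarith : 0 ≤ q - 4 * M₀)]
  have hYh : Y * h₀ > 1 := by
    have : 2 / h₀ < Y := by
      have : 4 / h₀ = 2 * (2 / h₀) := by ring
      linarith
    rw [div_lt_iff₀ hh₀] at this
    linarith
  obtain ⟨σ, σ', b, hb, hbh, hσc, hσd, hσ, hσ0, hσb⟩ := hmain (1 / Y) (by positivity)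
    (by rw [div_lt_iff₀ hY0]; linarith)
  refine radialBarrier_boundary (K := K) (h := 1 / Y) (Y := Y) hξ hq0 hY0 (by field_simp)
    (by linarith) hn h1 ?_ hlam' hb hbh hσc hσd hσ hσ0 hσb
  have k1 : q ^ 2 ≤ 4 * Y ^ 2 := by
    have : q ≤ 2 * Y := by linarith
    nlinarith
  have k2 : q ^ 2 * Y ≤ (q + 8 * M₀) * Y ^ 2 := by
    have : q ^ 2 ≤ (q + 8 * M₀) * Y := by nlinarith
    nlinarith
  have k3 := mul_le_mul_of_nonneg_left k2 hc
  have k4 := mul_le_mul_of_nonneg_left k1 hK.le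
  linarith

/-- Polar coordinates, as a map on the plane. -/
def polarMap (r θ : ℝ) : Plane := (r * Real.cos θ, r * Real.sin θ)

theorem continuous_polarMap : Continuous (fun p : ℝ × ℝ => polarMap p.1 p.2) := by
  unfold polarMap
  fun_prop

theorem measurableSet_unitDisc : MeasurableSet unitDisc :=
  (isOpen_lt (by fun_prop) (by fun_prop)).measurableSet

theorem setIntegral_unitDisc_polar {f : Plane → ℝ} (hf : Continuous f) :
    ∫ x in unitDisc, f x
      = ∫ r in (0 : ℝ)..1, r * ∫ θ in (-Real.pi)..Real.pi, f (polarMap r θ) := by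
  have hpi : -Real.pi ≤ Real.pi := by linarith [Real.pi_pos]
  rw [← integral_indicator measurableSet_unitDisc, ← integral_comp_polarCoord_symm]
  have hc : Continuous fun p : ℝ × ℝ => p.1 * f (polarMap p.1 p.2) :=
    continuous_fst.mul (hf.comp continuous_polarMap)
  have e1 : ∀ p ∈ polarCoord.target, p.1 • unitDisc.indicator f (polarCoord.symm p)
      = (Ioo (0 : ℝ) 1 ×ˢ Ioo (-Real.pi) Real.pi).indicator
        (fun p => p.1 * f (polarMap p.1 p.2)) p := by
    intro p hp
    have hp' : 0 < p.1 ∧ p.2 ∈ Ioo (-Real.pi) Real.pi := by simpa [polarCoord] using hp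
    have hmem : polarCoord.symm p ∈ unitDisc ↔ p ∈ Ioo (0 : ℝ) 1 ×ˢ Ioo (-Real.pi) Real.pi := by
      have : (p.1 * Real.cos p.2) ^ 2 + (p.1 * Real.sin p.2) ^ 2 = p.1 ^ 2 := by
        linear_combination p.1 ^ 2 * Real.sin_sq_add_cos_sq p.2
      simp only [unitDisc, polarCoord_symm_apply, mem_ofPred_eq, this, mem_prod, mem_Ioo]
      rw [sq_lt_one_iff₀ hp'.1.le]
      exact ⟨fun h => ⟨⟨hp'.1, h⟩, hp'.2⟩, fun h => h.1.2⟩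
    by_cases h : p ∈ Ioo (0 : ℝ) 1 ×ˢ Ioo (-Real.pi) Real.pi
    · rw [indicator_of_mem h, indicator_of_mem (hmem.2 h), smul_eq_mul]
      rfl
    · rw [indicator_of_notMem h, indicator_of_notMem (fun h' => h (hmem.1 h')), smul_zero]
  have hsub : Ioo (0 : ℝ) 1 ×ˢ Ioo (-Real.pi) Real.pi ⊆ polarCoord.target := by
    rintro p ⟨h1, h2⟩
    exact ⟨h1.1, h2⟩
  rw [setIntegral_congr_fun polarCoord.open_target.measurableSet e1,
    setIntegral_indicator (measurableSet_Ioo.prod measurableSet_Ioo), inter_eq_right.2 hsub,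
    Measure.volume_eq_prod, setIntegral_prod]
  · rw [intervalIntegral.integral_of_le zero_le_one, integral_Ioc_eq_integral_Ioo]
    refine setIntegral_congr_fun measurableSet_Ioo fun r _ => ?_
    rw [intervalIntegral.integral_of_le hpi, integral_Ioc_eq_integral_Ioo, integral_const_mul]
  · rw [← Measure.volume_eq_prod]
    exact (hc.continuousOn.integrableOn_compact (isCompact_Icc.prod isCompact_Icc)).mono_set
      (prod_mono Ioo_subset_Icc_self Ioo_subset_Icc_self)

/-- The (unnormalized) angular Fourier coefficient. -/
def angCoeff (G : ℝ → ℝ → ℂ) (m : ℤ) (r : ℝ) : ℂ :=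
  ∫ θ in (-Real.pi)..Real.pi, Complex.exp (-(m * θ * Complex.I)) * G r θ

theorem norm_exp_ang (m : ℤ) (θ : ℝ) : ‖Complex.exp (-(m * θ * Complex.I))‖ = 1 := by
  have : -((m : ℂ) * θ * Complex.I) = ((-(m * θ) : ℝ) : ℂ) * Complex.I := by push_cast; ring
  rw [this, Complex.norm_exp_ofReal_mul_I]

theorem continuous_angCoeff {G : ℝ → ℝ → ℂ} (hG : Continuous (Function.uncurry G)) (m : ℤ) :
    Continuous (angCoeff G m) := by
  refine intervalIntegral.continuous_parametric_intervalIntegral_of_continuous'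
    (f := fun r θ => Complex.exp (-(m * θ * Complex.I)) * G r θ) ?_ _ _
  have : Continuous fun p : ℝ × ℝ => G p.1 p.2 := hG
  simp only [Function.uncurry_def]
  fun_prop

theorem hasSum_sq_angCoeff {g : ℝ → ℂ} (hg : Continuous g) :
    HasSum (fun m : ℤ => ‖∫ θ in (-Real.pi)..Real.pi, Complex.exp (-(m * θ * Complex.I)) * g θ‖ ^ 2)
      (2 * Real.pi * ∫ θ in (-Real.pi)..Real.pi, ‖g θ‖ ^ 2) := by
  have hpi := Real.pi_pos
  have hab : -Real.pi < Real.pi := by linarith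
  obtain ⟨M, hM⟩ := (isCompact_Icc (a := -Real.pi) (b := Real.pi)).exists_bound_of_continuousOn
    hg.continuousOn
  have hL2 : MemLp g 2 (volume.restrict (Ioc (-Real.pi) Real.pi)) := by
    refine MemLp.of_bound hg.aestronglyMeasurable M ?_
    filter_upwards [ae_restrict_mem measurableSet_Ioc] with θ hθ
    exact hM θ (Ioc_subset_Icc_self hθ)
  have h := (hasSum_sq_fourierCoeffOn hab hL2).mul_left ((2 * Real.pi) ^ 2)
  have e : (Real.pi - -Real.pi) = 2 * Real.pi := by ring
  have e2 : (2 * Real.pi) ^ 2 * ((Real.pi - -Real.pi)⁻¹ • ∫ x in (-Real.pi)..Real.pi, ‖g x‖ ^ 2)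
      = 2 * Real.pi * ∫ θ in (-Real.pi)..Real.pi, ‖g θ‖ ^ 2 := by
    rw [e, smul_eq_mul]
    field_simp
  rw [e2] at h
  refine Eq.subst (motive := fun F => HasSum F _) (funext fun m => ?_) h
  rw [fourierCoeffOn_eq_integral, norm_smul, mul_pow _ (‖_‖), ← mul_assoc, e]
  have e3 : (2 * Real.pi) ^ 2 * ‖1 / (2 * Real.pi)‖ ^ 2 = 1 := by
    rw [Real.norm_of_nonneg (by positivity)]
    field_simp
  rw [e3, one_mul]
  congr 2
  refine intervalIntegral.integral_congr fun θ _ => ?_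
  simp only [fourier_coe_apply, smul_eq_mul]
  congr 2
  push_cast
  have : (Real.pi : ℂ) ≠ 0 := by exact_mod_cast hpi.ne'
  field_simp

theorem hasSum_integral_angCoeff {G : ℝ → ℝ → ℂ} (hG : Continuous (Function.uncurry G)) :
    HasSum (fun m : ℤ => ∫ r in (0 : ℝ)..1, r * ‖angCoeff G m r‖ ^ 2)
      (2 * Real.pi * ∫ r in (0 : ℝ)..1, r * ∫ θ in (-Real.pi)..Real.pi, ‖G r θ‖ ^ 2) := by
  have hN : Continuous fun r => ∫ θ in (-Real.pi)..Real.pi, ‖G r θ‖ ^ 2 := by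
    refine intervalIntegral.continuous_parametric_intervalIntegral_of_continuous'
      (f := fun r θ => ‖G r θ‖ ^ 2) ?_ _ _
    exact (hG.norm.pow 2)
  have hs : ∀ r, HasSum (fun m : ℤ => r * ‖angCoeff G m r‖ ^ 2)
      (r * (2 * Real.pi * ∫ θ in (-Real.pi)..Real.pi, ‖G r θ‖ ^ 2)) := fun r =>
    (hasSum_sq_angCoeff (hG.comp (Continuous.prodMk_right r))).mul_left r
  have h := intervalIntegral.hasSum_integral_of_dominated_convergence (a := 0) (b := 1)
    (μ := volume)
    (F := fun (m : ℤ) r => r * ‖angCoeff G m r‖ ^ 2)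
    (f := fun r => r * (2 * Real.pi * ∫ θ in (-Real.pi)..Real.pi, ‖G r θ‖ ^ 2))
    (fun m r => r * ‖angCoeff G m r‖ ^ 2)
    (fun m => (by have := continuous_angCoeff hG m; fun_prop :
      Continuous fun r => r * ‖angCoeff G m r‖ ^ 2).aestronglyMeasurable)
    (fun m => ae_of_all _ fun r hr => by
      rw [uIoc_of_le zero_le_one] at hr
      rw [Real.norm_of_nonneg (mul_nonneg hr.1.le (by positivity))])
    (ae_of_all _ fun r _ => (hs r).summable)
    (by
      simp only [(hs _).tsum_eq]
      exact Continuous.intervalIntegrable (by fun_prop) _ _)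
    (ae_of_all _ fun r _ => hs r)
  have e : 2 * Real.pi * (∫ r in (0 : ℝ)..1, r * ∫ θ in (-Real.pi)..Real.pi, ‖G r θ‖ ^ 2)
      = ∫ r in (0 : ℝ)..1, r * (2 * Real.pi * ∫ θ in (-Real.pi)..Real.pi, ‖G r θ‖ ^ 2) := by
    rw [← intervalIntegral.integral_const_mul]
    refine intervalIntegral.integral_congr fun r _ => ?_
    ring
  rwa [e]

theorem hasDerivAt_angCoeff {G G' : ℝ → ℝ → ℂ} (hG : Continuous (Function.uncurry G))
    (hG' : Continuous (Function.uncurry G'))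
    (h : ∀ r θ, HasDerivAt (fun r => G r θ) (G' r θ) r) (m : ℤ) (r : ℝ) :
    HasDerivAt (angCoeff G m) (angCoeff G' m r) r := by
  obtain ⟨M, hM⟩ := ((isCompact_Icc (a := r - 1) (b := r + 1)).prod
    (isCompact_Icc (a := -Real.pi) (b := Real.pi))).exists_bound_of_continuousOn hG'.continuousOn
  have hc : ∀ {G : ℝ → ℝ → ℂ}, Continuous (Function.uncurry G) → ∀ r,
      Continuous fun θ : ℝ => Complex.exp (-(m * θ * Complex.I)) * G r θ := by
    intro G hG r
    have : Continuous (G r) := hG.comp (Continuous.prodMk_right r)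
    fun_prop
  refine (intervalIntegral.hasDerivAt_integral_of_dominated_loc_of_deriv_le
    (F := fun r θ => Complex.exp (-(m * θ * Complex.I)) * G r θ)
    (F' := fun r θ => Complex.exp (-(m * θ * Complex.I)) * G' r θ)
    (bound := fun _ => M)
    (Icc_mem_nhds (by linarith : r - 1 < r) (by linarith : r < r + 1))
    (Eventually.of_forall fun r => (hc hG r).aestronglyMeasurable)
    ((hc hG r).intervalIntegrable _ _) (hc hG' r).aestronglyMeasurable
    (ae_of_all _ fun θ hθ x hx => ?_) intervalIntegrable_const
    (ae_of_all _ fun θ _ x _ => (h x θ).const_mul _)).2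
  rw [norm_mul, norm_exp_ang, one_mul]
  rw [uIoc_of_le (by linarith [Real.pi_pos])] at hθ
  exact hM (x, θ) ⟨hx, Ioc_subset_Icc_self hθ⟩

theorem angCoeff_deriv_angle {G G' : ℝ → ℝ → ℂ} (hG' : Continuous (Function.uncurry G')) {r : ℝ}
    (h : ∀ θ, HasDerivAt (G r) (G' r θ) θ) (hper : G r (-Real.pi) = G r Real.pi) (m : ℤ) :
    angCoeff G' m r = m * Complex.I * angCoeff G m r := by
  have hd : ∀ θ : ℝ, HasDerivAt (fun θ : ℝ => Complex.exp (-(m * θ * Complex.I)) * G r θ)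
      (Complex.exp (-(m * θ * Complex.I)) * G' r θ
        - m * Complex.I * (Complex.exp (-(m * θ * Complex.I)) * G r θ)) θ := by
    intro θ
    have h1 : HasDerivAt (fun θ : ℝ => -((m : ℂ) * θ * Complex.I)) (-(m * Complex.I)) θ := by
      have := ((Complex.ofRealCLM.hasDerivAt (x := θ)).const_mul (m : ℂ)).mul_const Complex.I
      simpa using this.fun_neg
    exact (h1.cexp.fun_mul (h θ)).congr_deriv (by ring)
  have hc' : Continuous (G' r) := hG'.comp (Continuous.prodMk_right r)
  have hc : Continuous (G r) := continuous_iff_continuousAt.2 fun θ => (h θ).continuousAt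
  have i1 : Continuous fun θ : ℝ => Complex.exp (-(m * θ * Complex.I)) * G' r θ := by fun_prop
  have i2 : Continuous fun θ : ℝ => (m : ℂ) * Complex.I *
    (Complex.exp (-(m * θ * Complex.I)) * G r θ) := by fun_prop
  have := intervalIntegral.integral_eq_sub_of_hasDerivAt (a := -Real.pi) (b := Real.pi)
    (fun θ _ => hd θ) ((i1.sub i2).intervalIntegrable _ _)
  rw [intervalIntegral.integral_sub (i1.intervalIntegrable _ _) (i2.intervalIntegrable _ _),
    intervalIntegral.integral_const_mul] at this
  have e : Complex.exp (-(m * (Real.pi : ℝ) * Complex.I))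
      = Complex.exp (-(m * ((-Real.pi : ℝ) : ℂ) * Complex.I)) := by
    rw [Complex.exp_eq_exp_iff_exists_int]
    exact ⟨-m, by push_cast; ring⟩
  rw [e, hper, sub_self, sub_eq_zero] at this
  exact this

theorem magSq_polar {B r θ : ℝ} {u : Plane → ℂ} :
    magSq B F0 u (polarMap r θ) =
      ‖fderiv ℝ u (polarMap r θ) (Real.cos θ, Real.sin θ)‖ ^ 2 +
      ‖(-Complex.I) * fderiv ℝ u (polarMap r θ) (-Real.sin θ, Real.cos θ)
        - ((B * r / 2 : ℝ) : ℂ) * u (polarMap r θ)‖ ^ 2 := by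
  unfold magSq
  set L := fderiv ℝ u (polarMap r θ)
  have hL : ∀ a b : ℝ, L (a, b) = a * L (1, 0) + b * L (0, 1) := by
    intro a b
    have : ((a, b) : ℝ × ℝ) = a • (1, 0) + b • (0, 1) := by simp
    rw [this, map_add, map_smul, map_smul, Complex.real_smul, Complex.real_smul]
  rw [hL (Real.cos θ), hL (-Real.sin θ)]
  have h1 := Real.sin_sq_add_cos_sq θ
  clear_value L
  generalize u (polarMap r θ) = w
  simp only [F0, polarMap, ← Complex.normSq_eq_norm_sq, Complex.normSq_apply]
  generalize L (1, 0) = p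
  generalize L (0, 1) = q
  generalize Real.sin θ = s at *
  generalize Real.cos θ = c at *
  simp only [Complex.sub_re, Complex.sub_im, Complex.mul_re, Complex.mul_im, Complex.neg_re,
    Complex.neg_im, Complex.I_re, Complex.I_im, Complex.ofReal_re, Complex.ofReal_im,
    Complex.add_re, Complex.add_im]
  linear_combination (-(p.re ^ 2 + p.im ^ 2 + q.re ^ 2 + q.im ^ 2)
    + B ^ 2 * r ^ 2 / 4 * (w.re ^ 2 + w.im ^ 2)) * h1

theorem disc_lower_bound {B lam : ℝ} (hB : 0 ≤ B) (hlam : lam ≤ B)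
    (H : ∀ n, 0 ≤ n → RadialBarrier B lam n) {u : Plane → ℂ} (hu : ContDiff ℝ 1 u) :
    lam * ∫ x in unitDisc, ‖u x‖ ^ 2 ≤ ∫ x in unitDisc, magSq B F0 u x := by
  have hpi := Real.pi_pos
  have hfd : Continuous (fderiv ℝ u) := hu.continuous_fderiv (by norm_num)
  have huc := hu.continuous
  have hcu : Continuous fun p : ℝ × ℝ => u (polarMap p.1 p.2) := huc.comp continuous_polarMap
  have hcd : Continuous fun p : ℝ × ℝ => fderiv ℝ u (polarMap p.1 p.2) :=
    hfd.comp continuous_polarMap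
  set U : ℝ → ℝ → ℂ := fun r θ => u (polarMap r θ) with hU
  set Ur : ℝ → ℝ → ℂ := fun r θ => fderiv ℝ u (polarMap r θ) (Real.cos θ, Real.sin θ) with hUr
  set Ut : ℝ → ℝ → ℂ := fun r θ => fderiv ℝ u (polarMap r θ) (-Real.sin θ, Real.cos θ) with hUt
  set Dt : ℝ → ℝ → ℂ := fun r θ => (-Complex.I) * Ut r θ - ((B * r / 2 : ℝ) : ℂ) * U r θ with hDt
  have cU : Continuous (Function.uncurry U) := hcu
  have cUr : Continuous (Function.uncurry Ur) := by
    simp only [Function.uncurry_def, hUr]; fun_prop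
  have cUt : Continuous (Function.uncurry Ut) := by
    simp only [Function.uncurry_def, hUt]; fun_prop
  have cDt : Continuous (Function.uncurry Dt) := by
    have : Continuous fun p : ℝ × ℝ => Ut p.1 p.2 := cUt
    have : Continuous fun p : ℝ × ℝ => U p.1 p.2 := cU
    simp only [Function.uncurry_def, hDt]; fun_prop
  have dr : ∀ r θ, HasDerivAt (fun r => U r θ) (Ur r θ) r := by
    intro r θ
    have h1 : HasDerivAt (fun r => polarMap r θ) (Real.cos θ, Real.sin θ) r := by
      have h2 := ((hasDerivAt_id r).mul_const (Real.cos θ)).prodMk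
        ((hasDerivAt_id r).mul_const (Real.sin θ))
      simpa [polarMap] using h2
    exact ((hu.differentiable (by norm_num) _).hasFDerivAt.comp_hasDerivAt r h1)
  have dt : ∀ r θ, HasDerivAt (U r) (r * Ut r θ) θ := by
    intro r θ
    have h1 : HasDerivAt (fun θ => polarMap r θ) (r • (-Real.sin θ, Real.cos θ)) θ := by
      have h2 := ((Real.hasDerivAt_cos θ).const_mul r).prodMk ((Real.hasDerivAt_sin θ).const_mul r)
      simpa [polarMap] using h2
    refine ((hu.differentiable (by norm_num) _).hasFDerivAt.comp_hasDerivAt θ h1).congr_deriv ?_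
    rw [map_smul, Complex.real_smul]
  have key : ∀ (m : ℤ) (r : ℝ), (r : ℂ) * angCoeff Dt m r
      = ((m - B * r ^ 2 / 2 : ℝ) : ℂ) * angCoeff U m r := by
    intro m r
    have h1 := angCoeff_deriv_angle (G := U) (G' := fun r θ => r * Ut r θ) (r := r)
      (by
        have : Continuous fun p : ℝ × ℝ => Ut p.1 p.2 := cUt
        simp only [Function.uncurry_def]; fun_prop)
      (dt r)
      (by simp [hU, polarMap]) m
    have i0 : Continuous (U r) := cU.comp (Continuous.prodMk_right r)
    have i1 : Continuous (Ut r) := cUt.comp (Continuous.prodMk_right r)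
    have e : (r : ℂ) * angCoeff Dt m r = -Complex.I * angCoeff (fun r θ => r * Ut r θ) m r
        - ((B * r ^ 2 / 2 : ℝ) : ℂ) * angCoeff U m r := by
      unfold angCoeff
      rw [← intervalIntegral.integral_const_mul, ← intervalIntegral.integral_const_mul,
        ← intervalIntegral.integral_const_mul, ← intervalIntegral.integral_sub
        (Continuous.intervalIntegrable (by fun_prop) _ _)
        (Continuous.intervalIntegrable (by fun_prop) _ _)]
      refine intervalIntegral.integral_congr fun θ _ => ?_
      simp only [hDt]
      push_cast
      ring
    rw [e, h1]
    push_cast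
    linear_combination (-(m : ℂ)) * angCoeff U m r * Complex.I_mul_I
  have hterm : ∀ m : ℤ, lam * ∫ r in (0 : ℝ)..1, r * ‖angCoeff U m r‖ ^ 2
      ≤ (∫ r in (0 : ℝ)..1, r * ‖angCoeff Ur m r‖ ^ 2)
        + ∫ r in (0 : ℝ)..1, r * ‖angCoeff Dt m r‖ ^ 2 := by
    intro m
    have c1 := continuous_angCoeff cU m
    have c2 := continuous_angCoeff cUr m
    have c3 := continuous_angCoeff cDt m
    rw [← intervalIntegral.integral_add (Continuous.intervalIntegrable (by fun_prop) _ _)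
      (Continuous.intervalIntegrable (by fun_prop) _ _)]
    refine (H (max m 0) (le_max_right _ _)).lower_bound hlam c1.continuousOn c2.continuousOn
      c3.continuousOn (fun r _ => hasDerivAt_angCoeff cU cUr dr m r) fun r hr => ?_
    have h1 : r ^ 2 * ‖angCoeff Dt m r‖ ^ 2 = (m - B * r ^ 2 / 2) ^ 2 * ‖angCoeff U m r‖ ^ 2 := by
      have := congrArg (fun z => ‖z‖ ^ 2) (key m r)
      simpa only [norm_mul, mul_pow, Complex.norm_real, Real.norm_eq_abs, sq_abs] using this
    rw [h1]
    refine mul_le_mul_of_nonneg_right ?_ (by positivity)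
    have h0 : 0 ≤ B * r ^ 2 / 2 := by positivity
    rcases le_total (0 : ℝ) m with hm | hm
    · rw [max_eq_left hm]
    · rw [max_eq_right hm]
      nlinarith
  have s1 := (hasSum_integral_angCoeff cU).mul_left lam
  have s2 := (hasSum_integral_angCoeff cUr).add (hasSum_integral_angCoeff cDt)
  have hle := hasSum_le hterm s1 s2
  have cmag : Continuous fun x => magSq B F0 u x := by
    unfold magSq F0
    fun_prop
  rw [setIntegral_unitDisc_polar (f := fun x => ‖u x‖ ^ 2) (by fun_prop), setIntegral_unitDisc_polar cmag]
  have e : (∫ r in (0 : ℝ)..1, r * ∫ θ in (-Real.pi)..Real.pi, magSq B F0 u (polarMap r θ))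
      = (∫ r in (0 : ℝ)..1, r * ∫ θ in (-Real.pi)..Real.pi, ‖Ur r θ‖ ^ 2)
        + ∫ r in (0 : ℝ)..1, r * ∫ θ in (-Real.pi)..Real.pi, ‖Dt r θ‖ ^ 2 := by
    have hN : ∀ {G : ℝ → ℝ → ℂ}, Continuous (Function.uncurry G) →
        Continuous fun r => ∫ θ in (-Real.pi)..Real.pi, ‖G r θ‖ ^ 2 := fun {G} hG =>
      intervalIntegral.continuous_parametric_intervalIntegral_of_continuous'
        (f := fun r θ => ‖G r θ‖ ^ 2) (by exact hG.norm.pow 2) _ _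
    have n1 := hN cUr
    have n2 := hN cDt
    rw [← intervalIntegral.integral_add (Continuous.intervalIntegrable (by fun_prop) _ _)
      (Continuous.intervalIntegrable (by fun_prop) _ _)]
    refine intervalIntegral.integral_congr fun r _ => ?_
    have i1 : Continuous (Ur r) := cUr.comp (Continuous.prodMk_right r)
    have i2 : Continuous (Dt r) := cDt.comp (Continuous.prodMk_right r)
    rw [← mul_add, ← intervalIntegral.integral_add (Continuous.intervalIntegrable (by fun_prop) _ _)
      (Continuous.intervalIntegrable (by fun_prop) _ _)]
    congr 1
    exact intervalIntegral.integral_congr fun θ _ => magSq_polar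
  rw [e]
  have h2 : 0 < 2 * Real.pi := by positivity
  refine le_of_mul_le_mul_left ?_ h2
  linear_combination hle

theorem hasDerivAt_sq_max (y : ℝ) :
    HasDerivAt (fun y : ℝ => max 0 y ^ 2) (2 * max 0 y) y := by
  rcases lt_trichotomy y 0 with h | h | h
  · rw [max_eq_left h.le, mul_zero]
    refine (hasDerivAt_const y (0 : ℝ)).congr_of_eventuallyEq ?_
    filter_upwards [Iio_mem_nhds h] with z hz
    rw [max_eq_left (le_of_lt hz)]
    norm_num
  · subst h
    rw [max_self, mul_zero, hasDerivAt_iff_isLittleO]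
    have h2 : (fun y : ℝ => y ^ 2) =o[𝓝 0] fun y : ℝ => y := by
      simpa using Asymptotics.isLittleO_pow_id (𝕜 := ℝ) (n := 2) (by norm_num)
    refine Asymptotics.IsBigO.trans_isLittleO ?_ (h2.congr_right fun y => (sub_zero y).symm)
    refine Asymptotics.IsBigO.of_bound 1 (Eventually.of_forall fun y => ?_)
    simp only [max_self, sub_zero, smul_zero, Real.norm_eq_abs, one_mul]
    rw [zero_pow two_ne_zero, sub_zero, abs_of_nonneg (by positivity), abs_of_nonneg (sq_nonneg y)]
    rcases le_total y 0 with hy | hy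
    · rw [max_eq_left hy]; nlinarith [sq_nonneg y]
    · rw [max_eq_right hy]
  · rw [max_eq_right h.le]
    refine (((hasDerivAt_id y).fun_pow 2).congr_deriv (by simp)).congr_of_eventuallyEq ?_
    filter_upwards [Ioi_mem_nhds h] with z hz
    rw [max_eq_right (le_of_lt hz)]
    rfl

/-- The cut-off in the normal variable at scale `1/h`. -/
def cutoff (h s : ℝ) : ℝ := max 0 (1 - 16 * h ^ 2 * s ^ 2) ^ 2

/-- The derivative of `cutoff h`. -/
def cutoffDeriv (h s : ℝ) : ℝ := -(64 * h ^ 2 * s * max 0 (1 - 16 * h ^ 2 * s ^ 2))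

theorem hasDerivAt_cutoff (h s : ℝ) : HasDerivAt (cutoff h) (cutoffDeriv h s) s := by
  have h1 : HasDerivAt (fun s : ℝ => 1 - 16 * h ^ 2 * s ^ 2) (-(32 * h ^ 2 * s)) s := by
    refine ((((hasDerivAt_id s).fun_pow 2).const_mul (16 * h ^ 2)).const_sub 1).congr_deriv ?_
    simp only [id]
    push_cast
    ring
  exact ((hasDerivAt_sq_max _).comp s h1).congr_deriv (by unfold cutoffDeriv; ring)

set_option maxHeartbeats 1000000 in
theorem trial_pointwise {h s δ ρ ρ₁ K₁ x T c t : ℝ} (hh : 0 < h) (hh1 : h ≤ 1) (hs : 0 ≤ s)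
    (hρ : |ρ| ≤ 4 * (1 + s)) (hρ₁ : |ρ₁| ≤ K₁ * (1 + s) ^ 3) (hx : |x| ≤ 1 + s)
    (hδ : 0 ≤ δ) (hδh : δ ≤ h) (hT : 0 ≤ T) (hT1 : T ≤ 1) (ht : 0 ≤ t) (ht1 : t ≤ 1)
    (hts : t = 0 ∨ 4 * h * s < 1) :
    (1 - 2 * h * s) * (ρ * t ^ 2 + -(64 * h ^ 2 * s * t)) ^ 2
      + (x + δ) ^ 2 / (1 - 2 * h * s) * t ^ 4 - (T - c * h) * t ^ 4
      - (2 * t ^ 2 * (-(64 * h ^ 2 * s * t)) * (ρ + h * ρ₁ - δ * (ρ ^ 2 - x ^ 2 + T))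
        + t ^ 4 * (ρ ^ 2 + x ^ 2 - T + h * c + 2 * h * s * (x ^ 2 - ρ ^ 2) + 2 * δ * x))
      ≤ (5000 + 128 * K₁) * h ^ 2 * (1 + s) ^ 4 := by
  rcases hts with rfl | hts
  · have hK : 0 ≤ K₁ := by
      have := (abs_nonneg _).trans hρ₁
      exact nonneg_of_mul_nonneg_left this (by positivity)
    simp only [ne_eq, OfNat.ofNat_ne_zero, not_false_eq_true, zero_pow, mul_zero, neg_zero,
      add_zero, zero_mul, sub_zero]
    positivity
  obtain ⟨L, hL⟩ : ∃ L, L = 1 + s := ⟨_, rfl⟩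
  rw [← hL] at hρ hρ₁ hx ⊢
  have hL1 : 1 ≤ L := by linarith
  have hsL : s ≤ L := by linarith
  have hL0 : 0 ≤ L := by linarith
  have p2 : 1 ≤ L ^ 2 := one_le_pow₀ hL1
  have p4 : L ^ 2 ≤ L ^ 4 := pow_le_pow_right₀ hL1 (by norm_num)
  have p3 : L ^ 3 ≤ L ^ 4 := pow_le_pow_right₀ hL1 (by norm_num)
  have p23 : L ^ 2 ≤ L ^ 3 := pow_le_pow_right₀ hL1 (by norm_num)
  have p13 : L ≤ L ^ 3 := le_self_pow₀ hL1 (by norm_num)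
  have hK : 0 ≤ K₁ := by
    have := (abs_nonneg _).trans hρ₁
    exact nonneg_of_mul_nonneg_left this (by positivity)
  have hy0 : 0 ≤ h * s := by positivity
  have hp : 0 < 1 - 2 * h * s := by linarith
  have hp1 : 1 - 2 * h * s ≤ 1 := by linarith
  have hx2 : x ^ 2 ≤ L ^ 2 := sq_le_sq' (by linarith [(abs_le.1 hx).1]) (abs_le.1 hx).2
  have hρ2 : ρ ^ 2 ≤ 16 * L ^ 2 := by
    have := sq_le_sq' (by linarith [(abs_le.1 hρ).1]) (abs_le.1 hρ).2
    linarith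
  have hw : |ρ + h * ρ₁ - δ * (ρ ^ 2 - x ^ 2 + T)| ≤ (22 + K₁) * L ^ 3 := by
    have a1 : |h * ρ₁| ≤ K₁ * L ^ 3 := by
      rw [abs_mul, abs_of_pos hh]
      calc h * |ρ₁| ≤ 1 * (K₁ * L ^ 3) := by gcongr
        _ = _ := one_mul _
    have a2 : |δ * (ρ ^ 2 - x ^ 2 + T)| ≤ 18 * L ^ 2 := by
      rw [abs_mul, abs_of_nonneg hδ]
      have : |ρ ^ 2 - x ^ 2 + T| ≤ 18 * L ^ 2 := by
        rw [abs_le]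
        constructor <;> nlinarith [sq_nonneg x, sq_nonneg ρ]
      calc δ * |ρ ^ 2 - x ^ 2 + T| ≤ 1 * (18 * L ^ 2) := by
            gcongr
            linarith
        _ = _ := one_mul _
    have := abs_le.1 a1
    have := abs_le.1 a2
    have := abs_le.1 hρ
    rw [abs_le]
    constructor <;> nlinarith
  obtain ⟨w, hwd⟩ : ∃ w, w = ρ + h * ρ₁ - δ * (ρ ^ 2 - x ^ 2 + T) := ⟨_, rfl⟩
  rw [← hwd] at hw ⊢
  have hdiv : (x + δ) ^ 2 / (1 - 2 * h * s)
      ≤ (x + δ) ^ 2 * (1 + 2 * h * s + 8 * (h * s) ^ 2) := by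
    rw [div_le_iff₀ hp, mul_assoc]
    refine le_mul_of_one_le_right (sq_nonneg _) ?_
    have : 0 ≤ (h * s) ^ 2 * (1 - 4 * (h * s)) := mul_nonneg (sq_nonneg _) (by linarith)
    nlinarith
  have hδL : δ ≤ L := by linarith
  have hxd : (x + δ) ^ 2 ≤ 4 * L ^ 2 := by
    have := abs_le.1 hx
    nlinarith
  have t1 : (x + δ) ^ 2 / (1 - 2 * h * s) - x ^ 2 - 2 * h * s * x ^ 2 - 2 * δ * x
      ≤ 38 * h ^ 2 * L ^ 4 := by
    have b1 : δ * x * (h * s) ≤ h ^ 2 * L ^ 2 := by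
      calc δ * x * (h * s) ≤ h * L * (h * L) := by
            refine mul_le_mul ?_ (by gcongr) hy0 (by positivity)
            calc δ * x ≤ δ * L := by gcongr; exact (abs_le.1 hx).2
              _ ≤ h * L := by gcongr
        _ = _ := by ring
    have b2 : δ ^ 2 * (1 + 2 * h * s) ≤ 2 * h ^ 2 := by
      have : δ ^ 2 ≤ h ^ 2 := by gcongr
      calc δ ^ 2 * (1 + 2 * h * s) ≤ h ^ 2 * 2 := by gcongr; linarith
        _ = _ := by ring
    have b3 : 8 * (h * s) ^ 2 * (x + δ) ^ 2 ≤ 32 * h ^ 2 * L ^ 4 := by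
      calc 8 * (h * s) ^ 2 * (x + δ) ^ 2 ≤ 8 * (h * L) ^ 2 * (4 * L ^ 2) := by gcongr
        _ = _ := by ring
    have b4 : h ^ 2 * L ^ 2 ≤ h ^ 2 * L ^ 4 := by gcongr
    have b5 : h ^ 2 * 1 ≤ h ^ 2 * L ^ 2 := by gcongr
    nlinarith
  have e : (1 - 2 * h * s) * (ρ * t ^ 2 + -(64 * h ^ 2 * s * t)) ^ 2
      + (x + δ) ^ 2 / (1 - 2 * h * s) * t ^ 4 - (T - c * h) * t ^ 4
      - (2 * t ^ 2 * (-(64 * h ^ 2 * s * t)) * w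
        + t ^ 4 * (ρ ^ 2 + x ^ 2 - T + h * c + 2 * h * s * (x ^ 2 - ρ ^ 2) + 2 * δ * x))
      = t ^ 4 * ((x + δ) ^ 2 / (1 - 2 * h * s) - x ^ 2 - 2 * h * s * x ^ 2 - 2 * δ * x)
        + (1 - 2 * h * s) * (128 * h ^ 2 * (s * (t ^ 3 * -ρ)) + 4096 * h ^ 2 * ((h * s) ^ 2 * t ^ 2))
        + 128 * h ^ 2 * (s * (t ^ 3 * w)) := by ring
  rw [e]
  have t3 : t ^ 3 ≤ 1 := pow_le_one₀ ht ht1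
  have t2 : t ^ 2 ≤ 1 := pow_le_one₀ ht ht1
  have t4 : t ^ 4 ≤ 1 := pow_le_one₀ ht ht1
  have c1 : t ^ 4 * ((x + δ) ^ 2 / (1 - 2 * h * s) - x ^ 2 - 2 * h * s * x ^ 2 - 2 * δ * x)
      ≤ 38 * h ^ 2 * L ^ 4 := by
    calc _ ≤ t ^ 4 * (38 * h ^ 2 * L ^ 4) := by gcongr
      _ ≤ 1 * (38 * h ^ 2 * L ^ 4) := by gcongr
      _ = _ := one_mul _
  have c2 : s * (t ^ 3 * -ρ) ≤ 4 * L ^ 2 := by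
    calc s * (t ^ 3 * -ρ) ≤ s * (t ^ 3 * |ρ|) := by
          gcongr
          exact neg_le_abs ρ
      _ ≤ s * (1 * |ρ|) := by gcongr
      _ ≤ L * (1 * (4 * L)) := by gcongr
      _ = _ := by ring
  have c4 : s * (t ^ 3 * w) ≤ (22 + K₁) * L ^ 4 := by
    calc s * (t ^ 3 * w) ≤ s * (t ^ 3 * |w|) := by
          gcongr
          exact le_abs_self w
      _ ≤ s * (1 * |w|) := by gcongr
      _ ≤ L * (1 * ((22 + K₁) * L ^ 3)) := by gcongr
      _ = _ := by ring
  have c5 : (1 - 2 * h * s) * (128 * h ^ 2 * (s * (t ^ 3 * -ρ))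
      + 4096 * h ^ 2 * ((h * s) ^ 2 * t ^ 2)) ≤ 1 * (128 * h ^ 2 * (4 * L ^ 4) + 1 * h ^ 2 * L ^ 4
        + 1024 * h ^ 2 * L ^ 4) := by
    have c3' : (h * s) ^ 2 * t ^ 2 ≤ 1 / 16 * 1 := by
      gcongr
      nlinarith
    have n0 : 0 ≤ 4096 * h ^ 2 * (1 / 16 * 1) := by positivity
    refine (mul_le_mul_of_nonneg_left (b := 128 * h ^ 2 * (s * (t ^ 3 * -ρ))
      + 4096 * h ^ 2 * ((h * s) ^ 2 * t ^ 2)) (c := 128 * h ^ 2 * (4 * L ^ 4) + 1 * h ^ 2 * L ^ 4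
        + 1024 * h ^ 2 * L ^ 4) ?_ hp.le).trans
      (mul_le_mul_of_nonneg_right hp1 (by positivity))
    have d1 : 128 * h ^ 2 * (s * (t ^ 3 * -ρ)) ≤ 128 * h ^ 2 * (4 * L ^ 4) :=
      mul_le_mul_of_nonneg_left (c2.trans (by linarith)) (by positivity)
    have d2 : 4096 * h ^ 2 * ((h * s) ^ 2 * t ^ 2) ≤ 1024 * h ^ 2 * L ^ 4 := by
      calc 4096 * h ^ 2 * ((h * s) ^ 2 * t ^ 2) ≤ 4096 * h ^ 2 * (1 / 16 * 1) := by gcongr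
        _ ≤ 1024 * h ^ 2 * 1 := by nlinarith [sq_nonneg h]
        _ ≤ _ := by
          gcongr
          linarith
    have d3 : 0 ≤ 1 * h ^ 2 * L ^ 4 := by positivity
    linarith
  have c6 : 128 * h ^ 2 * (s * (t ^ 3 * w)) ≤ 128 * h ^ 2 * ((22 + K₁) * L ^ 4) := by gcongr
  have n1 : 0 ≤ h ^ 2 * L ^ 4 := by positivity
  linarith

/-- The rescaled distance to the boundary, as a function of the polar radius. -/
def normalCoord (h r : ℝ) : ℝ := (1 - r ^ 2) / (2 * h)

theorem hasDerivAt_normalCoord {h : ℝ} (hh : h ≠ 0) (r : ℝ) :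
    HasDerivAt (normalCoord h) (-(r / h)) r := by
  refine ((((hasDerivAt_id r).fun_pow 2).const_sub 1).div_const (2 * h)).congr_deriv ?_
  simp only [id]
  push_cast
  field_simp

namespace IsProfile

variable {ξ : ℝ} {u v : ℝ → ℝ}

/-- Gaussian decay of the profile, with a polynomial weight. -/
theorem exists_decay (P : IsProfile ξ u v) :
    ∃ K, 0 < K ∧ ∀ s, 0 ≤ s → (1 + s) ^ 4 * u s ^ 2 ≤ K * Real.exp (-s) := by
  have hξ := P.neg
  have hξ1 := P.neg_one_lt
  have hanti : AntitoneOn (fun s => u s * Real.exp (s ^ 2 / 2 + ξ * s)) (Ici 0) := by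
    refine antitoneOn_of_deriv_nonpos (convex_Ici _) ?_ ?_ ?_
    · exact P.cont_u.mul (by fun_prop)
    all_goals
      intro t ht
      rw [interior_Ici] at ht
      have hd : HasDerivAt (fun s => u s * Real.exp (s ^ 2 / 2 + ξ * s))
          ((v t + (t + ξ) * u t) * Real.exp (t ^ 2 / 2 + ξ * t)) t := by
        have h1 : HasDerivAt (fun s : ℝ => s ^ 2 / 2 + ξ * s) (t + ξ) t := by
          refine ((((hasDerivAt_id t).fun_pow 2).div_const 2).fun_add
            ((hasDerivAt_id t).const_mul ξ)).congr_deriv ?_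
          simp only [id]
          push_cast
          ring
        exact ((P.hasDeriv_u t ht).fun_mul h1.exp).congr_deriv (by ring)
    · exact hd.differentiableAt.differentiableWithinAt
    · rw [hd.deriv]
      exact mul_nonpos_of_nonpos_of_nonneg (P.v_add_le (le_of_lt ht)) (Real.exp_pos _).le
  have hu0 := P.pos 0 le_rfl
  refine ⟨u 0 ^ 2 * (24 * Real.exp 5), by positivity, fun s hs => ?_⟩
  have h1 : u s * Real.exp (s ^ 2 / 2 + ξ * s) ≤ u 0 := by
    have := hanti self_mem_Ici (mem_Ici.2 hs) hs
    simpa using this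
  have h2 : u s ≤ u 0 * Real.exp (-(s ^ 2 / 2 + ξ * s)) := by
    rw [Real.exp_neg, ← div_eq_mul_inv, le_div_iff₀ (Real.exp_pos _)]
    exact h1
  have h3 : (1 + s) ^ 4 ≤ 24 * Real.exp (1 + s) := by
    have := Real.pow_div_factorial_le_exp (x := 1 + s) (by linarith) 4
    rw [div_le_iff₀ (by positivity)] at this
    norm_num [Nat.factorial] at this
    linarith
  calc (1 + s) ^ 4 * u s ^ 2
      ≤ (24 * Real.exp (1 + s)) * (u 0 * Real.exp (-(s ^ 2 / 2 + ξ * s))) ^ 2 := by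
        have := (P.pos s hs).le
        gcongr
    _ = u 0 ^ 2 * 24 * Real.exp (1 + s + 2 * -(s ^ 2 / 2 + ξ * s)) := by
        rw [Real.exp_add (1 + s), two_mul, Real.exp_add (-(s ^ 2 / 2 + ξ * s))]
        ring
    _ ≤ u 0 ^ 2 * 24 * Real.exp (5 + -s) := by
        refine mul_le_mul_of_nonneg_left (Real.exp_le_exp.2 ?_) (by positivity)
        nlinarith [sq_nonneg (s - 2)]
    _ = _ := by rw [Real.exp_add]; ring

end IsProfile

variable {ξ : ℝ} {u v : ℝ → ℝ}

namespace IsProfile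


theorem hasDerivAt_comp_max (P : IsProfile ξ u v) (s : ℝ) :
    HasDerivAt (fun s => u (max s 0)) (v (max s 0)) s := by
  rcases lt_trichotomy s 0 with h0 | h0 | h0
  · rw [max_eq_right h0.le, P.v_zero]
    refine (hasDerivAt_const s (u 0)).congr_of_eventuallyEq ?_
    filter_upwards [Iio_mem_nhds h0] with t ht
    rw [max_eq_right (le_of_lt ht)]
  · subst h0
    rw [max_self, P.v_zero]
    have h1 : HasDerivWithinAt (fun s => u (max s 0)) 0 (Ici 0) 0 :=
      P.hasDeriv_u_zero.congr (fun t ht => by rw [max_eq_left ht]) (by simp)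
    have h2 : HasDerivWithinAt (fun s => u (max s 0)) 0 (Iic 0) 0 :=
      (hasDerivWithinAt_const 0 (Iic 0) (u 0)).congr (fun t ht => by rw [max_eq_right ht])
        (by simp)
    have := h2.union h1
    rwa [Iic_union_Ici, hasDerivWithinAt_univ] at this
  · rw [max_eq_left h0.le]
    refine (P.hasDeriv_u s h0).congr_of_eventuallyEq ?_
    filter_upwards [Ioi_mem_nhds h0] with t ht
    rw [max_eq_left (le_of_lt ht)]

end IsProfile

theorem normalCoord_nonneg {h : ℝ} (hh : 0 < h) {r : ℝ} (hr : r ∈ Icc (0 : ℝ) 1) :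
    0 ≤ normalCoord h r := by
  have : r ^ 2 ≤ 1 := pow_le_one₀ hr.1 hr.2
  exact div_nonneg (by linarith) (by positivity)

theorem normalCoord_pos {h : ℝ} (hh : 0 < h) {r : ℝ} (hr : r ∈ Ioo (0 : ℝ) 1) :
    0 < normalCoord h r := by
  have : r ^ 2 < 1 := pow_lt_one₀ hr.1.le hr.2 two_ne_zero
  exact div_pos (by linarith) (by positivity)

theorem continuous_normalCoord (h : ℝ) : Continuous (normalCoord h) := by
  unfold normalCoord
  fun_prop

theorem cutoff_eq_zero {h s : ℝ} (hs : 1 ≤ 4 * h * s) : cutoff h s = 0 := by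
  have : 1 - 16 * h ^ 2 * s ^ 2 ≤ 0 := by nlinarith
  rw [cutoff, max_eq_left this]
  norm_num

theorem continuous_cutoff (h : ℝ) : Continuous (cutoff h) := by
  unfold cutoff
  fun_prop

theorem continuous_cutoffDeriv (h : ℝ) : Continuous (cutoffDeriv h) := by
  unfold cutoffDeriv
  fun_prop

namespace IsProfile

set_option maxHeartbeats 1000000 in
theorem trial_energy_le (P : IsProfile ξ u v) : ∃ K' : ℝ, 0 < K' ∧ ∀ h δ, 0 < h → h ≤ 1 →
    0 ≤ δ → δ ≤ h → ∀ Φ : ℝ → ℝ, IntegrableOn Φ (Icc 0 1) → (∀ r ∈ Ioo (0 : ℝ) 1, Φ r =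
      r * (r / h) ^ 2 * (v (max (normalCoord h r) 0) * cutoff h (normalCoord h r)
        + u (max (normalCoord h r) 0) * cutoffDeriv h (normalCoord h r)) ^ 2
      + (normalCoord h r + ξ + δ) ^ 2 / (h ^ 2 * r) *
          (u (max (normalCoord h r) 0) * cutoff h (normalCoord h r)) ^ 2
      - (ξ ^ 2 - u 0 ^ 2 / 3 * h) / h ^ 2 *
          (r * (u (max (normalCoord h r) 0) * cutoff h (normalCoord h r)) ^ 2)) →
    ∫ r in (0 : ℝ)..1, Φ r ≤ K' * h := by
  obtain ⟨ρ, ρ₁, S, hvρ⟩ := P.exists_slope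
  obtain ⟨K₁, hK₁, hb₁⟩ := S.bound₁
  obtain ⟨K, hK, hdec⟩ := P.exists_decay
  have hξ := P.neg
  have hξ1 := P.neg_one_lt
  obtain ⟨K', hK'⟩ : ∃ K', K' = (5000 + 128 * K₁) * K := ⟨_, rfl⟩
  have hK'0 : 0 < K' := by rw [hK']; positivity
  refine ⟨K', hK'0, fun h δ hh hh1 hδ hδh Φ hΦ hΦe => ?_⟩
  obtain ⟨c, hc⟩ : ∃ c, c = u 0 ^ 2 / 3 := ⟨_, rfl⟩
  rw [← hc] at S hΦe
  have hσ0 := fun r hr => normalCoord_nonneg hh (r := r) hr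
  have hσpos := fun r hr => normalCoord_pos hh (r := r) hr
  have dσ : ∀ r, HasDerivAt (normalCoord h) (-(r / h)) r := hasDerivAt_normalCoord hh.ne'
  have cσ := continuous_normalCoord h
  have hσ1 : normalCoord h 1 = 0 := by simp [normalCoord]
  have hσz : 4 * h * normalCoord h 0 = 2 := by simp only [normalCoord]; field_simp; norm_num
  have hpr : ∀ r : ℝ, 1 - 2 * h * normalCoord h r = r ^ 2 := fun r => by
    simp only [normalCoord]; field_simp; ring
  have hχz := fun s hs => cutoff_eq_zero (h := h) (s := s) hs
  have cχ := continuous_cutoff h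
  generalize normalCoord h = σ at *
  obtain ⟨w, hw⟩ : ∃ w : ℝ → ℝ, w = fun s => ρ s + h * ρ₁ s
      - δ * (ρ s ^ 2 - (s + ξ) ^ 2 + ξ ^ 2) := ⟨_, rfl⟩
  obtain ⟨W, hW⟩ : ∃ W : ℝ → ℝ, W = fun s => cutoff h s ^ 2 * (u s ^ 2 * w s) := ⟨_, rfl⟩
  have cW : ContinuousOn W (Ici 0) := by
    have := S.cont
    have := S.cont₁
    have := P.cont_u
    have := cχ.continuousOn (s := Ici 0)
    simp only [hW, hw]
    fun_prop
  have dW : ∀ s, 0 < s → HasDerivAt W (u s ^ 2 * (2 * cutoff h s * cutoffDeriv h s * w s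
      + cutoff h s ^ 2 * (ρ s ^ 2 + (s + ξ) ^ 2 - ξ ^ 2 + h * c
        + 2 * h * s * ((s + ξ) ^ 2 - ρ s ^ 2) + 2 * δ * (s + ξ)))) s := by
    intro s hs
    have d1 := ((hasDerivAt_id s).add_const ξ).fun_pow 2
    have d2 := (S.hasDeriv s hs).fun_pow 2
    have d3 := ((S.hasDeriv s hs).fun_add ((S.hasDeriv₁ s hs).const_mul h)).fun_sub
      (((d2.fun_sub d1).add_const (ξ ^ 2)).const_mul δ)
    have d4 := ((P.hasDeriv_u s hs).fun_pow 2).fun_mul d3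
    rw [hW, hw]
    refine (((hasDerivAt_cutoff h s).fun_pow 2).fun_mul d4).congr_deriv ?_
    rw [hvρ s hs.le]
    simp only [id]
    push_cast
    ring
  have hmain := intervalIntegral.integral_le_sub_of_hasDeriv_right_of_le zero_le_one
    (g := fun r => (1 / h) * (-W (σ r) + K' * h ^ 2 * Real.exp (-σ r)))
    (g' := fun r => (1 / h) * (r / h) * (u (σ r) ^ 2 * (2 * cutoff h (σ r) * cutoffDeriv h (σ r)
      * w (σ r) + cutoff h (σ r) ^ 2 * (ρ (σ r) ^ 2 + (σ r + ξ) ^ 2 - ξ ^ 2 + h * c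
        + 2 * h * σ r * ((σ r + ξ) ^ 2 - ρ (σ r) ^ 2) + 2 * δ * (σ r + ξ)))
        + K' * h ^ 2 * Real.exp (-σ r)))
    (φ := Φ) ?_ ?_ hΦ ?_
  · refine hmain.trans ?_
    have w0 : W (σ 1) = 0 := by
      simp [hW, hw, hσ1, S.zero, S.zero₁]
    have w1 : W (σ 0) = 0 := by
      simp [hW, hχz (σ 0) (by linarith)]
    simp only [w0, w1]
    simp only [hσ1]
    have : 0 ≤ 1 / h * (K' * h ^ 2 * Real.exp (-σ 0)) := by positivity
    have e : 1 / h * (-0 + K' * h ^ 2 * Real.exp (-0)) = K' * h := by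
      rw [neg_zero, Real.exp_zero]; field_simp; ring
    rw [e]
    linarith
  · have h1 : ContinuousOn (fun r => W (σ r)) (Icc 0 1) :=
      cW.comp cσ.continuousOn fun r hr => hσ0 r hr
    have h2 : Continuous fun r => K' * h ^ 2 * Real.exp (-σ r) := by fun_prop
    exact continuousOn_const.mul (h1.neg.add h2.continuousOn)
  · intro r hr
    have e1 := (dW (σ r) (hσpos r hr)).comp r (dσ r)
    have e2 := (dσ r).fun_neg.exp
    exact ((e1.fun_neg.fun_add (e2.const_mul (K' * h ^ 2))).const_mul (1 / h)).congr_deriv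
      (by ring) |>.hasDerivWithinAt
  · intro r hr
    have hs := hσpos r hr
    have hρb := S.abs_le hs.le
    have hxb : |σ r + ξ| ≤ 1 + σ r := by
      rw [_root_.abs_le]
      constructor <;> linarith
    have hts : max 0 (1 - 16 * h ^ 2 * σ r ^ 2) = 0 ∨ 4 * h * σ r < 1 := by
      rcases lt_or_ge (4 * h * σ r) 1 with h1 | h1
      · exact Or.inr h1
      · exact Or.inl (max_eq_left (by nlinarith))
    have hpt := trial_pointwise (c := c) (T := ξ ^ 2) hh hh1 hs.le hρb (hb₁ _ hs.le) hxb hδ hδh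
      (sq_nonneg _) (by nlinarith) (le_max_left 0 (1 - 16 * h ^ 2 * σ r ^ 2))
      (max_le zero_le_one (by nlinarith [mul_nonneg (sq_nonneg h) (sq_nonneg (σ r))])) hts
    rw [hΦe r hr, max_eq_left hs.le, hvρ _ hs.le]
    have hd := hdec (σ r) hs.le
    have hpt2 := mul_le_mul_of_nonneg_left hpt (sq_nonneg (u (σ r)))
    have hd2 : u (σ r) ^ 2 * ((5000 + 128 * K₁) * h ^ 2 * (1 + σ r) ^ 4)
        ≤ K' * h ^ 2 * Real.exp (-σ r) := by
      calc _ = (5000 + 128 * K₁) * h ^ 2 * ((1 + σ r) ^ 4 * u (σ r) ^ 2) := by ring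
        _ ≤ (5000 + 128 * K₁) * h ^ 2 * (K * Real.exp (-σ r)) := by gcongr
        _ = _ := by rw [hK']; ring
    have hfin := mul_le_mul_of_nonneg_left (hpt2.trans hd2)
      (by have := hr.1; positivity : 0 ≤ (1 / h) * (r / h))
    rw [hpr] at hfin
    have hr0 := hr.1.ne'
    rw [← sub_nonneg] at hfin ⊢
    refine hfin.trans (le_of_eq ?_)
    simp only [hw, cutoff, cutoffDeriv]
    generalize max 0 (1 - 16 * h ^ 2 * σ r ^ 2) = t
    field_simp
    ring
set_option maxHeartbeats 1000000 in
theorem trial_mass_ge (P : IsProfile ξ u v) : ∃ h₀ : ℝ, 0 < h₀ ∧ ∀ h, 0 < h → h ≤ h₀ → h ≤ 1 →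
    h / 2 ≤ ∫ r in (0 : ℝ)..1,
      r * (u (max (normalCoord h r) 0) * cutoff h (normalCoord h r)) ^ 2 := by
  obtain ⟨K, hK, hdec⟩ := P.exists_decay
  obtain ⟨m, hm0, hmc, hmd, hml, hm1, hmn⟩ := P.exists_mass
  obtain ⟨s₀, hs₀⟩ := (hml.eventually (lt_mem_nhds (by norm_num : (3 / 4 : ℝ) < 1))).exists_forall_of_atTop
  refine ⟨min (1 / (2 * (|s₀| + 1))) (1 / (256 * K + 1)), by positivity, fun h hh hle hh1 => ?_⟩
  have hh2 : h ≤ 1 / (2 * (|s₀| + 1)) := hle.trans (min_le_left _ _)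
  have hh3 : h ≤ 1 / (256 * K + 1) := hle.trans (min_le_right _ _)
  have cu : Continuous fun s => u (max s 0) :=
    continuous_iff_continuousAt.2 fun s => (P.hasDerivAt_comp_max s).continuousAt
  have hσ0 := fun r hr => normalCoord_nonneg hh (r := r) hr
  have hσpos := fun r hr => normalCoord_pos hh (r := r) hr
  have dσ : ∀ r, HasDerivAt (normalCoord h) (-(r / h)) r := hasDerivAt_normalCoord hh.ne'
  have cσ := continuous_normalCoord h
  have hσ1 : normalCoord h 1 = 0 := by simp [normalCoord]
  have hσz : normalCoord h 0 = 1 / (2 * h) := by simp [normalCoord]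
  have cχ := continuous_cutoff h
  generalize normalCoord h = σ at *
  have hmain := intervalIntegral.sub_le_integral_of_hasDeriv_right_of_le zero_le_one
    (g := fun r => -(h * m (σ r)) - 64 * h ^ 3 * K * Real.exp (-σ r))
    (g' := fun r => r * u (σ r) ^ 2 - 64 * h ^ 2 * r * (K * Real.exp (-σ r)))
    (φ := fun r => r * (u (max (σ r) 0) * cutoff h (σ r)) ^ 2) ?_ ?_ ?_ ?_
  · refine le_trans ?_ hmain
    have h1 : s₀ ≤ σ 0 := by
      have : (|s₀| + 1) * (2 * h) ≤ 1 := by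
        rw [le_div_iff₀ (by positivity)] at hh2
        linarith
      rw [hσz, le_div_iff₀ (by positivity)]
      have := le_abs_self s₀
      nlinarith
    have h2 := hs₀ _ h1
    have h3 : 256 * (h * K) ≤ 1 := by
      rw [le_div_iff₀ (by positivity)] at hh3
      linarith
    have h4 : 64 * h ^ 3 * K ≤ h / 4 := by
      have : h ^ 2 * (256 * (h * K)) ≤ h * 1 * 1 := by
        gcongr
        nlinarith
      linarith
    have h5 : 0 ≤ 64 * h ^ 3 * K * Real.exp (-σ 0) := by positivity
    rw [hσ1, hm0, neg_zero, Real.exp_zero]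
    nlinarith
  · fun_prop
  · intro r hr
    have e1 := (hmd (σ r) (hσpos r hr)).comp r (dσ r)
    have e2 := (dσ r).fun_neg.exp
    refine ((e1.const_mul h).fun_neg.fun_sub (e2.const_mul (64 * h ^ 3 * K))).congr_deriv ?_
      |>.hasDerivWithinAt
    field_simp
  · exact Continuous.integrableOn_Icc
      (continuous_id.mul (((cu.comp cσ).mul (cχ.comp cσ)).pow 2))
  · intro r hr
    have hs := hσpos r hr
    rw [max_eq_left hs.le]
    have hd := hdec (σ r) hs.le
    have hy : 0 ≤ h ^ 2 * σ r ^ 2 := by positivity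
    have hcut : 1 - 64 * (h ^ 2 * σ r ^ 2) ≤ cutoff h (σ r) ^ 2 := by
      unfold cutoff
      rcases le_total (1 - 16 * h ^ 2 * σ r ^ 2) 0 with h1 | h1
      · rw [max_eq_left h1]
        nlinarith
      · rw [max_eq_right h1]
        have : 1 + (2 : ℕ) * -(16 * h ^ 2 * σ r ^ 2) ≤ (1 + -(16 * h ^ 2 * σ r ^ 2)) ^ 2 :=
          one_add_mul_le_pow (by linarith) 2
        push_cast at this
        have h2 := sq_nonneg (2 * (16 * h ^ 2 * σ r ^ 2) - 1)
        nlinarith [sq_nonneg (16 * h ^ 2 * σ r ^ 2), mul_nonneg h1 h1]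
    have h1 : σ r ^ 2 * u (σ r) ^ 2 ≤ K * Real.exp (-σ r) := by
      refine le_trans ?_ hd
      have : σ r ^ 2 ≤ (1 + σ r) ^ 4 := by nlinarith [sq_nonneg (σ r), pow_pos hs 3]
      gcongr
    have h2 : u (σ r) ^ 2 * (1 - 64 * (h ^ 2 * σ r ^ 2)) ≤ u (σ r) ^ 2 * cutoff h (σ r) ^ 2 := by
      gcongr
    have h3 : u (σ r) ^ 2 - 64 * h ^ 2 * (K * Real.exp (-σ r))
        ≤ u (σ r) ^ 2 * cutoff h (σ r) ^ 2 := by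
      have : h ^ 2 * (σ r ^ 2 * u (σ r) ^ 2) ≤ h ^ 2 * (K * Real.exp (-σ r)) := by gcongr
      linarith
    have h4 := mul_le_mul_of_nonneg_left h3 hr.1.le
    linarith

theorem exists_trial_radial (P : IsProfile ξ u v) :
    ∃ K h₀ : ℝ, 0 < K ∧ 0 < h₀ ∧ ∀ h δ, 0 < h → h ≤ h₀ → 0 ≤ δ → δ ≤ h → ∃ g g' : ℝ → ℝ,
      Continuous g' ∧ (∀ s, HasDerivAt g (g' s) s) ∧ (∀ s, 1 ≤ 4 * h * s → g s = 0) ∧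
      (∀ Φ : ℝ → ℝ, IntegrableOn Φ (Icc 0 1) → (∀ r ∈ Ioo (0 : ℝ) 1, Φ r = r * (r / h) ^ 2 *
          g' (normalCoord h r) ^ 2 + (normalCoord h r + ξ + δ) ^ 2 / (h ^ 2 * r) *
          g (normalCoord h r) ^ 2 - (ξ ^ 2 - u 0 ^ 2 / 3 * h) / h ^ 2 * (r * g (normalCoord h r) ^ 2))
        → ∫ r in (0 : ℝ)..1, Φ r ≤ K * h) ∧
      h / 2 ≤ ∫ r in (0 : ℝ)..1, r * g (normalCoord h r) ^ 2 := by
  obtain ⟨K, hK, hE⟩ := P.trial_energy_le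
  obtain ⟨h₀, hh₀, hM⟩ := P.trial_mass_ge
  refine ⟨K, min h₀ 1, hK, by positivity, fun h δ hh hle hδ hδh => ?_⟩
  have hh1 : h ≤ 1 := hle.trans (min_le_right _ _)
  have cu : Continuous fun s => u (max s 0) :=
    continuous_iff_continuousAt.2 fun s => (P.hasDerivAt_comp_max s).continuousAt
  have cv : Continuous fun s => v (max s 0) :=
    P.cont_v.comp_continuous (by fun_prop) (fun s => mem_Ici.2 (le_max_right _ _))
  exact ⟨fun s => u (max s 0) * cutoff h s,
    fun s => v (max s 0) * cutoff h s + u (max s 0) * cutoffDeriv h s,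
    (cv.mul (continuous_cutoff h)).add (cu.mul (continuous_cutoffDeriv h)),
    fun s => (P.hasDerivAt_comp_max s).fun_mul (hasDerivAt_cutoff h s),
    fun s hs => by simp [cutoff_eq_zero hs], hE h δ hh hh1 hδ hδh,
    hM h hh (hle.trans (min_le_left _ _)) hh1⟩

end IsProfile

theorem esq_polarMap (r θ : ℝ) : esq (polarMap r θ) = r ^ 2 := by
  simp only [esq, polarMap]
  linear_combination r ^ 2 * Real.sin_sq_add_cos_sq θ

theorem exists_angular_lift {h : ℝ} (hh : 0 < h) (m : ℕ) {g g' : ℝ → ℝ} (hc : Continuous g')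
    (hg : ∀ s, HasDerivAt g (g' s) s) (hz : ∀ s, 1 ≤ 4 * h * s → g s = 0) :
    ∃ w : Plane → ℂ, ContDiff ℝ 1 w ∧ ∀ r, 0 < r → ∀ θ : ℝ, w (polarMap r θ)
      = Complex.exp (((m * θ : ℝ) : ℂ) * Complex.I) * (g (normalCoord h r) : ℝ) := by
  have hg1 : ContDiff ℝ 1 g := by
    rw [contDiff_one_iff_deriv]
    refine ⟨fun s => (hg s).differentiableAt, ?_⟩
    rwa [funext fun s => (hg s).deriv]
  have hesq : ContDiff ℝ 1 esq := by
    unfold esq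
    fun_prop
  refine ⟨fun x => (((x.1 : ℂ) + x.2 * Complex.I) * (((√(esq x))⁻¹ : ℝ) : ℂ)) ^ m
    * ((g ((1 - esq x) / (2 * h)) : ℝ) : ℂ), ?_, ?_⟩
  · rw [contDiff_iff_contDiffAt]
    intro x
    rcases lt_or_ge (esq x) (1 / 2) with hx | hx
    · refine (contDiffAt_const (c := (0 : ℂ))).congr_of_eventuallyEq ?_
      filter_upwards [(isOpen_lt hesq.continuous continuous_const).mem_nhds hx] with y hy
      have hy : esq y < 1 / 2 := hy
      rw [hz, Complex.ofReal_zero, mul_zero]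
      rw [mul_div_assoc', le_div_iff₀ (by positivity)]
      nlinarith
    · have hx0 : esq x ≠ 0 := by linarith
      have h1 : ContDiffAt ℝ 1 (fun x : Plane => (√(esq x))⁻¹) x :=
        (hesq.contDiffAt.sqrt hx0).inv (by positivity)
      have h2 : ContDiffAt ℝ 1 (fun x : Plane => g ((1 - esq x) / (2 * h))) x :=
        (hg1.comp ((contDiff_const.sub hesq).div_const _)).contDiffAt
      have h3 : ContDiff ℝ 1 (fun x : ℝ => (x : ℂ)) := Complex.ofRealCLM.contDiff
      have h4 : ContDiff ℝ 1 (fun x : Plane => (x.1 : ℂ) + x.2 * Complex.I) :=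
        (h3.comp contDiff_fst).add ((h3.comp contDiff_snd).mul contDiff_const)
      exact ((h4.contDiffAt.mul (h3.contDiffAt.comp x h1)).pow m).mul (h3.contDiffAt.comp x h2)
  · intro r hr θ
    simp only [esq_polarMap]
    rw [Real.sqrt_sq hr.le]
    have hr' : (r : ℂ) ≠ 0 := by exact_mod_cast hr.ne'
    congr 1
    have : ((((polarMap r θ).1 : ℝ) : ℂ) + ((polarMap r θ).2 : ℝ) * Complex.I) * ((r⁻¹ : ℝ) : ℂ)
        = Complex.exp (θ * Complex.I) := by
      simp only [polarMap]
      rw [Complex.exp_mul_I]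
      push_cast
      field_simp
    rw [this, ← Complex.exp_nat_mul]
    congr 1
    push_cast
    ring

theorem magSq_angular {h B r θ : ℝ} (hh : h ≠ 0) (hr : 0 < r) {m : ℕ} {g g' : ℝ → ℝ}
    (hg : ∀ s, HasDerivAt g (g' s) s) {w : Plane → ℂ} (hw : ContDiff ℝ 1 w)
    (he : ∀ r, 0 < r → ∀ θ : ℝ, w (polarMap r θ)
      = Complex.exp (((m * θ : ℝ) : ℂ) * Complex.I) * (g (normalCoord h r) : ℝ)) :
    magSq B F0 w (polarMap r θ) = (r / h) ^ 2 * g' (normalCoord h r) ^ 2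
      + (m / r - B * r / 2) ^ 2 * g (normalCoord h r) ^ 2 := by
  have hd := (hw.differentiable one_ne_zero (polarMap r θ)).hasFDerivAt
  have hr' : (r : ℂ) ≠ 0 := by exact_mod_cast hr.ne'
  have p1 : HasDerivAt (fun r => polarMap r θ) (Real.cos θ, Real.sin θ) r := by
    have h1 := ((hasDerivAt_id r).mul_const (Real.cos θ)).prodMk
      ((hasDerivAt_id r).mul_const (Real.sin θ))
    simpa [polarMap] using h1
  have p2 : HasDerivAt (fun θ => polarMap r θ) (r • (-Real.sin θ, Real.cos θ)) θ := by
    have h1 := ((Real.hasDerivAt_cos θ).const_mul r).prodMk ((Real.hasDerivAt_sin θ).const_mul r)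
    simpa [polarMap] using h1
  have a1 : HasDerivAt (fun r => w (polarMap r θ))
      (fderiv ℝ w (polarMap r θ) (Real.cos θ, Real.sin θ)) r := hd.comp_hasDerivAt r p1
  have a2 : HasDerivAt (fun θ => w (polarMap r θ))
      (fderiv ℝ w (polarMap r θ) (r • (-Real.sin θ, Real.cos θ))) θ := hd.comp_hasDerivAt θ p2
  have b1 : HasDerivAt (fun r => w (polarMap r θ))
      (Complex.exp (((m * θ : ℝ) : ℂ) * Complex.I) * ((g' (normalCoord h r) * -(r / h) : ℝ) : ℂ)) r := by
    refine ((((hg _).comp r (hasDerivAt_normalCoord hh r)).ofReal_comp).const_mul _).congr_of_eventuallyEq ?_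
    filter_upwards [Ioi_mem_nhds hr] with t ht
    exact he t ht θ
  have b2 : HasDerivAt (fun θ => w (polarMap r θ))
      (Complex.exp (((m * θ : ℝ) : ℂ) * Complex.I) * (m * Complex.I) * (g (normalCoord h r) : ℝ)) θ := by
    simp only [he r hr]
    have : HasDerivAt (fun θ : ℝ => ((m * θ : ℝ) : ℂ) * Complex.I) (m * Complex.I) θ := by
      have := (((hasDerivAt_id θ).const_mul (m : ℝ)).ofReal_comp).mul_const Complex.I
      simpa using this
    exact this.cexp.mul_const _
  have e1 := a1.unique b1
  have e2 := a2.unique b2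
  rw [map_smul, Complex.real_smul] at e2
  rw [magSq_polar, e1]
  have hn : ‖Complex.exp (((m * θ : ℝ) : ℂ) * Complex.I)‖ = 1 := Complex.norm_exp_ofReal_mul_I _
  have e3 : (-Complex.I) * fderiv ℝ w (polarMap r θ) (-Real.sin θ, Real.cos θ)
      - ((B * r / 2 : ℝ) : ℂ) * w (polarMap r θ)
      = Complex.exp (((m * θ : ℝ) : ℂ) * Complex.I)
        * (((m / r - B * r / 2) * g (normalCoord h r) : ℝ) : ℂ) := by
    rw [he r hr]
    refine mul_left_cancel₀ hr' ?_
    rw [mul_sub, mul_left_comm, e2]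
    push_cast
    field_simp
    linear_combination (-(2 * (m : ℂ) * (g (normalCoord h r) : ℂ))) * Complex.I_sq
  rw [e3, norm_mul, norm_mul, hn, Complex.norm_real, Complex.norm_real, one_mul, one_mul,
    Real.norm_eq_abs, Real.norm_eq_abs, sq_abs, sq_abs]
  ring

theorem continuous_magSq_F0 {B : ℝ} {u : Plane → ℂ} (hu : ContDiff ℝ 1 u) :
    Continuous fun x => magSq B F0 u x := by
  have := hu.continuous
  have := hu.continuous_fderiv one_ne_zero
  unfold magSq F0
  fun_prop

theorem IsProfile.exists_trial {ξ : ℝ} {u v : ℝ → ℝ} (P : IsProfile ξ u v) :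
    ∃ C q₀ : ℝ, 0 < C ∧ 0 < q₀ ∧ ∀ q, q₀ ≤ q → ∃ w : Plane → ℂ, ContDiff ℝ 1 w ∧
      0 < (∫ x in unitDisc, ‖w x‖ ^ 2) ∧ ∫ x in unitDisc, magSq (q ^ 2) F0 w x
        ≤ (ξ ^ 2 * q ^ 2 - u 0 ^ 2 / 3 * q + C) * ∫ x in unitDisc, ‖w x‖ ^ 2 := by
  obtain ⟨K, h₀, hK, hh₀, H⟩ := P.exists_trial_radial
  refine ⟨2 * K, max 2 (1 / h₀), by positivity, by positivity, fun q hq => ?_⟩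
  have hq2 : 2 ≤ q := (le_max_left _ _).trans hq
  have hq0 : 0 < q := by linarith
  have hξ1 := P.neg_one_lt
  obtain ⟨h, hh⟩ : ∃ h, h = 1 / q := ⟨_, rfl⟩
  have hhp : 0 < h := by rw [hh]; positivity
  have hhq : h * q = 1 := by rw [hh]; field_simp
  have hle : h ≤ h₀ := by
    have := (le_max_right _ _).trans hq
    rw [div_le_iff₀ hh₀] at this
    rw [hh, div_le_iff₀ hq0]
    linarith
  obtain ⟨m, hm⟩ : ∃ m : ℕ, m = ⌈q ^ 2 / 2 + ξ * q⌉₊ := ⟨_, rfl⟩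
  have hm1 : q ^ 2 / 2 + ξ * q ≤ m := by rw [hm]; exact Nat.le_ceil _
  have hm2 : (m : ℝ) < q ^ 2 / 2 + ξ * q + 1 := by
    rw [hm]
    exact Nat.ceil_lt_add_one (by nlinarith)
  obtain ⟨δ, hδ⟩ : ∃ δ, δ = h * (m - q ^ 2 / 2 - ξ * q) := ⟨_, rfl⟩
  have hδ0 : 0 ≤ δ := by rw [hδ]; exact mul_nonneg hhp.le (by linarith)
  have hδ1 : δ ≤ h := by rw [hδ]; nlinarith
  obtain ⟨g, g', cg', dg, zg, hE, hM⟩ := H h δ hhp hle hδ0 hδ1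
  obtain ⟨w, hw, hwe⟩ := exists_angular_lift hhp m cg' dg zg
  have hpi := Real.pi_pos
  have cg : Continuous g := continuous_iff_continuousAt.2 fun s => (dg s).continuousAt
  have hn : ∀ r, 0 < r → ∀ θ, ‖w (polarMap r θ)‖ ^ 2 = g (normalCoord h r) ^ 2 := by
    intro r hr θ
    rw [hwe r hr, norm_mul, Complex.norm_exp_ofReal_mul_I, one_mul, Complex.norm_real,
      Real.norm_eq_abs, sq_abs]
  have cw := hw.continuous
  have cm := continuous_magSq_F0 (B := q ^ 2) hw
  have hmass : ∫ x in unitDisc, ‖w x‖ ^ 2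
      = 2 * Real.pi * ∫ r in (0 : ℝ)..1, r * g (normalCoord h r) ^ 2 := by
    rw [setIntegral_unitDisc_polar (f := fun x => ‖w x‖ ^ 2) (by fun_prop),
      ← intervalIntegral.integral_const_mul]
    refine intervalIntegral.integral_congr fun r hr => ?_
    rw [uIcc_of_le zero_le_one] at hr
    rcases hr.1.eq_or_lt with h0 | h0
    · simp [← h0]
    · simp only [hn r h0, intervalIntegral.integral_const, smul_eq_mul]
      ring
  have hpos : 0 < ∫ x in unitDisc, ‖w x‖ ^ 2 := by
    rw [hmass]
    have : 0 < ∫ r in (0 : ℝ)..1, r * g (normalCoord h r) ^ 2 := lt_of_lt_of_le (by positivity) hM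
    positivity
  refine ⟨w, hw, hpos, ?_⟩
  obtain ⟨f, hf⟩ : ∃ f : Plane → ℝ, f = fun x => magSq (q ^ 2) F0 w x
      - (ξ ^ 2 - u 0 ^ 2 / 3 * h) / h ^ 2 * ‖w x‖ ^ 2 := ⟨_, rfl⟩
  have cf : Continuous f := by rw [hf]; fun_prop
  have cfp : Continuous fun r => ∫ θ in (-Real.pi)..Real.pi, f (polarMap r θ) :=
    intervalIntegral.continuous_parametric_intervalIntegral_of_continuous'
      (f := fun r θ => f (polarMap r θ)) (by exact cf.comp continuous_polarMap) _ _
  have h1 := hE (fun r => (2 * Real.pi)⁻¹ * (r * ∫ θ in (-Real.pi)..Real.pi, f (polarMap r θ)))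
    (Continuous.integrableOn_Icc (by fun_prop)) (by
      intro r hr
      have hr0 := hr.1
      have e : ∀ θ, f (polarMap r θ) = (r / h) ^ 2 * g' (normalCoord h r) ^ 2
          + (m / r - q ^ 2 * r / 2) ^ 2 * g (normalCoord h r) ^ 2
          - (ξ ^ 2 - u 0 ^ 2 / 3 * h) / h ^ 2 * g (normalCoord h r) ^ 2 := by
        intro θ
        rw [hf]
        simp only
        rw [magSq_angular hhp.ne' hr0 dg hw hwe, hn r hr0]
      have e2 : (m / r - q ^ 2 * r / 2) ^ 2 = (normalCoord h r + ξ + δ) ^ 2 / (h ^ 2 * r ^ 2) := by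
        have : m / r - q ^ 2 * r / 2 = (normalCoord h r + ξ + δ) / (h * r) := by
          rw [hδ, normalCoord, hh]
          field_simp
          ring
        rw [this, div_pow, mul_pow]
      simp only [e, e2, intervalIntegral.integral_const, smul_eq_mul]
      field_simp
      ring)
  rw [intervalIntegral.integral_const_mul, ← setIntegral_unitDisc_polar cf, hf] at h1
  have hbd : unitDisc ⊆ Icc (-1 : ℝ) 1 ×ˢ Icc (-1 : ℝ) 1 := by
    intro x hx
    have hx : x.1 ^ 2 + x.2 ^ 2 < 1 := hx
    refine ⟨⟨?_, ?_⟩, ?_, ?_⟩ <;> nlinarith [sq_nonneg x.1, sq_nonneg x.2]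
  have hint : ∀ {F : Plane → ℝ}, Continuous F → IntegrableOn F unitDisc := fun {F} hF =>
    (hF.continuousOn.integrableOn_compact (isCompact_Icc.prod isCompact_Icc)).mono_set hbd
  rw [integral_sub (hint cm) (hint (by fun_prop)), integral_const_mul] at h1
  have h2 : (∫ x in unitDisc, magSq (q ^ 2) F0 w x)
      - (ξ ^ 2 - u 0 ^ 2 / 3 * h) / h ^ 2 * ∫ x in unitDisc, ‖w x‖ ^ 2
      ≤ 2 * Real.pi * (K * h) := by
    rwa [inv_mul_le_iff₀ (by positivity)] at h1
  have h3 : 2 * Real.pi * (K * h) ≤ 2 * K * ∫ x in unitDisc, ‖w x‖ ^ 2 := by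
    rw [hmass]
    have := mul_le_mul_of_nonneg_left hM (by positivity : 0 ≤ 4 * Real.pi * K)
    linarith
  have h4 : (ξ ^ 2 - u 0 ^ 2 / 3 * h) / h ^ 2 = ξ ^ 2 * q ^ 2 - u 0 ^ 2 / 3 * q := by
    rw [hh]
    field_simp
  rw [h4] at h2
  linarith

theorem isOpen_unitDisc : IsOpen unitDisc := isOpen_lt (by fun_prop) (by fun_prop)

theorem unitDisc_subset : unitDisc ⊆ Icc (-1 : ℝ) 1 ×ˢ Icc (-1 : ℝ) 1 := by
  intro x hx
  have hx : x.1 ^ 2 + x.2 ^ 2 < 1 := hx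
  refine ⟨⟨?_, ?_⟩, ?_, ?_⟩ <;> nlinarith [sq_nonneg x.1, sq_nonneg x.2]

theorem integrableOn_unitDisc {F : Plane → ℝ} (hF : Continuous F) : IntegrableOn F unitDisc :=
  (hF.continuousOn.integrableOn_compact (isCompact_Icc.prod isCompact_Icc)).mono_set unitDisc_subset

/-- Replacing a map by a globally defined one with the same values on the domain. -/
theorem CNearCl.exists_contDiff {E : Type*} [NormedAddCommGroup E] [NormedSpace ℝ E] {n : ℕ}
    {Ω : Set Plane} {u : Plane → E} (hu : CNearCl n Ω u) :
    ∃ u' : Plane → E, ContDiff ℝ n u' ∧ EqOn u u' Ω := by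
  obtain ⟨U, hU, hcl, hd⟩ := hu
  obtain ⟨f, hf0, hf1, -⟩ := exists_contMDiffMap_zero_one_nhds_of_isClosed (n := (n : ℕ∞))
    (modelWithCornersSelf ℝ Plane) hU.isClosed_compl (isClosed_closure (s := Ω))
    (disjoint_compl_left_iff_subset.2 hcl)
  have hfd : ContDiff ℝ n f := f.contMDiff.contDiff
  refine ⟨fun x => f x • u x, ?_, fun x hx => ?_⟩
  · rw [contDiff_iff_contDiffAt]
    intro x
    by_cases hx : x ∈ U
    · exact hfd.contDiffAt.smul (hd.contDiffAt (hU.mem_nhds hx))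
    · refine (contDiffAt_const (c := (0 : E))).congr_of_eventuallyEq ?_
      filter_upwards [eventually_nhdsSet_iff_forall.1 hf0 x hx] with y hy
      rw [hy, zero_smul]
  · show u x = f x • u x
    rw [(eventually_nhdsSet_iff_forall.1 hf1 x (subset_closure hx)).self_of_nhds, one_smul]

theorem sq_integral_mul_le {a b : ℝ} (hab : a ≤ b) {w f : ℝ → ℝ} (hw : Continuous w)
    (hf : Continuous f) (hn : ∀ x ∈ Icc a b, 0 ≤ w x) :
    (∫ x in a..b, w x * f x) ^ 2 ≤ (∫ x in a..b, w x) * ∫ x in a..b, w x * f x ^ 2 := by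
  have key : ∀ c : ℝ, 0 ≤ (∫ x in a..b, w x) * (c * c) + (-2 * ∫ x in a..b, w x * f x) * c
      + ∫ x in a..b, w x * f x ^ 2 := by
    intro c
    have h : 0 ≤ ∫ x in a..b, w x * (f x - c) ^ 2 :=
      intervalIntegral.integral_nonneg hab fun x hx => mul_nonneg (hn x hx) (sq_nonneg _)
    have e : (∫ x in a..b, w x * (f x - c) ^ 2) = (∫ x in a..b, w x) * (c * c)
        + (-2 * ∫ x in a..b, w x * f x) * c + ∫ x in a..b, w x * f x ^ 2 := by
      rw [← intervalIntegral.integral_mul_const, ← intervalIntegral.integral_const_mul,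
        ← intervalIntegral.integral_mul_const, ← intervalIntegral.integral_add
        (Continuous.intervalIntegrable (by fun_prop) _ _)
        (Continuous.intervalIntegrable (by fun_prop) _ _), ← intervalIntegral.integral_add
        (Continuous.intervalIntegrable (by fun_prop) _ _)
        (Continuous.intervalIntegrable (by fun_prop) _ _)]
      refine intervalIntegral.integral_congr fun x _ => ?_
      ring
    rwa [e] at h
  have := discrim_le_zero key
  rw [discrim] at this
  linarith

theorem setIntegral_unitDisc_polar_swap {f : Plane → ℝ} (hf : Continuous f) :
    ∫ x in unitDisc, f x
      = ∫ θ in (-Real.pi)..Real.pi, ∫ r in (0 : ℝ)..1, r * f (polarMap r θ) := by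
  rw [setIntegral_unitDisc_polar hf, ← intervalIntegral_intervalIntegral_swap]
  · refine intervalIntegral.integral_congr fun r _ => ?_
    exact (intervalIntegral.integral_const_mul _ _).symm
  · have hc : Continuous (fun p : ℝ × ℝ => p.1 * f (polarMap p.1 p.2)) :=
      continuous_fst.mul (hf.comp continuous_polarMap)
    exact (hc.continuousOn.integrableOn_compact (isCompact_uIcc.prod isCompact_uIcc)).mono_set
      (prod_mono uIoc_subset_uIcc uIoc_subset_uIcc)

theorem hasFDerivAt_parametric {H E : Type*} [NormedAddCommGroup H] [NormedSpace ℝ H]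
    [ProperSpace H] [NormedAddCommGroup E] [NormedSpace ℝ E] {a b : ℝ}
    {F : H → ℝ → E} {F' : H → ℝ → H →L[ℝ] E} (hF : Continuous (Function.uncurry F))
    (hF' : Continuous (Function.uncurry F')) (h : ∀ x t, HasFDerivAt (fun x => F x t) (F' x t) x)
    (x₀ : H) : HasFDerivAt (fun x => ∫ t in a..b, F x t) (∫ t in a..b, F' x₀ t) x₀ := by
  obtain ⟨M, hM⟩ := ((isCompact_closedBall x₀ 1).prod (isCompact_uIcc (a := a) (b := b))).exists_bound_of_continuousOn hF'.continuousOn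
  have c1 : ∀ x, Continuous (F x) := fun x => hF.comp (Continuous.prodMk_right x)
  have c2 : ∀ x, Continuous (F' x) := fun x => hF'.comp (Continuous.prodMk_right x)
  exact intervalIntegral.hasFDerivAt_integral_of_dominated_of_fderiv_le
    (Metric.closedBall_mem_nhds x₀ one_pos)
    (Eventually.of_forall fun x => (c1 x).aestronglyMeasurable)
    ((c1 x₀).intervalIntegrable _ _) (c2 x₀).aestronglyMeasurable
    (bound := fun _ => M)
    (ae_of_all _ fun t ht x hx => hM (x, t) ⟨hx, uIoc_subset_uIcc ht⟩) (by simp)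
    (ae_of_all _ fun t _ x _ => h x t)

theorem contDiff_parametric {H E : Type*} [NormedAddCommGroup H] [NormedSpace ℝ H]
    [ProperSpace H] [NormedAddCommGroup E] [NormedSpace ℝ E] {a b : ℝ}
    {F : H → ℝ → E} {F' : H → ℝ → H →L[ℝ] E} (hF : Continuous (Function.uncurry F))
    (hF' : Continuous (Function.uncurry F')) (h : ∀ x t, HasFDerivAt (fun x => F x t) (F' x t) x) :
    ContDiff ℝ 1 (fun x => ∫ t in a..b, F x t) := by
  rw [contDiff_one_iff_fderiv]
  have hd := hasFDerivAt_parametric (a := a) (b := b) hF hF' h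
  refine ⟨fun x => (hd x).differentiableAt, ?_⟩
  rw [funext fun x => (hd x).fderiv]
  exact intervalIntegral.continuous_parametric_intervalIntegral_of_continuous' hF' _ _

theorem integral_fderiv_mul_fderiv_comm {f g : Plane → ℂ} (hf : ContDiff ℝ 1 f)
    (hg : ContDiff ℝ 1 g) (hcf : HasCompactSupport f) (hcg : HasCompactSupport g) (v w : Plane) :
    ∫ x, fderiv ℝ f x v * fderiv ℝ g x w = ∫ x, fderiv ℝ f x w * fderiv ℝ g x v := by
  have cf : ∀ v, Continuous fun x => fderiv ℝ f x v := fun v =>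
    (hf.continuous_fderiv one_ne_zero).clm_apply continuous_const
  have cg : ∀ v, Continuous fun x => fderiv ℝ g x v := fun v =>
    (hg.continuous_fderiv one_ne_zero).clm_apply continuous_const
  have kf : ∀ v, HasCompactSupport fun x => fderiv ℝ f x v := fun v => hcf.fderiv_apply ℝ v
  have kg : ∀ v, HasCompactSupport fun x => fderiv ℝ g x v := fun v => hcg.fderiv_apply ℝ v
  have ct : ∀ t : ℝ, Continuous fun x : Plane => x + t • v := fun t => by fun_prop
  have dt : ∀ (h : Plane → ℂ), ContDiff ℝ 1 h → ∀ (x v : Plane) (t : ℝ),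
      HasDerivAt (fun t : ℝ => h (x + t • v)) (fderiv ℝ h (x + t • v) v) t := by
    intro h hh x v t
    have h1 : HasDerivAt (fun t : ℝ => x + t • v) v t := by
      simpa using ((hasDerivAt_id t).smul_const v).const_add x
    exact ((hh.differentiable one_ne_zero _).hasFDerivAt).comp_hasDerivAt t h1
  have dom : ∀ (h k : Plane → ℂ) (v : Plane), ContDiff ℝ 1 h → HasCompactSupport h → Continuous k →
      HasCompactSupport k → HasDerivAt (fun t : ℝ => ∫ x, h (x + t • v) * k x)
        (∫ x, fderiv ℝ h x v * k x) 0 := by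
    intro h k v hh hch hk hck
    have ch : Continuous fun x => fderiv ℝ h x v :=
      (hh.continuous_fderiv one_ne_zero).clm_apply continuous_const
    obtain ⟨M, hM⟩ := (hch.fderiv_apply ℝ v).exists_bound_of_continuous ch
    have := (hasDerivAt_integral_of_dominated_loc_of_deriv_le (μ := volume)
      (F := fun (t : ℝ) (x : Plane) => h (x + t • v) * k x)
      (F' := fun (t : ℝ) (x : Plane) => fderiv ℝ h (x + t • v) v * k x) (x₀ := 0)
      (bound := fun x => M * ‖k x‖) (s := univ) univ_mem
      (Eventually.of_forall fun t => ((hh.continuous.comp (by fun_prop)).mul hk).aestronglyMeasurable)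
      (((hh.continuous.comp (by fun_prop)).mul hk).integrable_of_hasCompactSupport
        hck.mul_left)
      ((ch.comp (g := fun x => fderiv ℝ h x v) (f := fun x : Plane => x + (0 : ℝ) • v)
        (by fun_prop)).mul hk).aestronglyMeasurable
      (ae_of_all _ fun x t _ => by
        rw [norm_mul]; exact mul_le_mul_of_nonneg_right (hM _) (norm_nonneg _))
      ((hk.norm.const_mul M).integrable_of_hasCompactSupport hck.norm.mul_left)
      (ae_of_all _ fun x t _ => (dt h hh x v t).mul_const (k x))).2
    simpa using this
  have h1 := dom f (fun x => fderiv ℝ g x w) v hf hcf (cg w) (kg w)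
  have h2 := dom g (fun x => fderiv ℝ f x w) (-v) hg hcg (cf w) (kf w)
  have e : (fun t : ℝ => ∫ x, f (x + t • v) * fderiv ℝ g x w)
      = fun t : ℝ => -∫ x, g (x + t • -v) * fderiv ℝ f x w := by
    funext t
    have hft : ContDiff ℝ 1 fun x => f (x + t • v) := hf.comp (by fun_prop)
    have hct : HasCompactSupport fun x => f (x + t • v) :=
      hcf.comp_homeomorph (Homeomorph.addRight (t • v))
    have ed : ∀ x, fderiv ℝ (fun x => f (x + t • v)) x w = fderiv ℝ f (x + t • v) w := by
      intro x
      rw [fderiv_comp_add_right]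
    rw [integral_mul_fderiv_eq_neg_fderiv_mul_of_integrable]
    · simp only [ed]
      rw [← integral_sub_right_eq_self (fun x => fderiv ℝ f (x + t • v) w * g x) (t • v)]
      congr 1
      refine integral_congr_ae (ae_of_all _ fun x => ?_)
      simp [sub_eq_add_neg, mul_comm]
    · exact (((hft.continuous_fderiv one_ne_zero).clm_apply continuous_const).mul
        hg.continuous).integrable_of_hasCompactSupport hcg.mul_left
    · exact (hft.continuous.mul (cg w)).integrable_of_hasCompactSupport (kg w).mul_left
    · exact (hft.continuous.mul hg.continuous).integrable_of_hasCompactSupport hcg.mul_left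
    · exact fun x _ => hft.differentiable one_ne_zero x
    · exact fun x _ => hg.differentiable one_ne_zero x
  rw [e] at h1
  have h3 := h1.unique h2.fun_neg
  rw [h3, ← integral_neg]
  refine integral_congr_ae (ae_of_all _ fun x => ?_)
  simp [mul_comm]

theorem hasFDerivAt_normSq {u : Plane → ℂ} (hu : ContDiff ℝ 1 u) (x v : Plane) :
    fderiv ℝ (fun x => ‖u x‖ ^ 2) x v = 2 * (fderiv ℝ u x v * (starRingEnd ℂ) (u x)).re := by
  have := ((hu.differentiable one_ne_zero x).hasFDerivAt.norm_sq).fderiv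
  rw [this]
  simp [Complex.inner, mul_comm]
  ring

theorem contDiff_normSq {u : Plane → ℂ} (hu : ContDiff ℝ 1 u) :
    ContDiff ℝ 1 (fun x => ‖u x‖ ^ 2) := hu.norm_sq ℝ

theorem continuous_magSq {B : ℝ} {A : Plane → Plane} {u : Plane → ℂ} (hA : Continuous A)
    (hu : ContDiff ℝ 1 u) : Continuous (magSq B A u) := by
  have c : ∀ v, Continuous fun x => fderiv ℝ u x v := fun v =>
    (hu.continuous_fderiv one_ne_zero).clm_apply continuous_const
  have := hu.continuous
  have c1 := c (1, 0)
  have c2 := c (0, 1)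
  unfold magSq
  fun_prop

theorem continuous_curl2 {A : Plane → Plane} (hA : ContDiff ℝ 1 A) : Continuous (curl2 A) := by
  have h1 : ContDiff ℝ 1 fun y => (A y).1 := contDiff_fst.comp hA
  have h2 : ContDiff ℝ 1 fun y => (A y).2 := contDiff_snd.comp hA
  unfold curl2
  exact ((h2.continuous_fderiv one_ne_zero).clm_apply continuous_const).sub
    ((h1.continuous_fderiv one_ne_zero).clm_apply continuous_const)

theorem magSq_nonneg {B : ℝ} {A : Plane → Plane} {u : Plane → ℂ} {x : Plane} :
    0 ≤ magSq B A u x := by unfold magSq; positivity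

/-- The lowest Landau level bound for compactly supported functions. -/
theorem integral_curl_le_magSq {B : ℝ} {A : Plane → Plane} {u : Plane → ℂ} (hA : ContDiff ℝ 1 A)
    (hu : ContDiff ℝ 1 u) (hc : HasCompactSupport u) :
    B * ∫ x, curl2 A x * ‖u x‖ ^ 2 ≤ ∫ x, magSq B A u x := by
  have hA1 : ContDiff ℝ 1 fun y => (A y).1 := contDiff_fst.comp hA
  have hA2 : ContDiff ℝ 1 fun y => (A y).2 := contDiff_snd.comp hA
  have c : ∀ v, Continuous fun x => fderiv ℝ u x v := fun v =>
    (hu.continuous_fderiv one_ne_zero).clm_apply continuous_const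
  have kc : ∀ v, HasCompactSupport fun x => fderiv ℝ u x v := fun v => hc.fderiv_apply ℝ v
  set ρ : Plane → ℝ := fun x => ‖u x‖ ^ 2 with hρ
  have ρd : ContDiff ℝ 1 ρ := contDiff_normSq hu
  have ρk : HasCompactSupport ρ := hc.comp_left (g := fun z : ℂ => ‖z‖ ^ 2) (by simp)
  have cρ : ∀ v, Continuous fun x => fderiv ℝ ρ x v := fun v =>
    (ρd.continuous_fderiv one_ne_zero).clm_apply continuous_const
  have ρkd : ∀ v, HasCompactSupport fun x => fderiv ℝ ρ x v := fun v => ρk.fderiv_apply ℝ v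
  have conjd : ContDiff ℝ 1 fun x => (starRingEnd ℂ) (u x) :=
    Complex.conjCLE.contDiff.comp hu
  have conjk : HasCompactSupport fun x => (starRingEnd ℂ) (u x) :=
    hc.comp_left (g := starRingEnd ℂ) (by simp)
  have conje : ∀ x v, fderiv ℝ (fun x => (starRingEnd ℂ) (u x)) x v
      = (starRingEnd ℂ) (fderiv ℝ u x v) := by
    intro x v
    have := (Complex.conjCLE.toContinuousLinearMap.hasFDerivAt.comp x
      (hu.differentiable one_ne_zero x).hasFDerivAt).fderiv
    have h2 : fderiv ℝ (fun x => (starRingEnd ℂ) (u x)) x = _ := this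
    rw [h2]; rfl
  have jac : ∫ x, (fderiv ℝ u x (1, 0) * (starRingEnd ℂ) (fderiv ℝ u x (0, 1))).im = 0 := by
    have h := integral_fderiv_mul_fderiv_comm hu conjd hc conjk (1, 0) (0, 1)
    simp only [conje] at h
    have i1 : Integrable fun x => fderiv ℝ u x (1, 0) * (starRingEnd ℂ) (fderiv ℝ u x (0, 1)) :=
      ((c _).mul (Complex.continuous_conj.comp (c _))).integrable_of_hasCompactSupport
        (kc _).mul_right
    have h1 := integral_im i1
    have h2 : (∫ x, fderiv ℝ u x (0, 1) * (starRingEnd ℂ) (fderiv ℝ u x (1, 0)))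
        = (starRingEnd ℂ) (∫ x, fderiv ℝ u x (1, 0) * (starRingEnd ℂ) (fderiv ℝ u x (0, 1))) := by
      rw [← integral_conj]
      simp [mul_comm]
    rw [h2] at h
    have h3 := congrArg Complex.im h
    rw [Complex.conj_im] at h3
    refine h1.trans ?_
    change (∫ x, fderiv ℝ u x (1, 0) * (starRingEnd ℂ) (fderiv ℝ u x (0, 1))).im = 0
    linarith
  have parts : ∀ (a : Plane → ℝ) (v : Plane), ContDiff ℝ 1 a →
      ∫ x, a x * fderiv ℝ ρ x v = -∫ x, fderiv ℝ a x v * ρ x := by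
    intro a v ha
    have ca : Continuous fun x => fderiv ℝ a x v :=
      (ha.continuous_fderiv one_ne_zero).clm_apply continuous_const
    refine integral_mul_fderiv_eq_neg_fderiv_mul_of_integrable ?_ ?_ ?_ ?_ ?_
    · exact (ca.mul ρd.continuous).integrable_of_hasCompactSupport ρk.mul_left
    · exact (ha.continuous.mul (cρ v)).integrable_of_hasCompactSupport (ρkd v).mul_left
    · exact (ha.continuous.mul ρd.continuous).integrable_of_hasCompactSupport ρk.mul_left
    · exact fun x _ => ha.differentiable one_ne_zero x
    · exact fun x _ => ρd.differentiable one_ne_zero x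
  have p1 := parts _ (1, 0) hA2
  have p2 := parts _ (0, 1) hA1
  have intc : ∀ a : Plane → ℝ, ContDiff ℝ 1 a → ∀ v, Integrable fun x => a x * fderiv ℝ ρ x v :=
    fun a ha v => (ha.continuous.mul (cρ v)).integrable_of_hasCompactSupport (ρkd v).mul_left
  have intd : ∀ a : Plane → ℝ, ContDiff ℝ 1 a → ∀ v, Integrable fun x => fderiv ℝ a x v * ρ x :=
    fun a ha v => (((ha.continuous_fderiv one_ne_zero).clm_apply continuous_const).mul
      ρd.continuous).integrable_of_hasCompactSupport ρk.mul_left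
  have ij : Integrable fun x => (fderiv ℝ u x (1, 0) * (starRingEnd ℂ) (fderiv ℝ u x (0, 1))).im :=
    (Complex.continuous_im.comp ((c _).mul
      (Complex.continuous_conj.comp (c _)))).integrable_of_hasCompactSupport
      ((kc (1, 0)).mul_right (f' := fun x => (starRingEnd ℂ) (fderiv ℝ u x (0, 1))) |>.comp_left
        (g := Complex.im) (by simp))
  have im : Integrable (magSq B A u) := by
    refine (continuous_magSq hA.continuous hu).integrable_of_hasCompactSupport ?_
    refine ((kc (1, 0)).norm.add ((kc (0, 1)).norm.add hc.norm)).mono fun x hx => ?_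
    rw [Function.mem_support] at hx ⊢
    contrapose! hx
    have n1 := norm_nonneg (fderiv ℝ u x (1, 0))
    have n2 := norm_nonneg (fderiv ℝ u x (0, 1))
    have n3 := norm_nonneg (u x)
    simp only [Pi.add_apply] at hx
    have z1 : fderiv ℝ u x (1, 0) = 0 := norm_eq_zero.1 (by linarith)
    have z2 : fderiv ℝ u x (0, 1) = 0 := norm_eq_zero.1 (by linarith)
    have z3 : u x = 0 := norm_eq_zero.1 (by linarith)
    simp [magSq, z1, z2, z3]
  have point : ∀ x, -2 * (fderiv ℝ u x (1, 0) * (starRingEnd ℂ) (fderiv ℝ u x (0, 1))).im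
      - B * ((A x).2 * fderiv ℝ ρ x (1, 0) - (A x).1 * fderiv ℝ ρ x (0, 1)) ≤ magSq B A u x := by
    intro x
    rw [hρ, hasFDerivAt_normSq hu, hasFDerivAt_normSq hu, magSq]
    generalize fderiv ℝ u x (1, 0) = a
    generalize fderiv ℝ u x (0, 1) = b
    generalize u x = z
    obtain ⟨α, β⟩ := A x
    simp only [← Complex.normSq_eq_norm_sq, Complex.normSq_apply, Complex.mul_re, Complex.mul_im,
      Complex.sub_re, Complex.sub_im, Complex.neg_re, Complex.neg_im, Complex.I_re, Complex.I_im,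
      Complex.ofReal_re, Complex.ofReal_im, Complex.conj_re, Complex.conj_im]
    nlinarith [sq_nonneg (a.im - B * α * z.re + (b.re + B * β * z.im)),
      sq_nonneg (-a.re - B * α * z.im + (b.im - B * β * z.re))]
  have key : B * ∫ x, curl2 A x * ρ x = ∫ x, (-2 * (fderiv ℝ u x (1, 0)
      * (starRingEnd ℂ) (fderiv ℝ u x (0, 1))).im
      - B * ((A x).2 * fderiv ℝ ρ x (1, 0) - (A x).1 * fderiv ℝ ρ x (0, 1))) := by
    have i3 : Integrable fun x => (A x).2 * fderiv ℝ ρ x (1, 0) - (A x).1 * fderiv ℝ ρ x (0, 1) :=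
      (intc _ hA2 _).sub (intc _ hA1 _)
    rw [integral_sub (ij.const_mul _) (i3.const_mul _),
      integral_const_mul, integral_const_mul, jac, integral_sub (intc _ hA2 _) (intc _ hA1 _), p1, p2]
    simp only [curl2, sub_mul]
    rw [integral_sub (intd _ hA2 _) (intd _ hA1 _)]
    ring
  rw [key]
  exact integral_mono ((ij.const_mul _).sub (((intc _ hA2 _).sub (intc _ hA1 _)).const_mul _)) im
    point

theorem contDiff_F0 : ContDiff ℝ 1 F0 := by unfold F0; fun_prop

theorem curl2_F0 (x : Plane) : curl2 F0 x = 1 := by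
  have h1 : HasFDerivAt (fun y : Plane => y.1 / 2) ((2 : ℝ)⁻¹ • ContinuousLinearMap.fst ℝ ℝ ℝ) x := by
    simpa [div_eq_inv_mul] using (hasFDerivAt_fst (𝕜 := ℝ) (p := x)).const_mul (2 : ℝ)⁻¹
  have h2 : HasFDerivAt (fun y : Plane => -y.2 / 2)
      ((-(2 : ℝ)⁻¹) • ContinuousLinearMap.snd ℝ ℝ ℝ) x := by
    refine ((hasFDerivAt_snd (𝕜 := ℝ) (p := x)).const_mul (-(2 : ℝ)⁻¹)).congr_of_eventuallyEq
      (Eventually.of_forall fun y => ?_)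
    simp only
    ring
  have e1 : fderiv ℝ (fun y : Plane => (F0 y).2) x = _ := h1.fderiv
  have e2 : fderiv ℝ (fun y : Plane => (F0 y).1) x = _ := h2.fderiv
  rw [curl2, e1, e2]
  norm_num

theorem curl2_sub {A A' : Plane → Plane} (hA : ContDiff ℝ 1 A) (hA' : ContDiff ℝ 1 A') (x : Plane) :
    curl2 (fun x => A x - A' x) x = curl2 A x - curl2 A' x := by
  have h1 : ∀ A : Plane → Plane, ContDiff ℝ 1 A → DifferentiableAt ℝ (fun y => (A y).1) x :=
    fun A hA => (contDiff_fst.comp hA).differentiable one_ne_zero x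
  have h2 : ∀ A : Plane → Plane, ContDiff ℝ 1 A → DifferentiableAt ℝ (fun y => (A y).2) x :=
    fun A hA => (contDiff_snd.comp hA).differentiable one_ne_zero x
  simp only [curl2, Prod.fst_sub, Prod.snd_sub]
  rw [fderiv_fun_sub (h2 A hA) (h2 A' hA'), fderiv_fun_sub (h1 A hA) (h1 A' hA')]
  simp only [sub_apply]
  ring

/-- The radial gauge. -/
theorem exists_radial_gauge {a : Plane → Plane} (ha : ContDiff ℝ 1 a) :
    ∃ φ : Plane → ℝ, ContDiff ℝ 1 φ ∧ ∀ x : Plane,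
      fderiv ℝ φ x (1, 0) = (a x).1 + x.2 * ∫ t in (0 : ℝ)..1, t * curl2 a (t • x) ∧
      fderiv ℝ φ x (0, 1) = (a x).2 - x.1 * ∫ t in (0 : ℝ)..1, t * curl2 a (t • x) := by
  have h1 : ContDiff ℝ 1 fun y => (a y).1 := contDiff_fst.comp ha
  have h2 : ContDiff ℝ 1 fun y => (a y).2 := contDiff_snd.comp ha
  obtain ⟨a₁, ea₁⟩ : ∃ f : Plane → ℝ, f = fun y => (a y).1 := ⟨_, rfl⟩
  obtain ⟨a₂, ea₂⟩ : ∃ f : Plane → ℝ, f = fun y => (a y).2 := ⟨_, rfl⟩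
  have q1 : ∀ x, (a x).1 = a₁ x := fun x => by rw [ea₁]
  have q2 : ∀ x, (a x).2 = a₂ x := fun x => by rw [ea₂]
  have hb : Continuous (curl2 a) := continuous_curl2 ha
  have eb : ∀ x, curl2 a x = fderiv ℝ a₂ x (1, 0) - fderiv ℝ a₁ x (0, 1) := fun x => by
    rw [curl2, ea₁, ea₂]
  rw [← ea₁] at h1
  rw [← ea₂] at h2
  simp only [q1, q2]
  have d1 : Continuous (fderiv ℝ a₁) := h1.continuous_fderiv one_ne_zero
  have d2 : Continuous (fderiv ℝ a₂) := h2.continuous_fderiv one_ne_zero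
  have c1 := h1.continuous
  have c2 := h2.continuous
  have hs : ∀ (f : Plane → ℝ), ContDiff ℝ 1 f → ∀ (x : Plane) (t : ℝ),
      HasFDerivAt (fun x : Plane => f (t • x)) (t • fderiv ℝ f (t • x)) x := by
    intro f hf x t
    have hl : HasFDerivAt (fun x : Plane => t • x) (t • ContinuousLinearMap.id ℝ Plane) x :=
      (hasFDerivAt_id x).const_smul t
    have := ((hf.differentiable one_ne_zero (t • x)).hasFDerivAt).comp x hl
    refine this.congr_fderiv ?_
    ext <;> simp
  let F : Plane → ℝ → ℝ := fun x t => x.1 * a₁ (t • x) + x.2 * a₂ (t • x)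
  let F' : Plane → ℝ → Plane →L[ℝ] ℝ := fun x t =>
    (x.1 • (t • fderiv ℝ a₁ (t • x)) + a₁ (t • x) • ContinuousLinearMap.fst ℝ ℝ ℝ)
      + (x.2 • (t • fderiv ℝ a₂ (t • x)) + a₂ (t • x) • ContinuousLinearMap.snd ℝ ℝ ℝ)
  have hF : Continuous (Function.uncurry F) := by
    simp only [F, Function.uncurry_def]
    fun_prop
  have hF' : Continuous (Function.uncurry F') := by
    simp only [F', Function.uncurry_def]
    fun_prop
  have hd : ∀ x t, HasFDerivAt (fun x => F x t) (F' x t) x := fun x t =>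
    (hasFDerivAt_fst.mul (hs a₁ h1 x t)).add (hasFDerivAt_snd.mul (hs a₂ h2 x t))
  have ftc : ∀ (f : Plane → ℝ), ContDiff ℝ 1 f → ∀ x : Plane,
      ∫ t in (0 : ℝ)..1, (f (t • x) + t * (fderiv ℝ f (t • x) x)) = f x := by
    intro f hf x
    have hfc := hf.continuous
    have hfd := hf.continuous_fderiv one_ne_zero
    have hder : ∀ t : ℝ, HasDerivAt (fun t : ℝ => t * f (t • x))
        (f (t • x) + t * (fderiv ℝ f (t • x) x)) t := by
      intro t
      have hl : HasDerivAt (fun t : ℝ => t • x) x t := by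
        simpa using (hasDerivAt_id t).smul_const x
      have := (hasDerivAt_id t).fun_mul
        (((hf.differentiable one_ne_zero (t • x)).hasFDerivAt).comp_hasDerivAt t hl)
      simpa using this
    rw [intervalIntegral.integral_eq_sub_of_hasDerivAt (fun t _ => hder t)
      (Continuous.intervalIntegrable (by fun_prop) _ _)]
    simp
  have lin : ∀ (L : Plane →L[ℝ] ℝ) (x : Plane), L x = x.1 * L (1, 0) + x.2 * L (0, 1) := by
    intro L x
    conv_lhs => rw [show x = x.1 • ((1 : ℝ), (0 : ℝ)) + x.2 • ((0 : ℝ), (1 : ℝ)) by ext <;> simp]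
    rw [map_add, map_smul, map_smul]; rfl
  refine ⟨fun x => ∫ t in (0 : ℝ)..1, F x t, contDiff_parametric hF hF' hd, fun x => ?_⟩
  have cF' : Continuous (F' x) := hF'.comp (Continuous.prodMk_right x)
  have hfd := (hasFDerivAt_parametric (a := 0) (b := 1) hF hF' hd x).fderiv
  have app : ∀ v, fderiv ℝ (fun x => ∫ t in (0 : ℝ)..1, F x t) x v
      = ∫ t in (0 : ℝ)..1, F' x t v := by
    intro v
    rw [hfd, ContinuousLinearMap.intervalIntegral_apply (cF'.intervalIntegrable _ _)]
  constructor
  · rw [app]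
    conv_rhs => rw [← ftc a₁ h1 x]
    rw [← intervalIntegral.integral_const_mul, ← intervalIntegral.integral_add
      (Continuous.intervalIntegrable (by fun_prop) _ _)
      (Continuous.intervalIntegrable (by fun_prop) _ _)]
    refine intervalIntegral.integral_congr fun t _ => ?_
    simp only [F', add_apply, smul_apply, smul_eq_mul, eb]
    rw [lin (fderiv ℝ a₁ (t • x)) x]
    simp
    ring
  · rw [app]
    conv_rhs => rw [← ftc a₂ h2 x]
    rw [← intervalIntegral.integral_const_mul, ← intervalIntegral.integral_sub
      (Continuous.intervalIntegrable (by fun_prop) _ _)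
      (Continuous.intervalIntegrable (by fun_prop) _ _)]
    refine intervalIntegral.integral_congr fun t _ => ?_
    simp only [F', add_apply, smul_apply, smul_eq_mul, eb]
    rw [lin (fderiv ℝ a₂ (t • x)) x]
    simp
    ring

theorem magSq_gauge {B : ℝ} {A : Plane → Plane} {u : Plane → ℂ} {φ : Plane → ℝ}
    (hu : ContDiff ℝ 1 u) (hφ : ContDiff ℝ 1 φ) (x : Plane) :
    magSq B (fun x => A x - (fderiv ℝ φ x (1, 0), fderiv ℝ φ x (0, 1)))
      (fun x => Complex.exp (-(Complex.I * (B * φ x : ℝ))) * u x) x = magSq B A u x := by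
  have hp := (hφ.differentiable one_ne_zero x).hasFDerivAt
  have hx : HasFDerivAt (fun x => Complex.exp (-(Complex.I * (B * φ x : ℝ))))
      (Complex.exp (-(Complex.I * (B * φ x : ℝ))) •
        (-(Complex.I • (Complex.ofRealCLM ∘L (B • fderiv ℝ φ x))))) x := by
    have h1 : HasFDerivAt (fun x => -(Complex.I * ((B * φ x : ℝ) : ℂ)))
        (-(Complex.I • (Complex.ofRealCLM ∘L (B • fderiv ℝ φ x)))) x :=
      ((Complex.ofRealCLM.hasFDerivAt.comp x (hp.const_mul B)).const_mul Complex.I).neg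
    exact h1.cexp
  have hd := (hx.mul (hu.differentiable one_ne_zero x).hasFDerivAt).fderiv
  have hd' : fderiv ℝ (fun x => Complex.exp (-(Complex.I * (B * φ x : ℝ))) * u x) x = _ := hd
  have hn : ‖Complex.exp (-(Complex.I * (B * φ x : ℝ)))‖ = 1 := by
    rw [Complex.norm_exp]; simp
  have key : ∀ v (α : ℝ), ‖(-Complex.I) * fderiv ℝ (fun x => Complex.exp (-(Complex.I *
      (B * φ x : ℝ))) * u x) x v - ((B * (α - fderiv ℝ φ x v) : ℝ) : ℂ) *
      (Complex.exp (-(Complex.I * (B * φ x : ℝ))) * u x)‖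
      = ‖(-Complex.I) * fderiv ℝ u x v - ((B * α : ℝ) : ℂ) * u x‖ := by
    intro v α
    rw [hd']
    conv_rhs => rw [← one_mul ‖_‖, ← hn, ← norm_mul]
    congr 1
    simp only [add_apply, smul_apply, smul_eq_mul, neg_apply, ContinuousLinearMap.comp_apply,
      Complex.ofRealCLM_apply]
    push_cast
    linear_combination ((Complex.exp (-(Complex.I * (↑B * ↑(φ x)))) * u x * (B * fderiv ℝ φ x v)))
      * Complex.I_sq
  simp only [magSq, Prod.fst_sub, Prod.snd_sub]
  rw [key, key]

theorem norm_sub_sq_ge {ε : ℝ} (hε : 0 < ε) (v w : ℂ) :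
    (1 - ε) * ‖v‖ ^ 2 - ε⁻¹ * ‖w‖ ^ 2 ≤ ‖v - w‖ ^ 2 := by
  have h1 : (‖v‖ - ‖w‖) ^ 2 ≤ ‖v - w‖ ^ 2 := by
    rw [sq_le_sq]
    exact (abs_norm_sub_norm_le v w).trans (le_abs_self _)
  have h2 : ‖v‖ * ‖w‖ * 2 ≤ ε * ‖v‖ ^ 2 + ε⁻¹ * ‖w‖ ^ 2 := by
    have h3 : 0 ≤ ε⁻¹ * (ε * ‖v‖ - ‖w‖) ^ 2 := by positivity
    have h4 : ε⁻¹ * (ε * ‖v‖ - ‖w‖) ^ 2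
        = ε * ‖v‖ ^ 2 + ε⁻¹ * ‖w‖ ^ 2 - ‖v‖ * ‖w‖ * 2 := by field_simp; ring
    linarith
  nlinarith [sq_nonneg ‖w‖]

theorem magSq_add_ge {B ε : ℝ} (hε : 0 < ε) {A d : Plane → Plane} {u : Plane → ℂ} {x : Plane} :
    (1 - ε) * magSq B A u x - ε⁻¹ * (B ^ 2 * (esq (d x) * ‖u x‖ ^ 2))
      ≤ magSq B (fun x => A x + d x) u x := by
  have e : ∀ (α δ : ℝ) (z w : ℂ), ‖w - ((B * (α + δ) : ℝ) : ℂ) * z‖ ^ 2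
      ≥ (1 - ε) * ‖w - ((B * α : ℝ) : ℂ) * z‖ ^ 2 - ε⁻¹ * (B ^ 2 * (δ ^ 2 * ‖z‖ ^ 2)) := by
    intro α δ z w
    have := norm_sub_sq_ge hε (w - ((B * α : ℝ) : ℂ) * z) (((B * δ : ℝ) : ℂ) * z)
    have e1 : w - ((B * α : ℝ) : ℂ) * z - ((B * δ : ℝ) : ℂ) * z
        = w - ((B * (α + δ) : ℝ) : ℂ) * z := by push_cast; ring
    rw [e1, norm_mul, Complex.norm_real, Real.norm_eq_abs, mul_pow, sq_abs] at this
    linarith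
  have h1 := e (A x).1 (d x).1 (u x) ((-Complex.I) * fderiv ℝ u x (1, 0))
  have h2 := e (A x).2 (d x).2 (u x) ((-Complex.I) * fderiv ℝ u x (0, 1))
  simp only [magSq, esq, Prod.fst_add, Prod.snd_add]
  linarith

theorem smul_polarMap (t r θ : ℝ) : t • polarMap r θ = polarMap (t * r) θ := by
  simp [polarMap, mul_assoc]

theorem radial_gauge_bound {b : Plane → ℝ} (hb : Continuous b) {r : ℝ} (hr : r ∈ Icc (0 : ℝ) 1)
    (θ : ℝ) : r ^ 2 * (∫ t in (0 : ℝ)..1, t * b (t • polarMap r θ)) ^ 2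
      ≤ 1 / 2 * ∫ s in (0 : ℝ)..1, s * b (polarMap s θ) ^ 2 := by
  have hbp : Continuous fun s => b (polarMap s θ) :=
    hb.comp (continuous_polarMap.comp (Continuous.prodMk_left θ))
  have h1 := sq_integral_mul_le (w := fun t => t) (f := fun t => b (t • polarMap r θ)) zero_le_one
    continuous_id (by fun_prop) (fun t ht => ht.1)
  have h2 : (∫ t in (0 : ℝ)..1, t) = 1 / 2 := by rw [integral_id]; norm_num
  rw [h2] at h1
  have h3 : r ^ 2 * ∫ t in (0 : ℝ)..1, t * b (t • polarMap r θ) ^ 2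
      = ∫ s in (0 : ℝ)..r, s * b (polarMap s θ) ^ 2 := by
    have := intervalIntegral.mul_integral_comp_mul_left (a := 0) (b := 1)
      (f := fun s => s * b (polarMap s θ) ^ 2) r
    rw [mul_zero, mul_one] at this
    rw [← this, ← intervalIntegral.integral_const_mul, ← intervalIntegral.integral_const_mul]
    refine intervalIntegral.integral_congr fun t _ => ?_
    simp only [smul_polarMap, mul_comm t r]
    ring
  have h4 : (∫ s in (0 : ℝ)..r, s * b (polarMap s θ) ^ 2)
      ≤ ∫ s in (0 : ℝ)..1, s * b (polarMap s θ) ^ 2 := by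
    refine intervalIntegral.integral_mono_interval le_rfl hr.1 hr.2 ?_
      ((continuous_id.mul (hbp.pow 2)).intervalIntegrable _ _)
    filter_upwards [ae_restrict_mem measurableSet_Ioc] with s hs
    exact mul_nonneg hs.1.le (sq_nonneg _)
  calc _ ≤ r ^ 2 * (1 / 2 * ∫ t in (0 : ℝ)..1, t * b (t • polarMap r θ) ^ 2) :=
        mul_le_mul_of_nonneg_left h1 (sq_nonneg _)
    _ = 1 / 2 * (r ^ 2 * ∫ t in (0 : ℝ)..1, t * b (t • polarMap r θ) ^ 2) := by ring
    _ ≤ _ := by rw [h3]; linarith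

/-- Comparison of the magnetic energy for a general potential with the constant field one. -/
theorem magSq_lower_bound {B lam Z : ℝ} (hZ : 0 < Z) (hZ1 : Z ≤ 1) {A : Plane → Plane}
    {u : Plane → ℂ} (hA : ContDiff ℝ 1 A) (hu : ContDiff ℝ 1 u)
    (hP : ∀ θ ∈ Icc (-Real.pi) Real.pi, ∫ r in (0 : ℝ)..1, r * ‖u (polarMap r θ)‖ ^ 2 ≤ Z)
    (H : ∀ w : Plane → ℂ, ContDiff ℝ 1 w →
      lam * ∫ x in unitDisc, ‖w x‖ ^ 2 ≤ ∫ x in unitDisc, magSq B F0 w x) :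
    (1 - Z) * (lam * ∫ x in unitDisc, ‖u x‖ ^ 2)
      - 1 / 2 * (B ^ 2 * ∫ x in unitDisc, (curl2 A x - 1) ^ 2)
      ≤ ∫ x in unitDisc, magSq B A u x := by
  have ha : ContDiff ℝ 1 fun x => A x - F0 x := hA.sub contDiff_F0
  obtain ⟨φ, hφ, hg⟩ := exists_radial_gauge ha
  have ecurl : curl2 (fun x => A x - F0 x) = fun x => curl2 A x - 1 := by
    funext x; rw [curl2_sub hA contDiff_F0, curl2_F0]
  rw [ecurl] at hg
  have hb : Continuous fun x => curl2 A x - 1 := (continuous_curl2 hA).sub continuous_const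
  obtain ⟨b, eb⟩ : ∃ b : Plane → ℝ, b = fun x => curl2 A x - 1 := ⟨_, rfl⟩
  have eb' : ∀ x, curl2 A x - 1 = b x := fun x => by rw [eb]
  simp only [eb'] at hg ⊢
  rw [← eb] at hb
  let β : Plane → ℝ := fun x => ∫ t in (0 : ℝ)..1, t * b (t • x)
  have hβ : Continuous β :=
    intervalIntegral.continuous_parametric_intervalIntegral_of_continuous'
      (f := fun x t => t * b (t • x)) (by simp only [Function.uncurry_def]; fun_prop) _ _
  let d : Plane → Plane := fun x => (-x.2 * β x, x.1 * β x)
  have hd : Continuous d := by simp only [d]; fun_prop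
  let w : Plane → ℂ := fun x => Complex.exp (-(Complex.I * (B * φ x : ℝ))) * u x
  have hw : ContDiff ℝ 1 w := by
    have : ContDiff ℝ 1 fun x => ((B * φ x : ℝ) : ℂ) :=
      Complex.ofRealCLM.contDiff.comp (contDiff_const.mul hφ)
    exact (Complex.contDiff_exp.comp (contDiff_const.mul this).neg).mul hu
  have nw : ∀ x, ‖w x‖ = ‖u x‖ := by
    intro x
    simp only [w]
    rw [norm_mul, Complex.norm_exp]; simp
  have em : ∀ x, magSq B A u x = magSq B (fun x => F0 x + d x) w x := by
    intro x
    rw [← magSq_gauge hu hφ x]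
    congr 1
    funext y
    obtain ⟨g1, g2⟩ := hg y
    rw [g1, g2]
    ext
    · simp only [Prod.fst_sub, Prod.fst_add, d, β]; ring
    · simp only [Prod.snd_sub, Prod.snd_add, d, β]; ring
  have hesq : Continuous fun x => esq (d x) * ‖u x‖ ^ 2 := by
    have := hu.continuous
    unfold esq
    fun_prop
  have cm0 := continuous_magSq (B := B) contDiff_F0.continuous hw
  have cm : Continuous (magSq B A u) := continuous_magSq hA.continuous hu
  have hb2 : Continuous fun x => b x ^ 2 := hb.pow 2
  have err : ∫ x in unitDisc, esq (d x) * ‖u x‖ ^ 2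
      ≤ Z * (1 / 2 * ∫ x in unitDisc, b x ^ 2) := by
    have cu := hu.continuous
    have cp := continuous_polarMap
    rw [setIntegral_unitDisc_polar_swap hesq, setIntegral_unitDisc_polar_swap hb2,
      ← intervalIntegral.integral_const_mul, ← intervalIntegral.integral_const_mul]
    have pc : ∀ f : Plane → ℝ, Continuous f →
        Continuous fun θ => ∫ r in (0 : ℝ)..1, r * f (polarMap r θ) := fun f hf =>
      intervalIntegral.continuous_parametric_intervalIntegral_of_continuous'
        (f := fun θ r => r * f (polarMap r θ)) (by
          simp only [Function.uncurry_def]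
          exact continuous_snd.mul (hf.comp (cp.comp continuous_swap))) _ _
    have pcr : ∀ f : Plane → ℝ, Continuous f → ∀ θ, Continuous fun r => r * f (polarMap r θ) :=
      fun f hf θ => continuous_id.mul (hf.comp (cp.comp (Continuous.prodMk_left θ)))
    refine intervalIntegral.integral_mono_on (by linarith [Real.pi_pos])
      ((pc _ hesq).intervalIntegrable _ _)
      ((((pc _ hb2).const_mul _).const_mul _).intervalIntegrable _ _) fun θ hθ => ?_
    have step : ∫ r in (0 : ℝ)..1, r * (esq (d (polarMap r θ)) * ‖u (polarMap r θ)‖ ^ 2)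
        ≤ ∫ r in (0 : ℝ)..1, (1 / 2 * ∫ s in (0 : ℝ)..1, s * b (polarMap s θ) ^ 2)
          * (r * ‖u (polarMap r θ)‖ ^ 2) := by
      refine intervalIntegral.integral_mono_on zero_le_one ((pcr _ hesq θ).intervalIntegrable _ _)
        (((pcr _ (cu.norm.pow 2) θ).const_mul _).intervalIntegrable _ _) fun r hr => ?_
      have e1 : esq (d (polarMap r θ)) = r ^ 2 * β (polarMap r θ) ^ 2 := by
        rw [← esq_polarMap r θ]; simp only [esq, d]; ring
      have e2 := radial_gauge_bound hb hr θ
      rw [e1]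
      have : 0 ≤ r * ‖u (polarMap r θ)‖ ^ 2 := mul_nonneg hr.1 (sq_nonneg _)
      nlinarith [mul_le_mul_of_nonneg_right e2 this]
    rw [intervalIntegral.integral_const_mul] at step
    have nn : 0 ≤ 1 / 2 * ∫ s in (0 : ℝ)..1, s * b (polarMap s θ) ^ 2 := by
      refine mul_nonneg (by norm_num) (intervalIntegral.integral_nonneg zero_le_one fun s hs => ?_)
      exact mul_nonneg hs.1 (sq_nonneg _)
    calc _ ≤ _ := step
      _ ≤ _ := mul_le_mul_of_nonneg_left (hP θ hθ) nn
      _ = _ := by ring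
  have h1 : (1 - Z) * (∫ x in unitDisc, magSq B F0 w x)
      - Z⁻¹ * (B ^ 2 * ∫ x in unitDisc, esq (d x) * ‖u x‖ ^ 2) ≤ ∫ x in unitDisc, magSq B A u x := by
    rw [← integral_const_mul, ← integral_const_mul, ← integral_const_mul, ← integral_sub
      ((integrableOn_unitDisc cm0).const_mul _)
      (((integrableOn_unitDisc hesq).const_mul _).const_mul _)]
    refine setIntegral_mono (((integrableOn_unitDisc cm0).const_mul _).sub
      (((integrableOn_unitDisc hesq).const_mul _).const_mul _)) (integrableOn_unitDisc cm) fun x => ?_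
    simp only
    rw [em x, ← nw x]
    exact magSq_add_ge hZ
  have h2 := H w hw
  simp only [nw] at h2
  have h3 : Z⁻¹ * (B ^ 2 * ∫ x in unitDisc, esq (d x) * ‖u x‖ ^ 2)
      ≤ 1 / 2 * (B ^ 2 * ∫ x in unitDisc, b x ^ 2) := by
    calc _ ≤ Z⁻¹ * (B ^ 2 * (Z * (1 / 2 * ∫ x in unitDisc, b x ^ 2))) := by gcongr
      _ = _ := by field_simp
  have h4 := mul_le_mul_of_nonneg_left h2 (sub_nonneg.2 hZ1)
  linarith

theorem continuous_radialIntegral {f : Plane → ℝ} (hf : Continuous f) :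
    Continuous fun θ => ∫ r in (0 : ℝ)..1, r * f (polarMap r θ) :=
  intervalIntegral.continuous_parametric_intervalIntegral_of_continuous'
    (f := fun θ r => r * f (polarMap r θ)) (by
      simp only [Function.uncurry_def]
      exact continuous_snd.mul (hf.comp (continuous_polarMap.comp continuous_swap))) _ _

theorem continuous_ray {f : Plane → ℝ} (hf : Continuous f) (θ : ℝ) :
    Continuous fun r => r * f (polarMap r θ) :=
  continuous_id.mul (hf.comp (continuous_polarMap.comp (Continuous.prodMk_left θ)))

theorem hasDerivAt_polarMap_angle (r θ : ℝ) :
    HasDerivAt (fun θ => polarMap r θ) (r • (-Real.sin θ, Real.cos θ)) θ := by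
  have h1 := (Real.hasDerivAt_cos θ).const_mul r
  have h2 := (Real.hasDerivAt_sin θ).const_mul r
  exact (h1.prodMk h2).congr_deriv (by simp)

theorem hasDerivAt_radialIntegral {f : Plane → ℝ} (hf : ContDiff ℝ 1 f) (θ : ℝ) :
    HasDerivAt (fun θ => ∫ r in (0 : ℝ)..1, r * f (polarMap r θ))
      (∫ r in (0 : ℝ)..1, r * (r * fderiv ℝ f (polarMap r θ) (-Real.sin θ, Real.cos θ))) θ := by
  have hfd := hf.continuous_fderiv one_ne_zero
  have hfc := hf.continuous
  have cp : Continuous fun p : ℝ × ℝ => polarMap p.2 p.1 := continuous_polarMap.comp continuous_swap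
  have c' : Continuous fun p : ℝ × ℝ =>
      p.2 * (p.2 * fderiv ℝ f (polarMap p.2 p.1) (-Real.sin p.1, Real.cos p.1)) :=
    continuous_snd.mul (continuous_snd.mul ((hfd.comp cp).clm_apply (by fun_prop)))
  have h := hasFDerivAt_parametric (H := ℝ) (a := 0) (b := 1)
    (F := fun θ r => r * f (polarMap r θ))
    (F' := fun θ r => ContinuousLinearMap.toSpanSingleton ℝ
      (r * (r * fderiv ℝ f (polarMap r θ) (-Real.sin θ, Real.cos θ))))
    (by simp only [Function.uncurry_def]; exact continuous_snd.mul (hfc.comp cp))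
    (by
      simp only [Function.uncurry_def]
      exact (ContinuousLinearMap.toSpanSingletonCLE (𝕜 := ℝ) (E := ℝ)).continuous.comp c')
    (fun θ r => by
      have h1 := ((hf.differentiable one_ne_zero (polarMap r θ)).hasFDerivAt).comp_hasDerivAt θ
        (hasDerivAt_polarMap_angle r θ)
      have h2 := (h1.const_mul r).hasFDerivAt
      refine h2.congr_fderiv ?_
      ext
      simp only [map_smul, smul_eq_mul]) θ
  refine h.hasDerivAt.congr_deriv ?_
  rw [ContinuousLinearMap.intervalIntegral_apply]
  · simp
  · refine Continuous.intervalIntegrable ?_ _ _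
    exact (ContinuousLinearMap.toSpanSingletonCLE (𝕜 := ℝ) (E := ℝ)).continuous.comp
      (c'.comp (Continuous.prodMk_right θ))

/-- Diamagnetic bound for the angular derivative of the density. -/
theorem abs_fderiv_normSq_le {B s : ℝ} (hs : 0 < s) {A : Plane → Plane} {u : Plane → ℂ}
    (hu : ContDiff ℝ 1 u) (x : Plane) (θ : ℝ) :
    |fderiv ℝ (fun x => ‖u x‖ ^ 2) x (-Real.sin θ, Real.cos θ)|
      ≤ s * ‖u x‖ ^ 2 + s⁻¹ * magSq B A u x := by
  have key : ∀ σ : ℝ, σ ^ 2 = s ^ 2 → 0 ≤ s * (s * ‖u x‖ ^ 2 + s⁻¹ * magSq B A u x)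
      + σ * fderiv ℝ (fun x => ‖u x‖ ^ 2) x (-Real.sin θ, Real.cos θ) := by
    intro σ hσ
    rw [hasFDerivAt_normSq hu, magSq]
    have e : fderiv ℝ u x (-Real.sin θ, Real.cos θ)
        = (-Real.sin θ : ℝ) • fderiv ℝ u x (1, 0) + (Real.cos θ : ℝ) • fderiv ℝ u x (0, 1) := by
      rw [← map_smul, ← map_smul, ← map_add]
      simp
    rw [e]
    have hsc := Real.sin_sq_add_cos_sq θ
    generalize Real.sin θ = S at *
    generalize Real.cos θ = C at *
    generalize fderiv ℝ u x (1, 0) = a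
    generalize fderiv ℝ u x (0, 1) = b
    generalize u x = z
    obtain ⟨α, β⟩ := A x
    rw [mul_add, mul_inv_cancel_left₀ hs.ne', ← mul_assoc, ← sq, ← hσ]
    simp only [← Complex.normSq_eq_norm_sq, Complex.normSq_apply, Complex.mul_re, Complex.mul_im,
      Complex.sub_re, Complex.sub_im, Complex.neg_re, Complex.neg_im, Complex.I_re, Complex.I_im,
      Complex.ofReal_re, Complex.ofReal_im, Complex.conj_re, Complex.conj_im, Complex.add_re,
      Complex.add_im, Complex.real_smul]
    have n1 := sq_nonneg (a.im - B * α * z.re - σ * S * z.im)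
    have n2 := sq_nonneg (-a.re - B * α * z.im + σ * S * z.re)
    have n3 := sq_nonneg (b.im - B * β * z.re + σ * C * z.im)
    have n4 := sq_nonneg (-b.re - B * β * z.im - σ * C * z.re)
    have h5 : S ^ 2 = 1 - C ^ 2 := by linarith
    linear_combination n1 + n2 + n3 + n4 + σ ^ 2 * (z.re ^ 2 + z.im ^ 2) * h5
  have k1 := key s rfl
  have k2 := key (-s) (by ring)
  rw [abs_le]
  constructor <;> nlinarith

/-- Estimates for the angular mass density of a function supported in a boundary layer. -/
theorem exists_angular_sup {B l Q : ℝ} (hl0 : 0 ≤ l) (hl1 : l ≤ 1) (hQ : 0 < Q)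
    {A : Plane → Plane} {u : Plane → ℂ} (hA : ContDiff ℝ 1 A) (hu : ContDiff ℝ 1 u)
    (hsupp : ∀ x, esq x ≤ 1 - l → u x = 0) (hE : ∫ x in unitDisc, magSq B A u x ≤ Q) :
    ∃ Z S : ℝ, 0 ≤ Z ∧ 0 ≤ S ∧
      (∀ θ ∈ Icc (-Real.pi) Real.pi, ∫ r in (0 : ℝ)..1, r * ‖u (polarMap r θ)‖ ^ 2 ≤ Z) ∧
      ∫ x in unitDisc, ‖u x‖ ^ 2 ≤ 2 * Real.pi * Z ∧
      S ≤ l / 2 * ∫ x in unitDisc, ‖u x‖ ^ 4 ∧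
      (∫ x in unitDisc, ‖u x‖ ^ 2) ^ 2 ≤ 2 * Real.pi * S ∧
      Z ^ 3 ≤ Z * S + 16 * Q * S := by
  have hpi := Real.pi_pos
  have hpi3 := Real.pi_gt_three
  have hle : -Real.pi ≤ Real.pi := by linarith
  have cu := hu.continuous
  have c2 : Continuous fun x => ‖u x‖ ^ 2 := by fun_prop
  have c4 : Continuous fun x => ‖u x‖ ^ 4 := by fun_prop
  have cm : Continuous (magSq B A u) := continuous_magSq hA.continuous hu
  obtain ⟨P, hP⟩ : ∃ P : ℝ → ℝ, P = fun θ => ∫ r in (0 : ℝ)..1, r * ‖u (polarMap r θ)‖ ^ 2 :=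
    ⟨_, rfl⟩
  obtain ⟨G, hG⟩ : ∃ G : ℝ → ℝ, G = fun θ => ∫ r in (0 : ℝ)..1, r * magSq B A u (polarMap r θ) :=
    ⟨_, rfl⟩
  have cP : Continuous P := hP ▸ continuous_radialIntegral c2
  have cG : Continuous G := hG ▸ continuous_radialIntegral cm
  have P0 : ∀ θ, 0 ≤ P θ := fun θ => by
    rw [hP]
    exact intervalIntegral.integral_nonneg zero_le_one fun r hr => mul_nonneg hr.1 (sq_nonneg _)
  have eN : ∫ x in unitDisc, ‖u x‖ ^ 2 = ∫ θ in (-Real.pi)..Real.pi, P θ := by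
    rw [setIntegral_unitDisc_polar_swap c2, hP]
  have eG : ∫ θ in (-Real.pi)..Real.pi, G θ ≤ Q := by
    rw [setIntegral_unitDisc_polar_swap cm] at hE
    rw [hG]; exact hE
  obtain ⟨θ₀, hθ₀, hmax⟩ := isCompact_Icc.exists_isMaxOn (nonempty_Icc.2 hle) cP.continuousOn
  have hmax : ∀ θ ∈ Icc (-Real.pi) Real.pi, P θ ≤ P θ₀ := hmax
  obtain ⟨S, hS⟩ : ∃ S, S = ∫ θ in (-Real.pi)..Real.pi, P θ ^ 2 := ⟨_, rfl⟩
  have S0 : 0 ≤ S := hS ▸ intervalIntegral.integral_nonneg hle fun θ _ => sq_nonneg _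
  have hPd : ∀ θ, HasDerivAt P (∫ r in (0 : ℝ)..1, r * (r * fderiv ℝ (fun x => ‖u x‖ ^ 2)
      (polarMap r θ) (-Real.sin θ, Real.cos θ))) θ := fun θ =>
    hP ▸ hasDerivAt_radialIntegral (contDiff_normSq hu) θ
  obtain ⟨P', hP'⟩ : ∃ P' : ℝ → ℝ, P' = fun θ => ∫ r in (0 : ℝ)..1, r * (r * fderiv ℝ
      (fun x => ‖u x‖ ^ 2) (polarMap r θ) (-Real.sin θ, Real.cos θ)) := ⟨_, rfl⟩
  have hPd' : ∀ θ, HasDerivAt P (P' θ) θ := fun θ => by rw [hP']; exact hPd θ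
  have cj : Continuous fun p : ℝ × ℝ => p.2 * (p.2 * fderiv ℝ (fun x => ‖u x‖ ^ 2)
      (polarMap p.2 p.1) (-Real.sin p.1, Real.cos p.1)) := by
    have cp : Continuous fun p : ℝ × ℝ => polarMap p.2 p.1 :=
      continuous_polarMap.comp continuous_swap
    exact continuous_snd.mul (continuous_snd.mul
      ((((contDiff_normSq hu).continuous_fderiv one_ne_zero).comp cp).clm_apply (by fun_prop)))
  have cP' : Continuous P' := by
    rw [hP']
    exact intervalIntegral.continuous_parametric_intervalIntegral_of_continuous'
      (f := fun θ r => r * (r * fderiv ℝ (fun x => ‖u x‖ ^ 2) (polarMap r θ)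
        (-Real.sin θ, Real.cos θ))) (by simpa only [Function.uncurry_def] using cj) _ _
  have bP' : ∀ s, 0 < s → ∀ θ, |P' θ| ≤ s * P θ + s⁻¹ * G θ := by
    intro s hs θ
    have i1 := (continuous_ray c2 θ).intervalIntegrable (μ := volume) 0 1
    have i2 := (continuous_ray cm θ).intervalIntegrable (μ := volume) 0 1
    rw [hP', hP, hG]
    simp only
    rw [← intervalIntegral.integral_const_mul, ← intervalIntegral.integral_const_mul,
      ← intervalIntegral.integral_add (i1.const_mul _) (i2.const_mul _)]
    refine (intervalIntegral.abs_integral_le_integral_abs zero_le_one).trans ?_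
    refine intervalIntegral.integral_mono_on zero_le_one
      (Continuous.intervalIntegrable ?_ _ _) ((i1.const_mul _).add (i2.const_mul _)) fun r hr => ?_
    · exact (cj.comp (Continuous.prodMk_right θ)).abs
    · have := abs_fderiv_normSq_le (B := B) (A := A) hs hu (polarMap r θ) θ
      rw [abs_mul, abs_mul, abs_of_nonneg hr.1]
      have h3 : r * |fderiv ℝ (fun x => ‖u x‖ ^ 2) (polarMap r θ) (-Real.sin θ, Real.cos θ)|
          ≤ |fderiv ℝ (fun x => ‖u x‖ ^ 2) (polarMap r θ) (-Real.sin θ, Real.cos θ)| :=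
        mul_le_of_le_one_left (abs_nonneg _) hr.2
      calc _ ≤ r * (s * ‖u (polarMap r θ)‖ ^ 2 + s⁻¹ * magSq B A u (polarMap r θ)) :=
            mul_le_mul_of_nonneg_left (h3.trans this) hr.1
        _ = _ := by ring
  refine ⟨P θ₀, S, P0 _, S0, fun θ hθ => by simpa only [hP] using hmax θ hθ, ?_, ?_, ?_, ?_⟩
  · rw [eN]
    have := intervalIntegral.integral_mono_on (μ := volume) hle (cP.intervalIntegrable _ _)
      (continuous_const (y := P θ₀) |>.intervalIntegrable _ _) hmax
    rw [intervalIntegral.integral_const, smul_eq_mul] at this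
    linarith
  · rw [setIntegral_unitDisc_polar_swap c4, hS, ← intervalIntegral.integral_const_mul]
    refine intervalIntegral.integral_mono_on hle ((cP.pow 2).intervalIntegrable _ _)
      (((continuous_radialIntegral c4).const_mul _).intervalIntegrable _ _) fun θ _ => ?_
    have hr0 : 0 ≤ Real.sqrt (1 - l) := Real.sqrt_nonneg _
    have hrs : Real.sqrt (1 - l) ^ 2 = 1 - l := Real.sq_sqrt (by linarith)
    have hr1 : Real.sqrt (1 - l) ≤ 1 := Real.sqrt_le_one.2 (by linarith)
    have split : ∀ f : Plane → ℝ, Continuous f → (∀ x, u x = 0 → f x = 0) →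
        ∫ r in (0 : ℝ)..1, r * f (polarMap r θ)
          = ∫ r in (Real.sqrt (1 - l))..1, r * f (polarMap r θ) := by
      intro f hf h0
      rw [← intervalIntegral.integral_add_adjacent_intervals (b := Real.sqrt (1 - l))
        ((continuous_ray hf θ).intervalIntegrable _ _)
        ((continuous_ray hf θ).intervalIntegrable _ _)]
      have : ∫ r in (0 : ℝ)..Real.sqrt (1 - l), r * f (polarMap r θ) = 0 := by
        refine (intervalIntegral.integral_congr (g := fun _ => (0 : ℝ)) fun r hr => ?_).trans
          (by simp)
        rw [uIcc_of_le hr0] at hr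
        simp only
        rw [h0 _ (hsupp _ ?_), mul_zero]
        rw [esq_polarMap, ← hrs]
        exact pow_le_pow_left₀ hr.1 hr.2 2
      rw [this, zero_add]
    rw [hP]
    simp only
    rw [split _ c2 (fun x hx => by simp [hx]), split _ c4 (fun x hx => by simp [hx])]
    have cs := sq_integral_mul_le (w := fun r => r) (f := fun r => ‖u (polarMap r θ)‖ ^ 2) hr1
      continuous_id (c2.comp (continuous_polarMap.comp (Continuous.prodMk_left θ)))
      (fun x hx => hr0.trans hx.1)
    have h2 : (∫ t in (Real.sqrt (1 - l))..1, t) = l / 2 := by rw [integral_id, hrs]; ring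
    rw [h2] at cs
    refine cs.trans (le_of_eq ?_)
    congr 1
    refine intervalIntegral.integral_congr fun r _ => ?_
    ring
  · rw [eN]
    have := sq_integral_mul_le (w := fun _ => 1) (f := P) hle continuous_const cP
      (fun _ _ => zero_le_one)
    simp only [one_mul] at this
    rw [← hS, intervalIntegral.integral_const, smul_eq_mul, mul_one] at this
    linarith
  · rcases (P0 θ₀).eq_or_lt with h0 | h0
    · rw [← h0]; nlinarith [mul_nonneg hQ.le S0]
    have main : ∀ s, 0 < s → ∀ θ ∈ Icc (-Real.pi) Real.pi,
        P θ₀ ^ 2 - P θ ^ 2 ≤ 2 * s * S + 2 * P θ₀ * s⁻¹ * Q := by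
      intro s hs θ hθ
      have hd : ∀ t, HasDerivAt (fun t => P t ^ 2) (2 * P t * P' t) t := fun t =>
        ((hPd' t).fun_pow 2).congr_deriv (by push_cast; ring)
      have cd : Continuous fun t => 2 * P t * P' t := by fun_prop
      rw [← intervalIntegral.integral_eq_sub_of_hasDerivAt (fun t _ => hd t)
        (cd.intervalIntegrable _ _)]
      have a1 : ∫ t in θ..θ₀, 2 * P t * P' t ≤ ∫ t in (-Real.pi)..Real.pi, |2 * P t * P' t| := by
        refine (le_abs_self _).trans ?_
        refine (intervalIntegral.norm_integral_le_integral_norm_uIoc (f := fun t => 2 * P t * P' t)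
          (μ := volume)).trans ?_
        rw [intervalIntegral.integral_of_le hle]
        refine setIntegral_mono_set (cd.norm.integrableOn_Ioc) (ae_of_all _ fun t => norm_nonneg _)
          (Eventually.of_forall fun t ht => ?_)
        rw [uIoc] at ht
        exact ⟨lt_of_le_of_lt (le_min hθ.1 hθ₀.1) ht.1, ht.2.trans (max_le hθ.2 hθ₀.2)⟩
      refine a1.trans ?_
      have a2 : ∫ t in (-Real.pi)..Real.pi, |2 * P t * P' t|
          ≤ ∫ t in (-Real.pi)..Real.pi, (2 * s * P t ^ 2 + 2 * P θ₀ * s⁻¹ * G t) := by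
        refine intervalIntegral.integral_mono_on hle (cd.abs.intervalIntegrable _ _)
          (Continuous.intervalIntegrable (by fun_prop) _ _) fun t ht => ?_
        have G0 : 0 ≤ G t := by
          rw [hG]
          exact intervalIntegral.integral_nonneg zero_le_one fun r hr =>
            mul_nonneg hr.1 magSq_nonneg
        rw [abs_mul, abs_of_nonneg (by linarith [P0 t] : 0 ≤ 2 * P t)]
        calc 2 * P t * |P' t| ≤ 2 * P t * (s * P t + s⁻¹ * G t) :=
              mul_le_mul_of_nonneg_left (bP' s hs t) (by linarith [P0 t])
          _ = 2 * s * P t ^ 2 + 2 * P t * (s⁻¹ * G t) := by ring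
          _ ≤ 2 * s * P t ^ 2 + 2 * P θ₀ * (s⁻¹ * G t) := by
              have := hmax t ht
              have : 0 ≤ s⁻¹ * G t := by positivity
              gcongr
          _ = _ := by ring
      refine a2.trans ?_
      rw [intervalIntegral.integral_add (Continuous.intervalIntegrable (by fun_prop) _ _)
        (Continuous.intervalIntegrable (by fun_prop) _ _), intervalIntegral.integral_const_mul,
        intervalIntegral.integral_const_mul, ← hS]
      have : 0 ≤ 2 * P θ₀ * s⁻¹ := by positivity
      gcongr
    have hs : 0 < 4 * Q / P θ₀ := by positivity
    have avg := intervalIntegral.integral_mono_on (μ := volume) hle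
      (Continuous.intervalIntegrable (by fun_prop) _ _)
      (continuous_const.intervalIntegrable _ _) (main _ hs)
    rw [intervalIntegral.integral_sub (Continuous.intervalIntegrable (by fun_prop) _ _)
      (Continuous.intervalIntegrable (by fun_prop) _ _), intervalIntegral.integral_const,
      intervalIntegral.integral_const, ← hS, smul_eq_mul, smul_eq_mul] at avg
    generalize P θ₀ = Z at *
    have e1 : 2 * (4 * Q / Z) * S + 2 * Z * (4 * Q / Z)⁻¹ * Q = 8 * Q * S / Z + Z ^ 2 / 2 := by
      field_simp
      ring
    rw [e1] at avg
    have e2 : (Real.pi - -Real.pi) * (Z ^ 2 / 2) - S ≤ (Real.pi - -Real.pi) * (8 * Q * S / Z) := by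
      linarith
    have e3 := mul_le_mul_of_nonneg_right e2 h0.le
    have e4 : (Real.pi - -Real.pi) * (8 * Q * S / Z) * Z = (Real.pi - -Real.pi) * (8 * Q * S) := by
      field_simp
    rw [e4] at e3
    have e5 : Real.pi * (Z ^ 3 - 16 * Q * S) ≤ Z * S := by nlinarith
    by_contra! hcon
    have e6 : 0 ≤ Z * S := by positivity
    nlinarith

theorem exists_smoothTransition_deriv_bound :
    ∃ M, 0 < M ∧ ∀ x, |deriv Real.smoothTransition x| ≤ M := by
  have hc : Continuous (deriv Real.smoothTransition) :=
    (Real.smoothTransition.contDiff (n := 1)).continuous_deriv_one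
  obtain ⟨M, hM⟩ := isCompact_Icc.exists_bound_of_continuousOn (s := Icc (0 : ℝ) 1) hc.continuousOn
  refine ⟨|M| + 1, by positivity, fun x => ?_⟩
  by_cases hx : x ∈ Icc (0 : ℝ) 1
  · have := hM x hx
    rw [Real.norm_eq_abs] at this
    linarith [le_abs_self M]
  · have : deriv Real.smoothTransition x = 0 := by
      rw [mem_Icc, not_and_or, not_le, not_le] at hx
      rcases hx with hx | hx
      · have : Real.smoothTransition =ᶠ[𝓝 x] fun _ => 0 := by
          filter_upwards [gt_mem_nhds hx] with y hy
          exact Real.smoothTransition.zero_of_nonpos hy.le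
        rw [this.deriv_eq, deriv_const]
      · have : Real.smoothTransition =ᶠ[𝓝 x] fun _ => 1 := by
          filter_upwards [lt_mem_nhds hx] with y hy
          exact Real.smoothTransition.one_of_one_le hy.le
        rw [this.deriv_eq, deriv_const]
    rw [this, abs_zero]
    positivity

theorem magSq_cos_add_magSq_sin {B : ℝ} {A : Plane → Plane} {ψ : Plane → ℂ} {g : Plane → ℝ}
    (hψ : ContDiff ℝ 1 ψ) (hg : ContDiff ℝ 1 g) (x : Plane) :
    magSq B A (fun x => (Real.cos (g x) : ℂ) * ψ x) x
      + magSq B A (fun x => (Real.sin (g x) : ℂ) * ψ x) x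
      = magSq B A ψ x
        + ((fderiv ℝ g x (1, 0)) ^ 2 + (fderiv ℝ g x (0, 1)) ^ 2) * ‖ψ x‖ ^ 2 := by
  have hgx := (hg.differentiable one_ne_zero x).hasFDerivAt
  have hψx := (hψ.differentiable one_ne_zero x).hasFDerivAt
  have d1 : ∀ v, fderiv ℝ (fun x => (Real.cos (g x) : ℂ) * ψ x) x v
      = (Real.cos (g x) : ℂ) * fderiv ℝ ψ x v
        - (Real.sin (g x) * fderiv ℝ g x v : ℝ) * ψ x := by
    intro v
    have h1 : HasFDerivAt (fun x => ((Real.cos (g x) : ℝ) : ℂ)) _ x :=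
      Complex.ofRealCLM.hasFDerivAt.comp x hgx.cos
    have h2 : fderiv ℝ (fun x => (Real.cos (g x) : ℂ) * ψ x) x = _ := (h1.mul hψx).fderiv
    rw [h2]
    simp only [add_apply, smul_apply, smul_eq_mul, ContinuousLinearMap.comp_apply,
      Complex.ofRealCLM_apply]
    push_cast
    ring
  have d2 : ∀ v, fderiv ℝ (fun x => (Real.sin (g x) : ℂ) * ψ x) x v
      = (Real.sin (g x) : ℂ) * fderiv ℝ ψ x v
        + (Real.cos (g x) * fderiv ℝ g x v : ℝ) * ψ x := by
    intro v
    have h1 : HasFDerivAt (fun x => ((Real.sin (g x) : ℝ) : ℂ)) _ x :=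
      Complex.ofRealCLM.hasFDerivAt.comp x hgx.sin
    have h2 : fderiv ℝ (fun x => (Real.sin (g x) : ℂ) * ψ x) x = _ := (h1.mul hψx).fderiv
    rw [h2]
    simp only [add_apply, smul_apply, smul_eq_mul, ContinuousLinearMap.comp_apply,
      Complex.ofRealCLM_apply]
    push_cast
    ring
  simp only [magSq, d1, d2]
  have hsc := Real.sin_sq_add_cos_sq (g x)
  generalize Real.sin (g x) = S at *
  generalize Real.cos (g x) = C at *
  generalize fderiv ℝ g x (1, 0) = p
  generalize fderiv ℝ g x (0, 1) = q
  generalize fderiv ℝ ψ x (1, 0) = a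
  generalize fderiv ℝ ψ x (0, 1) = b
  generalize ψ x = z
  obtain ⟨α, β⟩ := A x
  simp only
  have key : ∀ (w : ℂ) (t γ : ℝ), ‖-Complex.I * (C * w - (S * t : ℝ) * z) - (B * γ : ℝ) * (C * z)‖ ^ 2
      + ‖-Complex.I * (S * w + (C * t : ℝ) * z) - (B * γ : ℝ) * (S * z)‖ ^ 2
      = ‖-Complex.I * w - (B * γ : ℝ) * z‖ ^ 2 + t ^ 2 * ‖z‖ ^ 2 := by
    intro w t γ
    simp only [← Complex.normSq_eq_norm_sq, Complex.normSq_apply, Complex.mul_re, Complex.mul_im,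
      Complex.sub_re, Complex.sub_im, Complex.neg_re, Complex.neg_im, Complex.I_re, Complex.I_im,
      Complex.ofReal_re, Complex.ofReal_im, Complex.add_re, Complex.add_im]
    have h5 : S ^ 2 = 1 - C ^ 2 := by linarith
    linear_combination ((w.im - B * γ * z.re) ^ 2 + (w.re + B * γ * z.im) ^ 2
      + t ^ 2 * (z.re ^ 2 + z.im ^ 2)) * h5
  linarith [key a p α, key b q β]

/-- A partition of unity separating a boundary layer of the disc from the bulk, with its
localization error. -/
theorem exists_partition : ∃ K, 0 < K ∧ ∀ l, 0 < l → ∃ χ₁ χ₂ : Plane → ℝ,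
    ContDiff ℝ 1 χ₁ ∧ ContDiff ℝ 1 χ₂ ∧ (∀ x, χ₁ x ^ 2 + χ₂ x ^ 2 = 1) ∧
    (∀ x, 1 - l / 2 ≤ esq x → χ₁ x = 0) ∧ (∀ x, esq x ≤ 1 - l → χ₂ x = 0) ∧
    ∀ (B : ℝ) (A : Plane → Plane) (ψ : Plane → ℂ), ContDiff ℝ 1 ψ → ∀ x ∈ unitDisc,
      magSq B A (fun x => (χ₁ x : ℂ) * ψ x) x + magSq B A (fun x => (χ₂ x : ℂ) * ψ x) x
        ≤ magSq B A ψ x + K / l ^ 2 * ‖ψ x‖ ^ 2 := by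
  obtain ⟨M, hM, hb⟩ := exists_smoothTransition_deriv_bound
  refine ⟨(Real.pi * M * 2) ^ 2, by positivity, fun l hl => ?_⟩
  let g : Plane → ℝ := fun x => Real.pi / 2 * Real.smoothTransition ((esq x - (1 - l)) * (2 / l))
  have hq : ContDiff ℝ 1 fun x : Plane => (esq x - (1 - l)) * (2 / l) := by unfold esq; fun_prop
  have hg : ContDiff ℝ 1 g := contDiff_const.mul (Real.smoothTransition.contDiff.comp hq)
  refine ⟨fun x => Real.cos (g x), fun x => Real.sin (g x), Real.contDiff_cos.comp hg,
    Real.contDiff_sin.comp hg, fun x => Real.cos_sq_add_sin_sq _, fun x hx => ?_, fun x hx => ?_,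
    fun B A ψ hψ x hx => ?_⟩
  · have : g x = Real.pi / 2 := by
      simp only [g]
      rw [Real.smoothTransition.one_of_one_le, mul_one]
      rw [← div_le_iff₀ (by positivity), one_div_div]
      linarith
    simp only [this, Real.cos_pi_div_two]
  · have : g x = 0 := by
      simp only [g]
      rw [Real.smoothTransition.zero_of_nonpos, mul_zero]
      exact mul_nonpos_of_nonpos_of_nonneg (by linarith) (by positivity)
    simp only [this, Real.sin_zero]
  · rw [magSq_cos_add_magSq_sin hψ hg]
    refine add_le_add_right (mul_le_mul_of_nonneg_right ?_ (sq_nonneg _)) _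
    have d : ∀ v : Plane, fderiv ℝ g x v = Real.pi / 2 * (deriv Real.smoothTransition
        ((esq x - (1 - l)) * (2 / l)) * ((2 * x.1 * v.1 + 2 * x.2 * v.2) * (2 / l))) := by
      intro v
      have hf : HasFDerivAt (fun x : Plane => x.1) (ContinuousLinearMap.fst ℝ ℝ ℝ) x :=
        hasFDerivAt_fst
      have hs : HasFDerivAt (fun x : Plane => x.2) (ContinuousLinearMap.snd ℝ ℝ ℝ) x :=
        hasFDerivAt_snd
      have hesq : esq = fun x : Plane => x.1 * x.1 + x.2 * x.2 := by
        funext x; rw [esq, sq, sq]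
      have h0 : HasFDerivAt (fun x : Plane => (esq x - (1 - l)) * (2 / l)) _ x :=
        ((((hf.mul hf).add (hs.mul hs)).congr_of_eventuallyEq hesq.eventuallyEq).sub_const
          (1 - l)).mul_const (2 / l)
      have h1 : HasFDerivAt g _ x := (((Real.smoothTransition.contDiff (n := 1)).differentiable
        one_ne_zero ((esq x - (1 - l)) * (2 / l))).hasDerivAt.comp_hasFDerivAt x h0).const_mul
        (Real.pi / 2)
      rw [h1.fderiv]
      simp only [add_apply, smul_apply, smul_eq_mul, ContinuousLinearMap.coe_fst',
        ContinuousLinearMap.coe_snd']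
      ring
    rw [d, d]
    have hb' := hb ((esq x - (1 - l)) * (2 / l))
    have hb2 : deriv Real.smoothTransition ((esq x - (1 - l)) * (2 / l)) ^ 2 ≤ M ^ 2 := by
      rw [sq_le_sq, abs_of_pos hM]; exact hb'
    generalize deriv Real.smoothTransition ((esq x - (1 - l)) * (2 / l)) = D at *
    have hx' : x.1 ^ 2 + x.2 ^ 2 ≤ 1 := le_of_lt hx
    calc _ = (Real.pi * 2) ^ 2 / l ^ 2 * (D ^ 2 * (x.1 ^ 2 + x.2 ^ 2)) := by
          field_simp; ring
      _ ≤ (Real.pi * 2) ^ 2 / l ^ 2 * (M ^ 2 * 1) := by gcongr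
      _ = _ := by ring

/-- The lowest Landau level bound for functions vanishing near the boundary of the disc. -/
theorem setIntegral_curl_le_magSq {B δ : ℝ} (hδ : 0 < δ) {A : Plane → Plane} {u : Plane → ℂ}
    (hA : ContDiff ℝ 1 A) (hu : ContDiff ℝ 1 u) (h0 : ∀ x, 1 - δ ≤ esq x → u x = 0) :
    B * ∫ x in unitDisc, curl2 A x * ‖u x‖ ^ 2 ≤ ∫ x in unitDisc, magSq B A u x := by
  have hout : ∀ x, x ∉ unitDisc → 1 ≤ esq x := fun x hx => not_lt.1 hx
  have cesq : Continuous esq := by unfold esq; fun_prop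
  have hc : HasCompactSupport u := by
    refine HasCompactSupport.intro (K := Icc (-1 : ℝ) 1 ×ˢ Icc (-1 : ℝ) 1)
      (isCompact_Icc.prod isCompact_Icc) fun x hx => h0 x ?_
    have := hout x fun h => hx (unitDisc_subset h)
    linarith
  have := integral_curl_le_magSq (B := B) hA hu hc
  rwa [← setIntegral_eq_integral_of_forall_compl_eq_zero (s := unitDisc)
      (f := fun x => curl2 A x * ‖u x‖ ^ 2),
    ← setIntegral_eq_integral_of_forall_compl_eq_zero (s := unitDisc) (f := magSq B A u)] at this
  · intro x hx
    have hz : u =ᶠ[𝓝 x] fun _ => 0 := by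
      filter_upwards [(isOpen_lt continuous_const cesq).mem_nhds
        (show 1 - δ < esq x by linarith [hout x hx])] with y hy
      exact h0 y (le_of_lt hy)
    simp [magSq, hz.fderiv_eq, hz.self_of_nhds]
  · intro x hx
    simp [h0 x (by linarith [hout x hx])]

/-- Splitting a configuration into a bulk part, bounded below by the field strength, and a
boundary layer part. -/
theorem exists_layer_splitting : ∃ K, 0 < K ∧ ∀ l, 0 < l → ∀ (B : ℝ) (A : Plane → Plane)
    (ψ : Plane → ℂ), ContDiff ℝ 1 A → ContDiff ℝ 1 ψ → ∃ (N₁ : ℝ) (ψ₂ : Plane → ℂ), 0 ≤ N₁ ∧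
      ContDiff ℝ 1 ψ₂ ∧ (∀ x, esq x ≤ 1 - l → ψ₂ x = 0) ∧
      N₁ + ∫ x in unitDisc, ‖ψ₂ x‖ ^ 2 = ∫ x in unitDisc, ‖ψ x‖ ^ 2 ∧
      ∫ x in unitDisc, ‖ψ₂ x‖ ^ 4 ≤ ∫ x in unitDisc, ‖ψ x‖ ^ 4 ∧
      ∀ s, 0 < s → B * N₁ - s / 2 * (B ^ 2 * ∫ x in unitDisc, (curl2 A x - 1) ^ 2)
          - s⁻¹ / 2 * (∫ x in unitDisc, ‖ψ x‖ ^ 4) + ∫ x in unitDisc, magSq B A ψ₂ x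
        ≤ (∫ x in unitDisc, magSq B A ψ x) + K / l ^ 2 * ∫ x in unitDisc, ‖ψ x‖ ^ 2 := by
  obtain ⟨K, hK, hpart⟩ := exists_partition
  refine ⟨K, hK, fun l hl B A ψ hA hψ => ?_⟩
  obtain ⟨χ₁, χ₂, h1, h2, hsum, hz1, hz2, hims⟩ := hpart l hl
  have cψ := hψ.continuous
  have c1 := h1.continuous
  have c2 := h2.continuous
  have d1 : ContDiff ℝ 1 fun x => (χ₁ x : ℂ) * ψ x :=
    (Complex.ofRealCLM.contDiff.comp h1).mul hψ
  have d2 : ContDiff ℝ 1 fun x => (χ₂ x : ℂ) * ψ x :=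
    (Complex.ofRealCLM.contDiff.comp h2).mul hψ
  have hcurl := continuous_curl2 hA
  have nrm : ∀ (c : ℝ) (z : ℂ), ‖(c : ℂ) * z‖ ^ 2 = c ^ 2 * ‖z‖ ^ 2 := fun c z => by
    rw [norm_mul, Complex.norm_real, mul_pow, Real.norm_eq_abs, sq_abs]
  have le1 : ∀ x, χ₁ x ^ 2 ≤ 1 := fun x => by nlinarith [hsum x, sq_nonneg (χ₂ x)]
  have le2 : ∀ x, χ₂ x ^ 2 ≤ 1 := fun x => by nlinarith [hsum x, sq_nonneg (χ₁ x)]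
  refine ⟨∫ x in unitDisc, ‖(χ₁ x : ℂ) * ψ x‖ ^ 2, fun x => (χ₂ x : ℂ) * ψ x,
    integral_nonneg fun x => sq_nonneg _, d2, fun x hx => by simp [hz2 x hx], ?_, ?_, ?_⟩
  · rw [← integral_add (integrableOn_unitDisc (by fun_prop)) (integrableOn_unitDisc (by fun_prop))]
    refine integral_congr_ae (ae_of_all _ fun x => ?_)
    simp only [nrm]
    rw [← add_mul, hsum, one_mul]
  · refine setIntegral_mono (integrableOn_unitDisc (by fun_prop))
      (integrableOn_unitDisc (by fun_prop)) fun x => ?_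
    have e : ‖(χ₂ x : ℂ) * ψ x‖ ^ 4 = (χ₂ x ^ 2) ^ 2 * ‖ψ x‖ ^ 4 := by
      rw [show ‖(χ₂ x : ℂ) * ψ x‖ ^ 4 = (‖(χ₂ x : ℂ) * ψ x‖ ^ 2) ^ 2 by ring, nrm]
      ring
    simp only [e]
    exact mul_le_of_le_one_left (by positivity) (pow_le_one₀ (sq_nonneg _) (le2 x))
  · intro s hs
    have landau := setIntegral_curl_le_magSq (B := B) (half_pos hl) hA d1
      (fun x hx => by simp [hz1 x hx])
    have bulk : B * (∫ x in unitDisc, ‖(χ₁ x : ℂ) * ψ x‖ ^ 2)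
        - s / 2 * (B ^ 2 * ∫ x in unitDisc, (curl2 A x - 1) ^ 2)
        - s⁻¹ / 2 * ∫ x in unitDisc, ‖ψ x‖ ^ 4
        ≤ B * ∫ x in unitDisc, curl2 A x * ‖(χ₁ x : ℂ) * ψ x‖ ^ 2 := by
      simp only [← integral_const_mul]
      rw [← integral_sub (integrableOn_unitDisc (by fun_prop))
        (integrableOn_unitDisc (by fun_prop)), ← integral_sub
        (integrableOn_unitDisc (by fun_prop)) (integrableOn_unitDisc (by fun_prop))]
      refine setIntegral_mono (integrableOn_unitDisc (by fun_prop))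
        (integrableOn_unitDisc (by fun_prop)) fun x => ?_
      simp only [nrm]
      have hc := le1 x
      have hc0 := sq_nonneg (χ₁ x)
      generalize χ₁ x ^ 2 = c at *
      have hy : 0 ≤ ‖ψ x‖ ^ 2 := sq_nonneg _
      rw [show ‖ψ x‖ ^ 4 = (‖ψ x‖ ^ 2) ^ 2 by ring]
      generalize ‖ψ x‖ ^ 2 = y at *
      generalize curl2 A x = k
      have h3 : 0 ≤ s⁻¹ / 2 * (s * (B * (k - 1)) + c * y) ^ 2 := by positivity
      have h4 : s⁻¹ / 2 * (s * (B * (k - 1)) + c * y) ^ 2 = s / 2 * (B ^ 2 * (k - 1) ^ 2)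
          + B * (k - 1) * (c * y) + s⁻¹ / 2 * (c * y) ^ 2 := by field_simp; ring
      have h5 : s⁻¹ / 2 * (c * y) ^ 2 ≤ s⁻¹ / 2 * y ^ 2 := by
        have : c * y ≤ y := mul_le_of_le_one_left hy hc
        gcongr
      linarith
    have ims : (∫ x in unitDisc, magSq B A (fun x => (χ₁ x : ℂ) * ψ x) x)
        + ∫ x in unitDisc, magSq B A (fun x => (χ₂ x : ℂ) * ψ x) x
        ≤ (∫ x in unitDisc, magSq B A ψ x) + K / l ^ 2 * ∫ x in unitDisc, ‖ψ x‖ ^ 2 := by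
      have m1 := continuous_magSq (B := B) hA.continuous d1
      have m2 := continuous_magSq (B := B) hA.continuous d2
      have m := continuous_magSq (B := B) hA.continuous hψ
      rw [← integral_const_mul, ← integral_add (integrableOn_unitDisc m1)
        (integrableOn_unitDisc m2), ← integral_add (integrableOn_unitDisc m)
        (integrableOn_unitDisc (by fun_prop))]
      exact setIntegral_mono_on (integrableOn_unitDisc (m1.add m2))
        (integrableOn_unitDisc (m.add (by fun_prop))) measurableSet_unitDisc (hims B A ψ hψ)
    linarith

theorem GLenergy_eq {κ H : ℝ} {ψ : Plane → ℂ} {A : Plane → Plane} (hψ : ContDiff ℝ 1 ψ)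
    (hA : ContDiff ℝ 1 A) : GLenergy unitDisc κ H ψ A =
      (∫ x in unitDisc, magSq (κ * H) A ψ x) - κ ^ 2 * (∫ x in unitDisc, ‖ψ x‖ ^ 2)
        + κ ^ 2 / 2 * (∫ x in unitDisc, ‖ψ x‖ ^ 4)
        + (κ * H) ^ 2 * ∫ x in unitDisc, (curl2 A x - 1) ^ 2 := by
  have m := continuous_magSq (B := κ * H) hA.continuous hψ
  have cψ := hψ.continuous
  have hcurl := continuous_curl2 hA
  have m1 : Continuous fun x => magSq (κ * H) A ψ x - κ ^ 2 * ‖ψ x‖ ^ 2 := m.sub (by fun_prop)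
  have m2 : Continuous fun x => magSq (κ * H) A ψ x - κ ^ 2 * ‖ψ x‖ ^ 2
      + κ ^ 2 / 2 * ‖ψ x‖ ^ 4 := m1.add (by fun_prop)
  rw [GLenergy, ← integral_const_mul, ← integral_const_mul, ← integral_const_mul,
    ← integral_sub (integrableOn_unitDisc m) (integrableOn_unitDisc (by fun_prop)),
    ← integral_add (integrableOn_unitDisc m1) (integrableOn_unitDisc (by fun_prop)),
    ← integral_add (integrableOn_unitDisc m2) (integrableOn_unitDisc (by fun_prop))]
  simp only [mul_pow]

theorem GLenergy_congr {κ H : ℝ} {ψ ψ' : Plane → ℂ} {A A' : Plane → Plane}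
    (hψ : EqOn ψ ψ' unitDisc) (hA : EqOn A A' unitDisc) :
    GLenergy unitDisc κ H ψ A = GLenergy unitDisc κ H ψ' A' := by
  refine setIntegral_congr_fun measurableSet_unitDisc fun x hx => ?_
  have e1 : ψ =ᶠ[𝓝 x] ψ' := hψ.eventuallyEq_of_mem (isOpen_unitDisc.mem_nhds hx)
  have e2 : A =ᶠ[𝓝 x] A' := hA.eventuallyEq_of_mem (isOpen_unitDisc.mem_nhds hx)
  have e3 : (fun y => (A y).1) =ᶠ[𝓝 x] fun y => (A' y).1 := e2.fun_comp Prod.fst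
  have e4 : (fun y => (A y).2) =ᶠ[𝓝 x] fun y => (A' y).2 := e2.fun_comp Prod.snd
  simp only [magSq, curl2, e1.fderiv_eq, e3.fderiv_eq, e4.fderiv_eq, hψ hx, hA hx]

theorem normalUnique_of_contDiff {κ H : ℝ}
    (h : ∀ (ψ : Plane → ℂ) (A : Plane → Plane), ContDiff ℝ 1 ψ → ContDiff ℝ 1 A →
      0 < ∫ x in unitDisc, ‖ψ x‖ ^ 2 → 0 < GLenergy unitDisc κ H ψ A) :
    NormalUnique unitDisc κ H := by
  have key : ∀ ψ A, GLadm unitDisc ψ A → ∃ ψ' A', ContDiff ℝ 1 ψ' ∧ ContDiff ℝ 1 A' ∧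
      GLenergy unitDisc κ H ψ A = GLenergy unitDisc κ H ψ' A' ∧
      ∫ x in unitDisc, ‖ψ x‖ ^ 2 = ∫ x in unitDisc, ‖ψ' x‖ ^ 2 := by
    rintro ψ A ⟨hψ, hA⟩
    obtain ⟨ψ', d1, e1⟩ := hψ.exists_contDiff
    obtain ⟨A', d2, e2⟩ := hA.exists_contDiff
    exact ⟨ψ', A', by exact_mod_cast d1, by exact_mod_cast d2, GLenergy_congr e1 e2,
      setIntegral_congr_fun measurableSet_unitDisc fun x hx => by simp only [e1 hx]⟩
  have pos : ∀ ψ A, GLadm unitDisc ψ A → (∫ x in unitDisc, ‖ψ x‖ ^ 2) ≠ 0 →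
      0 < GLenergy unitDisc κ H ψ A := by
    intro ψ A hadm hne
    obtain ⟨ψ', A', d1, d2, e, eN⟩ := key ψ A hadm
    rw [e]
    exact h ψ' A' d1 d2 (eN ▸ lt_of_le_of_ne (integral_nonneg fun x => sq_nonneg _) hne.symm)
  refine ⟨fun ψ A hadm => ?_, pos⟩
  by_cases hN : ∫ x in unitDisc, ‖ψ x‖ ^ 2 = 0
  · obtain ⟨ψ', A', d1, d2, e, eN⟩ := key ψ A hadm
    rw [e, GLenergy_eq d1 d2, ← eN, hN]
    have i1 : 0 ≤ ∫ x in unitDisc, magSq (κ * H) A' ψ' x := integral_nonneg fun x => magSq_nonneg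
    have i2 : 0 ≤ ∫ x in unitDisc, ‖ψ' x‖ ^ 4 := integral_nonneg fun x => by positivity
    have i3 : 0 ≤ ∫ x in unitDisc, (curl2 A' x - 1) ^ 2 := integral_nonneg fun x => by positivity
    have : 0 ≤ κ ^ 2 / 2 * ∫ x in unitDisc, ‖ψ' x‖ ^ 4 := by positivity
    have : 0 ≤ (κ * H) ^ 2 * ∫ x in unitDisc, (curl2 A' x - 1) ^ 2 := by positivity
    linarith
  · exact (pos ψ A hadm hN).le

theorem le_of_cubic {l M κ N F S Z : ℝ} (hl : 0 ≤ l) (hM : 0 < M)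
    (hlM : l * (32 * M + 8192 * M ^ 2) ≤ 1)
    (hκ : 1 ≤ κ) (hN : 0 < N) (hNF : N ^ 2 ≤ M / κ * F) (hS0 : 0 ≤ S) (hS : S ≤ l / 2 * F)
    (hZ : Z ^ 3 ≤ Z * S + 16 * (2 * κ ^ 2 * N) * S) : Z ≤ F / (8 * N) := by
  rw [le_div_iff₀ (by positivity)]
  by_contra! hcon
  have hκ0 : 0 < κ := by linarith
  have hF : 0 < F := by
    by_contra! hF
    have : M / κ * F ≤ 0 := mul_nonpos_of_nonneg_of_nonpos (by positivity) hF
    nlinarith [pow_pos hN 2]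
  obtain ⟨X, hX⟩ : ∃ X, X = Z * N := ⟨_, rfl⟩
  have hX0 : F < 8 * X := by rw [hX]; linarith
  have hNF' : κ * N ^ 2 ≤ M * F := by
    have := mul_le_mul_of_nonneg_left hNF hκ0.le
    rwa [show κ * (M / κ * F) = M * F by field_simp] at this
  have a1 : N ^ 2 ≤ M * F := by nlinarith [sq_nonneg N]
  have a2 : (κ * N ^ 2) ^ 2 ≤ (M * F) ^ 2 := pow_le_pow_left₀ (by positivity) hNF' 2
  have b1 : N ^ 2 * S ≤ M * F * (l / 2 * F) := mul_le_mul a1 hS hS0 (by positivity)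
  have b2 : (κ * N ^ 2) ^ 2 * S ≤ (M * F) ^ 2 * (l / 2 * F) := mul_le_mul a2 hS hS0 (by positivity)
  have X0 : 0 < X := by linarith
  have c1 : X ^ 3 ≤ X * (M * F * (l / 2 * F)) + 32 * ((M * F) ^ 2 * (l / 2 * F)) := by
    have := mul_le_mul_of_nonneg_right hZ (pow_pos hN 3).le
    have e1 : Z ^ 3 * N ^ 3 = X ^ 3 := by rw [hX]; ring
    have e2 : (Z * S + 16 * (2 * κ ^ 2 * N) * S) * N ^ 3
        = X * (N ^ 2 * S) + 32 * ((κ * N ^ 2) ^ 2 * S) := by rw [hX]; ring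
    rw [e1, e2] at this
    have := mul_le_mul_of_nonneg_left b1 X0.le
    linarith
  have f2 : F ^ 2 < (8 * X) ^ 2 := pow_lt_pow_left₀ hX0 hF.le two_ne_zero
  have f3 : F ^ 3 < (8 * X) ^ 3 := pow_lt_pow_left₀ hX0 hF.le three_ne_zero
  rcases hl.eq_or_lt with h0 | h0
  · rw [← h0] at c1
    have := pow_pos X0 3
    simp at c1
    linarith
  have g2 : X * (M * F * (l / 2 * F)) < X * (M * (l / 2)) * (8 * X) ^ 2 := by
    have := mul_lt_mul_of_pos_left f2 (show 0 < X * (M * (l / 2)) by positivity)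
    linarith
  have g3 : 32 * ((M * F) ^ 2 * (l / 2 * F)) < 32 * (M ^ 2 * (l / 2)) * (8 * X) ^ 3 := by
    have := mul_lt_mul_of_pos_left f3 (show 0 < 32 * (M ^ 2 * (l / 2)) by positivity)
    linarith
  have g4 := mul_le_mul_of_nonneg_right hlM (pow_pos X0 3).le
  linarith

theorem le_of_crude_split {T κ N F q b B N₁ q₂ : ℝ} (hT : 0 < T) (hT1 : T < 1) (hN : 0 < N)
    (hκ : 6 ≤ κ * (1 - T)) (hN₁ : 0 ≤ N₁) (hB : κ ^ 2 / T ≤ B) (hq : 0 ≤ q) (hb : 0 ≤ b)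
    (hq₂ : 0 ≤ q₂) (hF : F ≤ 2 * N) (hqb : q + b ≤ κ ^ 2 * N)
    (h : B * N₁ - κ⁻¹ / 2 * b - κ / 2 * F + q₂ ≤ q + (1 - T) / 4 * κ ^ 2 * N) :
    N₁ ≤ (1 - (1 - T) / 2) * N := by
  have hT' : 0 < 1 - T := by linarith
  have κ0 : 0 < κ := by
    by_contra! hcon
    have := mul_nonpos_of_nonpos_of_nonneg hcon hT'.le
    linarith
  have h1 : κ⁻¹ / 2 * b ≤ κ / 2 * N := by
    calc κ⁻¹ / 2 * b ≤ κ⁻¹ / 2 * (κ ^ 2 * N) := by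
          apply mul_le_mul_of_nonneg_left _ (by positivity); linarith
      _ = _ := by field_simp
  have h2 : κ ^ 2 / T * N₁ ≤ B * N₁ := mul_le_mul_of_nonneg_right hB hN₁
  have hF' : κ / 2 * F ≤ κ / 2 * (2 * N) := mul_le_mul_of_nonneg_left hF (by positivity)
  have h3 : κ ^ 2 / T * N₁ ≤ (κ ^ 2 + (1 - T) / 4 * κ ^ 2 + κ / 2 + κ) * N := by linarith
  have h5 : κ ^ 2 * N₁ ≤ T * ((κ ^ 2 + (1 - T) / 4 * κ ^ 2 + κ / 2 + κ) * N) := by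
    have := mul_le_mul_of_nonneg_left h3 hT.le
    rwa [show T * (κ ^ 2 / T * N₁) = κ ^ 2 * N₁ by field_simp] at this
  have t1 : T * (1 - T) * κ ^ 2 ≤ (1 - T) * κ ^ 2 :=
    mul_le_mul_of_nonneg_right (mul_le_of_le_one_left hT'.le hT1.le) (sq_nonneg _)
  have t2 : T * (3 / 2 * κ) ≤ 3 / 2 * κ := mul_le_of_le_one_left (by positivity) hT1.le
  have t3 : 6 * κ ≤ κ * (1 - T) * κ := mul_le_mul_of_nonneg_right hκ κ0.le
  have t4 : T * (κ ^ 2 + (1 - T) / 4 * κ ^ 2 + κ / 2 + κ) ≤ κ ^ 2 * (1 - (1 - T) / 2) := by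
    linarith
  have t5 := mul_le_mul_of_nonneg_right t4 hN.le
  refine le_of_mul_le_mul_left (a := κ ^ 2) ?_ (by positivity)
  linarith

set_option maxHeartbeats 1000000 in
/-- If the linear problem on the disc is stable with a sufficient margin, the normal state is the
unique minimizer of the nonlinear functional. -/
theorem exists_normalUnique {T : ℝ} (hT : 0 < T) (hT1 : T < 1) :
    ∃ c κ₀, 0 < c ∧ 0 < κ₀ ∧ ∀ κ H, κ₀ ≤ κ → κ ^ 2 / T ≤ κ * H →
      (∀ w : Plane → ℂ, ContDiff ℝ 1 w → (κ ^ 2 + c) * ∫ x in unitDisc, ‖w x‖ ^ 2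
        ≤ ∫ x in unitDisc, magSq (κ * H) F0 w x) → NormalUnique unitDisc κ H := by
  obtain ⟨K, hK, hsplit⟩ := exists_layer_splitting
  have hT' : 0 < 1 - T := by linarith
  obtain ⟨L, hL⟩ : ∃ L, L = Real.sqrt (4 * K / (1 - T)) := ⟨_, rfl⟩
  have L0 : 0 < L := hL ▸ Real.sqrt_pos.2 (by positivity)
  have L2 : L ^ 2 = 4 * K / (1 - T) := hL ▸ Real.sq_sqrt (by positivity)
  obtain ⟨θ, hθ⟩ : ∃ θ, θ = (1 - T) / 2 := ⟨_, rfl⟩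
  have θ0 : 0 < θ := by rw [hθ]; linarith
  obtain ⟨M, hM⟩ : ∃ M, M = Real.pi * L / θ ^ 2 := ⟨_, rfl⟩
  have M0 : 0 < M := by have := Real.pi_pos; rw [hM]; positivity
  obtain ⟨l, hl⟩ : ∃ l, l = 1 / (1 + (32 * M + 8192 * M ^ 2)) := ⟨_, rfl⟩
  have l0 : 0 < l := by rw [hl]; positivity
  have l1 : l ≤ 1 := by
    rw [hl, div_le_one (by positivity)]; nlinarith [sq_nonneg M]
  have lM : l * (32 * M + 8192 * M ^ 2) ≤ 1 := by
    rw [hl, div_mul_eq_mul_div, one_mul, div_le_one (by positivity)]; linarith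
  obtain ⟨c, hc⟩ : ∃ c, c = K / l ^ 2 + 1 := ⟨_, rfl⟩
  have c0 : 0 < c := by rw [hc]; positivity
  refine ⟨c, 2 + L + 6 / (1 - T) + c + c * T / (1 - T), c0, by positivity,
    fun κ H hκ hB hlin => ?_⟩
  have k1 : 0 < 6 / (1 - T) := by positivity
  have k2 : 0 < c * T / (1 - T) := by positivity
  have κ2 : 2 ≤ κ := by linarith
  have κ0 : 0 < κ := by linarith
  have κL : L ≤ κ := by linarith
  have κ6 : 6 ≤ κ * (1 - T) := by
    rw [← div_le_iff₀ hT']; linarith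
  have κκ : κ ≤ κ ^ 2 := by nlinarith
  have κc : c ≤ κ ^ 2 := by linarith
  have κcT : κ ^ 2 + c ≤ κ ^ 2 / T := by
    rw [le_div_iff₀ hT]
    have : c * T ≤ κ * (1 - T) := by rw [← div_le_iff₀ hT']; linarith
    nlinarith
  refine normalUnique_of_contDiff fun ψ A hψ hA hN => ?_
  by_contra! hE
  rw [GLenergy_eq hψ hA] at hE
  obtain ⟨B, hBe⟩ : ∃ B, B = κ * H := ⟨_, rfl⟩
  rw [← hBe] at hE hB hlin
  have i1 : 0 ≤ ∫ x in unitDisc, magSq B A ψ x := integral_nonneg fun x => magSq_nonneg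
  have i2 : 0 ≤ ∫ x in unitDisc, ‖ψ x‖ ^ 4 := integral_nonneg fun x => by positivity
  have i3 : 0 ≤ B ^ 2 * ∫ x in unitDisc, (curl2 A x - 1) ^ 2 :=
    mul_nonneg (sq_nonneg _) (integral_nonneg fun x => by positivity)
  have sp := fun l hl => hsplit l hl B A ψ hA hψ
  obtain ⟨N, eN⟩ : ∃ N, N = ∫ x in unitDisc, ‖ψ x‖ ^ 2 := ⟨_, rfl⟩
  obtain ⟨F, eF⟩ : ∃ F, F = ∫ x in unitDisc, ‖ψ x‖ ^ 4 := ⟨_, rfl⟩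
  obtain ⟨q, eq⟩ : ∃ q, q = ∫ x in unitDisc, magSq B A ψ x := ⟨_, rfl⟩
  obtain ⟨b, eb⟩ : ∃ b, b = B ^ 2 * ∫ x in unitDisc, (curl2 A x - 1) ^ 2 := ⟨_, rfl⟩
  rw [← eN, ← eF, ← eq, ← eb] at hE
  rw [← eN] at hN
  rw [← eq] at i1
  rw [← eF] at i2
  rw [← eb] at i3
  simp only [← eN, ← eF, ← eq, ← eb] at sp
  have κsq : 0 < κ ^ 2 := by positivity
  have hF2 : F ≤ 2 * N := le_of_mul_le_mul_left (a := κ ^ 2) (by linarith) κsq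
  have hqb : q + b ≤ κ ^ 2 * N := by
    have : 0 ≤ κ ^ 2 / 2 * F := by positivity
    linarith
  have hNF : N ^ 2 ≤ M / κ * F := by
    obtain ⟨N₁, ψ₂, hN₁, hψ₂, hsupp, hsum, h4, hen⟩ := sp (L / κ) (by positivity)
    have i4 : 0 ≤ ∫ x in unitDisc, magSq B A ψ₂ x := integral_nonneg fun x => magSq_nonneg
    obtain ⟨Z, S, -, -, -, -, hS, hNS, -⟩ := exists_angular_sup (B := B) (l := L / κ)
      (Q := (∫ x in unitDisc, magSq B A ψ₂ x) + 1) (by positivity) ((div_le_one κ0).2 κL)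
      (by linarith) hA hψ₂ hsupp (by linarith)
    have e1 : K / (L / κ) ^ 2 = (1 - T) / 4 * κ ^ 2 := by
      rw [div_pow, L2]
      field_simp
    have h4' : N₁ ≤ (1 - θ) * N := by
      rw [hθ]
      exact le_of_crude_split hT hT1 hN κ6 hN₁ hB i1 i3 i4 hF2 hqb
        (by simpa only [e1, inv_inv] using hen κ⁻¹ (inv_pos.2 κ0))
    have h7 : θ * N ≤ ∫ x in unitDisc, ‖ψ₂ x‖ ^ 2 := by linarith
    have h8 : (θ * N) ^ 2 ≤ (∫ x in unitDisc, ‖ψ₂ x‖ ^ 2) ^ 2 :=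
      pow_le_pow_left₀ (by positivity) h7 2
    have h9 : S ≤ L / κ / 2 * F := hS.trans (mul_le_mul_of_nonneg_left h4 (by positivity))
    have h10 : θ ^ 2 * N ^ 2 ≤ Real.pi * (L / κ) * F := by
      have := mul_le_mul_of_nonneg_left h9 (show 0 ≤ 2 * Real.pi by have := Real.pi_pos; positivity)
      linarith
    calc N ^ 2 = (θ ^ 2 * N ^ 2) / θ ^ 2 := by field_simp
      _ ≤ (Real.pi * (L / κ) * F) / θ ^ 2 := by gcongr
      _ = _ := by rw [hM]; ring
  obtain ⟨N₁, ψ₂, hN₁, hψ₂, hsupp, hsum, h4, hen⟩ := sp l l0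
  have h := hen 1 one_pos
  have hKc : K / l ^ 2 = c - 1 := by rw [hc]; ring
  rw [hKc, inv_one] at h
  have hBl : κ ^ 2 + c ≤ B := κcT.trans hB
  have B0 : 0 ≤ B := by linarith
  have hq2 : ∫ x in unitDisc, magSq B A ψ₂ x ≤ 2 * κ ^ 2 * N := by
    have := mul_nonneg B0 hN₁
    have := mul_le_mul_of_nonneg_right κc hN.le
    linarith
  obtain ⟨Z, S, hZ0, hS0, hPZ, -, hS, -, hcub⟩ := exists_angular_sup l0.le l1
    (by positivity) hA hψ₂ hsupp hq2
  have hS' : S ≤ l / 2 * F := hS.trans (mul_le_mul_of_nonneg_left h4 (by positivity))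
  have hZ := le_of_cubic l0.le M0 lM (by linarith) hN hNF hS0 hS' hcub
  have F0' : 0 < F := by
    by_contra! hF
    have : M / κ * F ≤ 0 := mul_nonpos_of_nonneg_of_nonpos (by positivity) hF
    nlinarith [pow_pos hN 2]
  have lower := magSq_lower_bound (B := B) (Z := F / (8 * N)) (by positivity)
    (by rw [div_le_one (by positivity)]; linarith) hA hψ₂
    (fun θ hθ => (hPZ θ hθ).trans hZ) hlin
  rw [← eb] at lower
  have n2 : 0 ≤ ∫ x in unitDisc, ‖ψ₂ x‖ ^ 2 := integral_nonneg fun x => by positivity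
  obtain ⟨N₂, eN₂⟩ : ∃ N₂, N₂ = ∫ x in unitDisc, ‖ψ₂ x‖ ^ 2 := ⟨_, rfl⟩
  rw [← eN₂] at lower hsum n2
  have r1 : F / (8 * N) * ((κ ^ 2 + c) * N₂) ≤ κ ^ 2 * F / 4 := by
    calc F / (8 * N) * ((κ ^ 2 + c) * N₂) ≤ F / (8 * N) * ((2 * κ ^ 2) * N) := by
          have : N₂ ≤ N := by linarith
          have : κ ^ 2 + c ≤ 2 * κ ^ 2 := by linarith
          gcongr
      _ = _ := by field_simp; ring
  have r2 : (κ ^ 2 + c) * N₁ ≤ B * N₁ := mul_le_mul_of_nonneg_right hBl hN₁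
  have r3 : (κ ^ 2 + c) * N = (κ ^ 2 + c) * N₁ + (κ ^ 2 + c) * N₂ := by rw [← hsum]; ring
  have r4 : F / 2 ≤ κ ^ 2 * F / 4 := by
    have := mul_le_mul_of_nonneg_right (κ2.trans κκ) i2
    linarith
  linarith

theorem ContDiff.gladm {ψ : Plane → ℂ} {A : Plane → Plane} (hψ : ContDiff ℝ 1 ψ)
    (hA : ContDiff ℝ 1 A) : GLadm unitDisc ψ A :=
  ⟨⟨univ, isOpen_univ, subset_univ _, by exact_mod_cast hψ.contDiffOn⟩,
    ⟨univ, isOpen_univ, subset_univ _, by exact_mod_cast hA.contDiffOn⟩⟩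

theorem magSq_const_mul {B t : ℝ} {A : Plane → Plane} {u : Plane → ℂ} (hu : ContDiff ℝ 1 u)
    (x : Plane) : magSq B A (fun y => (t : ℂ) * u y) x = t ^ 2 * magSq B A u x := by
  have e : ∀ v, fderiv ℝ (fun y => (t : ℂ) * u y) x v = t * fderiv ℝ u x v := fun v => by
    rw [fderiv_const_mul (hu.differentiable one_ne_zero x)]
    simp
  have n : ∀ a b c : ℂ, ‖a * (t * b) - c * (t * u x)‖ ^ 2 = t ^ 2 * ‖a * b - c * u x‖ ^ 2 :=
    fun a b c => by
    rw [show a * (t * b) - c * (t * u x) = t * (a * b - c * u x) by ring, norm_mul,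
      Complex.norm_real, mul_pow, Real.norm_eq_abs, sq_abs]
  simp only [magSq, e, n]
  ring

/-- A trial function violating the linear stability bound destabilizes the normal state. -/
theorem not_normalMin {κ H : ℝ} {w : Plane → ℂ} (hw : ContDiff ℝ 1 w)
    (h : ∫ x in unitDisc, magSq (κ * H) F0 w x < κ ^ 2 * ∫ x in unitDisc, ‖w x‖ ^ 2) :
    ¬ NormalMin unitDisc κ H := by
  intro hmin
  obtain ⟨d, hd⟩ : ∃ d, d = (κ ^ 2 * ∫ x in unitDisc, ‖w x‖ ^ 2)
    - ∫ x in unitDisc, magSq (κ * H) F0 w x := ⟨_, rfl⟩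
  have hd0 : 0 < d := by linarith
  obtain ⟨F, hF⟩ : ∃ F, F = ∫ x in unitDisc, ‖w x‖ ^ 4 := ⟨_, rfl⟩
  have hF0 : 0 ≤ F := hF ▸ integral_nonneg fun x => by positivity
  obtain ⟨t, ht⟩ : ∃ t, t = Real.sqrt (d / (κ ^ 2 / 2 * F + 1)) := ⟨_, rfl⟩
  have hden : 0 < κ ^ 2 / 2 * F + 1 := by positivity
  have t0 : 0 < t := ht ▸ Real.sqrt_pos.2 (by positivity)
  have t2 : t ^ 2 * (κ ^ 2 / 2 * F + 1) = d := by
    rw [ht, Real.sq_sqrt (by positivity)]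
    field_simp
  have hd1 : ContDiff ℝ 1 fun x => (t : ℂ) * w x := contDiff_const.mul hw
  have hE := hmin _ _ (ContDiff.gladm hd1 contDiff_F0)
  have n : ∀ x, ‖(t : ℂ) * w x‖ = t * ‖w x‖ := fun x => by
    rw [norm_mul, Complex.norm_real, Real.norm_of_nonneg t0.le]
  rw [GLenergy_eq hd1 contDiff_F0] at hE
  simp only [magSq_const_mul hw, n, mul_pow, curl2_F0, integral_const_mul, ← hF] at hE
  have hneg : 0 < t ^ 2 * t ^ 2 := by positivity
  have : t ^ 2 * (d - t ^ 2 * (κ ^ 2 / 2 * F)) = t ^ 2 * t ^ 2 := by rw [← t2]; ring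
  rw [hd] at this
  norm_num at hE
  linarith

theorem not_normalMin_of_le_one {κ H : ℝ} (hκ : 0 < κ) (hH : 0 < H) (hH1 : H ≤ 1) :
    ¬ NormalMin unitDisc κ H := by
  have hw : ContDiff ℝ 1 fun _ : Plane => (1 : ℂ) := contDiff_const
  refine not_normalMin hw ?_
  have vol : 0 < ∫ _ in unitDisc, ‖(1 : ℂ)‖ ^ 2 := by
    have h0 : (0 : Plane) ∈ unitDisc := by simp [unitDisc]
    have hv : 0 < volume.real unitDisc := by
      refine ENNReal.toReal_pos (isOpen_unitDisc.measure_pos _ ⟨0, h0⟩).ne' ?_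
      exact ((measure_mono unitDisc_subset).trans_lt
        (isCompact_Icc.prod isCompact_Icc).measure_lt_top).ne
    simpa using hv
  have le : ∫ x in unitDisc, magSq (κ * H) F0 (fun _ => (1 : ℂ)) x
      ≤ κ ^ 2 / 4 * ∫ _ in unitDisc, ‖(1 : ℂ)‖ ^ 2 := by
    rw [← integral_const_mul]
    refine setIntegral_mono_on (integrableOn_unitDisc (continuous_magSq contDiff_F0.continuous hw))
      (integrableOn_unitDisc (by fun_prop)) measurableSet_unitDisc fun x hx => ?_
    have hx' : x.1 ^ 2 + x.2 ^ 2 < 1 := hx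
    have e : magSq (κ * H) F0 (fun _ => (1 : ℂ)) x
        = κ ^ 2 / 4 * (H ^ 2 * (x.1 ^ 2 + x.2 ^ 2)) := by
      simp only [magSq, F0, fderiv_fun_const, Pi.zero_apply, zero_apply, mul_zero, zero_sub, mul_one,
        norm_neg, Complex.norm_real, Real.norm_eq_abs, sq_abs]
      ring
    rw [e, norm_one, one_pow, mul_one]
    have hH2 : H ^ 2 ≤ 1 := pow_le_one₀ hH.le hH1
    refine mul_le_of_le_one_right (by positivity) (mul_le_one₀ hH2 (by positivity) hx'.le)
  have := mul_pos (show 0 < κ ^ 2 by positivity) vol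
  linarith

theorem margin_of_field_ge {a D κ y : ℝ} (ha : 0 ≤ a) (hD : 0 ≤ D) (hκ : 1 ≤ κ) (hy : 0 ≤ y)
    (h : κ ^ 2 + a * κ + (a ^ 2 / 2 + D + a * (D + a ^ 2) + (D + a ^ 2) ^ 2) ≤ y ^ 2) :
    κ ^ 2 + D ≤ y ^ 2 - a * y := by
  obtain ⟨e, he⟩ : ∃ e, e = (D + a ^ 2 / 4) / 2 := ⟨_, rfl⟩
  have e0 : 0 ≤ e := by rw [he]; positivity
  have ee : e ≤ D + a ^ 2 := by rw [he]; nlinarith [sq_nonneg a]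
  obtain ⟨p, hp⟩ : ∃ p, p = e / κ := ⟨_, rfl⟩
  have hκ0 : 0 < κ := by linarith
  have hpκ : p * κ = e := by rw [hp]; field_simp
  have p0 : 0 ≤ p := by rw [hp]; positivity
  have pe : p ≤ e := by rw [hp]; exact div_le_self e0 hκ
  have h1 : κ + a / 2 + p ≤ y := by
    refine le_of_sq_le_sq ?_ hy
    have : (κ + a / 2 + p) ^ 2 = κ ^ 2 + a * κ + a ^ 2 / 4 + 2 * (p * κ) + a * p + p ^ 2 := by ring
    rw [this, hpκ]
    have := mul_le_mul_of_nonneg_left (pe.trans ee) ha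
    have := pow_le_pow_left₀ p0 (pe.trans ee) 2
    linarith
  have h2 : (κ + p) ^ 2 ≤ (y - a / 2) ^ 2 := pow_le_pow_left₀ (by positivity) (by linarith) 2
  have h3 : (κ + p) ^ 2 = κ ^ 2 + 2 * (p * κ) + p ^ 2 := by ring
  rw [h3, hpκ] at h2
  have := sq_nonneg p
  linarith

theorem deficit_of_field_le {a D κ y : ℝ} (ha : 0 ≤ a) (hD : 0 ≤ D) (hκ : D + 1 ≤ κ) (hy : 0 ≤ y)
    (h : y ^ 2 ≤ κ ^ 2 + a * κ - (2 + a) * (D + 1)) : y ^ 2 - a * y + D < κ ^ 2 := by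
  obtain ⟨p, hp⟩ : ∃ p, p = (D + 1) / κ := ⟨_, rfl⟩
  have hκ0 : 0 < κ := by linarith
  have hpκ : p * κ = D + 1 := by rw [hp]; field_simp
  have p0 : 0 ≤ p := by rw [hp]; positivity
  have p1 : p ≤ 1 := by rw [hp]; exact (div_le_one hκ0).2 hκ
  have h1 : y ≤ κ + a / 2 - p := by
    refine le_of_sq_le_sq ?_ (by linarith)
    have : (κ + a / 2 - p) ^ 2 = κ ^ 2 + a * κ + a ^ 2 / 4 - 2 * (p * κ) - a * p + p ^ 2 := by ring
    rw [this, hpκ]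
    have := mul_le_mul_of_nonneg_left p1 ha
    have := mul_nonneg ha hD
    nlinarith [sq_nonneg a, sq_nonneg p]
  rcases le_total (a / 2) y with h2 | h2
  · have h3 : (y - a / 2) ^ 2 ≤ (κ - p) ^ 2 := pow_le_pow_left₀ (by linarith) (by linarith) 2
    have h4 : (κ - p) ^ 2 = κ ^ 2 - 2 * (p * κ) + p ^ 2 := by ring
    rw [h4, hpκ] at h3
    have := pow_le_one₀ p0 p1 (n := 2)
    have := sq_nonneg a
    nlinarith
  · have : y * y ≤ a * y := mul_le_mul_of_nonneg_right (by linarith) hy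
    nlinarith

theorem DeGennes.C1_pos (D : DeGennes) : 0 < D.C1 := by
  have := D.u₀_pos 0 le_rfl
  rw [DeGennes.C1]
  positivity

theorem DeGennes.Theta0_rpow (D : DeGennes) : Theta0 ^ (-(3 : ℝ) / 2) = ((-D.ξ₀) ^ 3)⁻¹ := by
  have h0 : 0 ≤ -D.ξ₀ := by linarith [D.ξ₀_mem.2]
  rw [← D.ξ₀_sq, ← neg_sq, ← Real.rpow_natCast (-D.ξ₀) 2, ← Real.rpow_mul h0,
    show ((2 : ℕ) : ℝ) * (-(3 : ℝ) / 2) = -((3 : ℕ) : ℝ) by norm_num, Real.rpow_neg h0,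
    Real.rpow_natCast]

/-- The scaled field strength at distance `k / κ` from the two-term approximation of the critical
field. -/
theorem DeGennes.scaled_field (D : DeGennes) {κ : ℝ} (hκ : 0 < κ) (k : ℝ) :
    Theta0 * (κ * (κ / Theta0 + D.C1 * Theta0 ^ (-(3 : ℝ) / 2) + k / Theta0 * κ⁻¹))
      = κ ^ 2 + D.C1 / (-D.ξ₀) * κ + k := by
  have h0 : 0 < -D.ξ₀ := by linarith [D.ξ₀_mem.2]
  rw [D.Theta0_rpow, ← D.ξ₀_sq, ← neg_sq]
  generalize -D.ξ₀ = s at h0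
  field_simp

theorem DeGennes.exists_stable (D : DeGennes) : ∃ K κ₀, 0 < K ∧ 0 < κ₀ ∧ ∀ κ H, κ₀ ≤ κ →
    κ / Theta0 + D.C1 * Theta0 ^ (-(3 : ℝ) / 2) + K * κ⁻¹ ≤ H → NormalUnique unitDisc κ H := by
  have T0 : 0 < Theta0 := by linarith [D.theta_lb]
  have C0 := D.C1_pos
  have s0 : 0 < -D.ξ₀ := by linarith [D.ξ₀_mem.2]
  obtain ⟨v, P⟩ := D.isProfile
  obtain ⟨ρ, ρ₁, S, -⟩ := P.exists_slope
  obtain ⟨E, q₀, hE, hq₀, hbar⟩ := S.exists_radialBarrier (by positivity)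
  obtain ⟨c, κ₁, hc, hκ₁, hmain⟩ := exists_normalUnique T0 D.theta_ub
  obtain ⟨a, ha⟩ : ∃ a, a = D.C1 / (-D.ξ₀) := ⟨_, rfl⟩
  have a0 : 0 < a := by rw [ha]; positivity
  obtain ⟨k, hk⟩ : ∃ k, k = a ^ 2 / 2 + (c + E) + a * ((c + E) + a ^ 2)
    + ((c + E) + a ^ 2) ^ 2 := ⟨_, rfl⟩
  have k0 : 0 < k := by rw [hk]; positivity
  refine ⟨k / Theta0, 1 + q₀ + κ₁, by positivity, by positivity, fun κ H hκ hH => ?_⟩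
  have hκ0 : 0 < κ := by linarith
  have hB : κ ^ 2 + a * κ + k ≤ Theta0 * (κ * H) := by
    rw [ha, ← D.scaled_field hκ0]
    gcongr
  have ak : 0 < a * κ := by positivity
  have hB1 : κ ^ 2 / Theta0 ≤ κ * H := by
    rw [div_le_iff₀ T0]
    linarith
  have hB2 : κ ^ 2 ≤ κ * H :=
    (le_div_self (sq_nonneg κ) T0 D.theta_ub.le).trans hB1
  have hB0 : 0 ≤ κ * H := (sq_nonneg κ).trans hB2
  obtain ⟨q, hq⟩ : ∃ q, q = Real.sqrt (κ * H) := ⟨_, rfl⟩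
  have q2 : q ^ 2 = κ * H := hq ▸ Real.sq_sqrt hB0
  have hκq : κ ≤ q := hq ▸ Real.le_sqrt_of_sq_le hB2
  have y2 : (-D.ξ₀ * q) ^ 2 = Theta0 * (κ * H) := by rw [← q2, ← D.ξ₀_sq]; ring
  have ay : a * (-D.ξ₀ * q) = D.C1 * q := by
    rw [ha, ← mul_assoc, div_mul_cancel₀ _ s0.ne']
  have hmargin := margin_of_field_ge (a := a) (D := c + E) (κ := κ) (y := -D.ξ₀ * q) a0.le
    (by positivity) (by linarith) (mul_nonneg s0.le (by linarith)) (by rw [y2]; linarith)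
  rw [y2, ay, ← q2] at hmargin
  refine hmain κ H (by linarith) hB1 fun w hw => ?_
  have hlow := disc_lower_bound (sq_nonneg q) (lam := D.ξ₀ ^ 2 * q ^ 2 - D.u₀ 0 ^ 2 / 3 * q - E)
    ?_ (fun n hn => hbar q n (by linarith) hn) hw
  · rw [q2] at hlow
    refine le_trans (mul_le_mul_of_nonneg_right ?_ (integral_nonneg fun x => sq_nonneg _)) hlow
    rw [D.ξ₀_sq, ← q2]
    change _ ≤ _ - D.C1 * q - E
    linarith
  · have h1 : D.ξ₀ ^ 2 * q ^ 2 ≤ q ^ 2 :=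
      mul_le_of_le_one_left (sq_nonneg q) (D.ξ₀_sq ▸ D.theta_ub.le)
    have h2 : 0 ≤ D.u₀ 0 ^ 2 / 3 * q := mul_nonneg (by positivity) (by linarith)
    linarith

theorem DeGennes.exists_unstable (D : DeGennes) : ∃ K κ₀, 0 < K ∧ 0 < κ₀ ∧ ∀ κ H, κ₀ ≤ κ → 0 < H →
    H ≤ κ / Theta0 + D.C1 * Theta0 ^ (-(3 : ℝ) / 2) - K * κ⁻¹ → ¬ NormalMin unitDisc κ H := by
  have T0 : 0 < Theta0 := by linarith [D.theta_lb]
  have C0 := D.C1_pos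
  have s0 : 0 < -D.ξ₀ := by linarith [D.ξ₀_mem.2]
  obtain ⟨v, P⟩ := D.isProfile
  obtain ⟨E, q₀, hE, hq₀, htrial⟩ := P.exists_trial
  obtain ⟨a, ha⟩ : ∃ a, a = D.C1 / (-D.ξ₀) := ⟨_, rfl⟩
  have a0 : 0 < a := by rw [ha]; positivity
  refine ⟨(2 + a) * (E + 1) / Theta0, E + 1 + q₀ ^ 2, by positivity, by positivity,
    fun κ H hκ hH0 hH => ?_⟩
  have hq₀κ : q₀ ^ 2 ≤ κ := by linarith
  have hEκ : E + 1 ≤ κ := by nlinarith [sq_nonneg q₀]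
  have hκ0 : 0 < κ := by linarith
  rcases le_total H 1 with hH1 | hH1
  · exact not_normalMin_of_le_one hκ0 hH0 hH1
  have hB : Theta0 * (κ * H) ≤ κ ^ 2 + a * κ - (2 + a) * (E + 1) := by
    rw [ha, sub_eq_add_neg (_ + _), ← D.scaled_field hκ0, ← ha]
    gcongr
    rw [neg_div Theta0]
    linarith
  have hκB : κ ≤ κ * H := le_mul_of_one_le_right hκ0.le hH1
  obtain ⟨q, hq⟩ : ∃ q, q = Real.sqrt (κ * H) := ⟨_, rfl⟩
  have q2 : q ^ 2 = κ * H := hq ▸ Real.sq_sqrt (by positivity)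
  have hqq : q₀ ≤ q := hq ▸ Real.le_sqrt_of_sq_le (hq₀κ.trans hκB)
  have y2 : (-D.ξ₀ * q) ^ 2 = Theta0 * (κ * H) := by rw [← q2, ← D.ξ₀_sq]; ring
  have ay : a * (-D.ξ₀ * q) = D.C1 * q := by
    rw [ha, ← mul_assoc, div_mul_cancel₀ _ s0.ne']
  have hdef := deficit_of_field_le (a := a) (D := E) (κ := κ) (y := -D.ξ₀ * q) a0.le hE.le hEκ
    (mul_nonneg s0.le (by linarith)) (by rw [y2]; linarith)
  rw [y2, ay, ← q2, ← D.ξ₀_sq] at hdef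
  obtain ⟨w, hw, hN, hle⟩ := htrial q hqq
  rw [q2] at hle
  refine not_normalMin hw (hle.trans_lt (mul_lt_mul_of_pos_right ?_ hN))
  rw [← q2]
  exact hdef

end SC

/-- Improved asymptotics of the global critical fields for the unit disc:
`H_{C3}(κ) = κ/Θ₀ + C₁ Θ₀^{-3/2} + O(κ^{-1})` for both the lower and upper field. -/
theorem hc3_asymptotics_disc (D : SC.DeGennes) :
    ∃ C > 0, ∃ κ₀ > 0, ∀ κ ≥ κ₀,
      |SC.HC3low SC.unitDisc κ - κ / SC.Theta0 - D.C1 * SC.Theta0 ^ (-(3 : ℝ) / 2)|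
          ≤ C * κ⁻¹ ∧
      |SC.HC3up SC.unitDisc κ - κ / SC.Theta0 - D.C1 * SC.Theta0 ^ (-(3 : ℝ) / 2)|
          ≤ C * κ⁻¹ := by
  obtain ⟨K, κ₁, hK, hκ₁, hs⟩ := D.exists_stable
  obtain ⟨K', κ₂, hK', hκ₂, hu⟩ := D.exists_unstable
  refine ⟨K + K', by positivity, κ₁ + κ₂, by positivity, fun κ hκ => ?_⟩
  have hκ0 : 0 < κ := by linarith
  have T0 : 0 < SC.Theta0 := by linarith [D.theta_lb]
  have C0 := D.C1_pos
  obtain ⟨G, hG⟩ : ∃ G, G = κ / SC.Theta0 + D.C1 * SC.Theta0 ^ (-(3 : ℝ) / 2) := ⟨_, rfl⟩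
  have G0 : 0 < G := by rw [hG]; positivity
  have p1 : 0 < K * κ⁻¹ := by positivity
  have p2 : 0 < K' * κ⁻¹ := by positivity
  replace hs := fun H => hs κ H (by linarith)
  replace hu := fun H => hu κ H (by linarith)
  rw [← hG] at hs hu
  have mem : G + K * κ⁻¹ ∈ {H : ℝ | 0 < H ∧ ∀ H', H < H' → SC.NormalUnique SC.unitDisc κ H'} :=
    ⟨by linarith, fun H' hH' => hs H' hH'.le⟩
  have mem' : G + K * κ⁻¹ ∈ {H : ℝ | 0 < H ∧ SC.NormalMin SC.unitDisc κ H} :=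
    ⟨by linarith, (hs _ le_rfl).1⟩
  have u1 : SC.HC3low SC.unitDisc κ ≤ G + K * κ⁻¹ := csInf_le ⟨0, fun H hH => hH.1.le⟩ mem'
  have u2 : SC.HC3up SC.unitDisc κ ≤ G + K * κ⁻¹ := csInf_le ⟨0, fun H hH => hH.1.le⟩ mem
  have l1 : G - K' * κ⁻¹ ≤ SC.HC3low SC.unitDisc κ := by
    refine le_csInf ⟨_, mem'⟩ fun H hH => ?_
    by_contra! hlt
    exact hu H hH.1 hlt.le hH.2
  have l2 : G - K' * κ⁻¹ ≤ SC.HC3up SC.unitDisc κ := by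
    refine le_csInf ⟨_, mem⟩ fun H hH => ?_
    by_contra! hlt
    obtain ⟨H', h1, h2⟩ := exists_between hlt
    exact hu H' (hH.1.trans h1) h2.le (hH.2 H' h1).1
  rw [add_mul]
  constructor <;> rw [abs_le] <;> constructor <;> linarith
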